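/- If a Turing degree is 2-random then it has no minimal predecessors, i.e. no degree below it is a minimal Turing degree. -/

import Mathlib

/-
Common framework: oracle (relative) partial computability via codes,
Turing reducibility, the jump, Cantor-space measure, Martin-Löf randomness
and genericity relative to an oracle, Turing functionals.
-/

open scoped ENNReal

namespace TypicalDegree

/-- Codes for partial functions recursive in an oracle (Kleene-style),
    following `Nat.Partrec.Code` with an extra `oracle` constructor. -/
inductive OracleCode : Type
  | zero : OracleCode
  | succ : OracleCode
  | left : OracleCode
  | right : OracleCode
  | oracle : OracleCode
  | pair : OracleCode → OracleCode → OracleCode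
  | comp : OracleCode → OracleCode → OracleCode
  | prec : OracleCode → OracleCode → OracleCode
  | rfind' : OracleCode → OracleCode

/-- Evaluation of an oracle code relative to an oracle `g : ℕ →. ℕ`. -/
def OracleCode.eval (g : ℕ →. ℕ) : OracleCode → ℕ →. ℕ
  | .zero => pure 0
  | .succ => Nat.succ
  | .left => ↑fun n : ℕ => n.unpair.1
  | .right => ↑fun n : ℕ => n.unpair.2
  | .oracle => g
  | .pair cf cg => fun n => Nat.pair <$> OracleCode.eval g cf n <*> OracleCode.eval g cg n
  | .comp cf cg => fun n => OracleCode.eval g cg n >>= OracleCode.eval g cf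
  | .prec cf cg =>
    Nat.unpaired fun a n =>
      n.rec (OracleCode.eval g cf a) fun y IH => do
        let i ← IH
        OracleCode.eval g cg (Nat.pair a (Nat.pair y i))
  | .rfind' cf =>
    Nat.unpaired fun a m =>
      (Nat.rfind fun n => (fun m => m = 0) <$> OracleCode.eval g cf (Nat.pair a (n + m))).map
        (· + m)

/-- An effective injective numbering of oracle codes. -/
def OracleCode.encodeCode : OracleCode → ℕ
  | .zero => 0
  | .succ => 1
  | .left => 2
  | .right => 3
  | .oracle => 4
  | .pair cf cg => 4 * Nat.pair cf.encodeCode cg.encodeCode + 5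
  | .comp cf cg => 4 * Nat.pair cf.encodeCode cg.encodeCode + 6
  | .prec cf cg => 4 * Nat.pair cf.encodeCode cg.encodeCode + 7
  | .rfind' cf => 4 * Nat.pair cf.encodeCode cf.encodeCode + 8

/-- The characteristic (total) oracle of an element of Cantor space. -/
def chi (X : ℕ → Bool) : ℕ →. ℕ := fun n => Part.some (cond (X n) 1 0)

/-- `f` is partial recursive relative to the oracle `g`. -/
def RedIn (f g : ℕ →. ℕ) : Prop := ∃ c : OracleCode, c.eval g = f

/-- A total function `ℕ → ℕ` viewed as a partial function. -/
def natFun (f : ℕ → ℕ) : ℕ →. ℕ := fun n => Part.some (f n)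

/-- Turing reducibility between elements of Cantor space. -/
def TRed (X Y : ℕ → Bool) : Prop := RedIn (chi X) (chi Y)

/-- Turing equivalence. -/
def TEquiv (X Y : ℕ → Bool) : Prop := TRed X Y ∧ TRed Y X

/-- `X` is computable. -/
def ComputableSeq (X : ℕ → Bool) : Prop := TRed X fun _ => false

/-- `f : ℕ → ℕ` is computable. -/
def ComputableFun (f : ℕ → ℕ) : Prop := RedIn (natFun f) (chi fun _ => false)

/-- The Turing jump of `X`: the halting problem relative to `X`,
    under the numbering `encodeCode`. -/
noncomputable def jump (X : ℕ → Bool) : ℕ → Bool := fun n =>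
  @decide (∃ c : OracleCode, c.encodeCode = n ∧ (c.eval (chi X) n).Dom) (Classical.dec _)

/-- `∅'`, the halting problem. -/
noncomputable def zeroJump : ℕ → Bool := jump fun _ => false

/-- `X` extends the finite binary string `σ` (i.e. `σ ⊂ X`). -/
def extendsStr (X : ℕ → Bool) (σ : List Bool) : Prop :=
  ∀ i : Fin σ.length, X i.1 = σ.get i

/-- `⟦V⟧`: the open set of infinite sequences extending some string in `V`. -/
def openOf (V : Set (List Bool)) : Set (ℕ → Bool) := {X | ∃ σ ∈ V, extendsStr X σ}

/-- The (fair-coin) measure of the open set `⟦V⟧` determined by a set of strings `V`: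
    the supremum over `n` of the proportion of length-`n` strings with a prefix in `V`. -/
noncomputable def stringMeasure (V : Set (List Bool)) : ℝ≥0∞ :=
  ⨆ n : ℕ, (Nat.card {f : Fin n → Bool // ∃ σ ∈ V, σ <+: List.ofFn f} : ℝ≥0∞) / 2 ^ n

/-- The fair-coin (Lebesgue) measure on Cantor space, as the outer measure obtained from
    open coverings by sets of strings; it agrees with Lebesgue measure on measurable sets. -/
noncomputable def cantorMeasure (S : Set (ℕ → Bool)) : ℝ≥0∞ :=
  ⨅ (V : Set (List Bool)) (_ : S ⊆ openOf V), stringMeasure V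

/-- `W` is computably enumerable relative to `X`. -/
def CEIn (X : ℕ → Bool) (W : Set (List Bool)) : Prop :=
  ∃ c : OracleCode, ∀ σ : List Bool, σ ∈ W ↔ (c.eval (chi X) (Encodable.encode σ)).Dom

/-- `W` is computably enumerable. -/
def CE (W : Set (List Bool)) : Prop := CEIn (fun _ => false) W

/-- The c.e. set of strings with index `d`. -/
def ceSetOf (d : OracleCode) : Set (List Bool) :=
  {σ | (d.eval (chi fun _ => false) (Encodable.encode σ)).Dom}

/-- The sequence `V` of sets of strings is uniformly c.e. relative to `X`. -/
def UniformCEIn (X : ℕ → Bool) (V : ℕ → Set (List Bool)) : Prop :=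
  ∃ c : OracleCode, ∀ (i : ℕ) (σ : List Bool),
    σ ∈ V i ↔ (c.eval (chi X) (Nat.pair i (Encodable.encode σ))).Dom

/-- A Martin-Löf test relative to `X`. -/
def MLTest (X : ℕ → Bool) (V : ℕ → Set (List Bool)) : Prop :=
  UniformCEIn X V ∧ ∀ i : ℕ, stringMeasure (V i) < (2 : ℝ≥0∞)⁻¹ ^ i

/-- `Y` is Martin-Löf random relative to `X`. -/
def MLRandomIn (X Y : ℕ → Bool) : Prop :=
  ∀ V : ℕ → Set (List Bool), MLTest X V → ∃ i, Y ∉ openOf (V i)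

/-- `Y` is 1-random. -/
def OneRandom (Y : ℕ → Bool) : Prop := MLRandomIn (fun _ => false) Y

/-- `Y` is 2-random: Martin-Löf random relative to `∅'`. -/
def TwoRandom (Y : ℕ → Bool) : Prop := MLRandomIn zeroJump Y

/-- `Y` is weakly 2-random: it avoids every null `Π⁰₂` class
    (every null intersection of a uniformly c.e. sequence of open sets). -/
def Weak2Random (Y : ℕ → Bool) : Prop :=
  ∀ V : ℕ → Set (List Bool), UniformCEIn (fun _ => false) V →
    cantorMeasure (⋂ i, openOf (V i)) = 0 → Y ∉ ⋂ i, openOf (V i)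

/-- `Y` is 1-generic relative to `X`. -/
def OneGenericIn (X Y : ℕ → Bool) : Prop :=
  ∀ W : Set (List Bool), CEIn X W →
    ∃ σ : List Bool, extendsStr Y σ ∧ (σ ∈ W ∨ ∀ τ : List Bool, σ <+: τ → τ ∉ W)

/-- `Y` is 1-generic. -/
def OneGeneric (Y : ℕ → Bool) : Prop := OneGenericIn (fun _ => false) Y

/-- `Y` is 2-generic: 1-generic relative to `∅'`. -/
def TwoGeneric (Y : ℕ → Bool) : Prop := OneGenericIn zeroJump Y

/-- The Turing functional coded by `c` is total on oracle `X` with value `Y ∈ 2^ω`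
    (i.e. `Ψ^X = Y`). -/
def FTotal (c : OracleCode) (X : ℕ → Bool) (Y : ℕ → Bool) : Prop :=
  c.eval (chi X) = chi Y

/-- `Ψ^X ⊇ σ`: the output of the functional `c` on oracle `X` extends the string `σ`. -/
def FExtends (c : OracleCode) (X : ℕ → Bool) (σ : List Bool) : Prop :=
  ∀ i : Fin σ.length, c.eval (chi X) i.1 = Part.some (cond (σ.get i) 1 0)

/-- `π(Ψ,σ) = μ({X : Ψ^X ⊇ σ})`. -/
noncomputable def piMeasure (c : OracleCode) (σ : List Bool) : ℝ≥0∞ :=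
  cantorMeasure {X | FExtends c X σ}

/-- A Turing functional is special if every infinite binary sequence
    in its range is incomputable. -/
def Special (c : OracleCode) : Prop :=
  ∀ X Y : ℕ → Bool, FTotal c X Y → ¬ ComputableSeq Y

/-- The code `c` computes the total function `T` on strings (no oracle). -/
def ComputesFun (c : OracleCode) (T : List Bool → Bool) : Prop :=
  ∀ σ : List Bool, c.eval (chi fun _ => false) (Encodable.encode σ) = Part.some (cond (T σ) 1 0)

/-- `T` is (the characteristic function of) a tree: closed under prefixes. -/
def IsTree (T : List Bool → Bool) : Prop :=
  ∀ σ τ : List Bool, σ <+: τ → T τ = true → T σ = true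

/-- The set of infinite paths through the tree `T`; `Π⁰₁` classes are the
    sets of paths through computable trees. -/
def pathsOf (T : List Bool → Bool) : Set (ℕ → Bool) :=
  {X | ∀ n : ℕ, T (List.ofFn fun i : Fin n => X i.1) = true}

/-- The computable join `X ⊕ Y`. -/
def join (X Y : ℕ → Bool) : ℕ → Bool := fun n =>
  if n % 2 = 0 then X (n / 2) else Y (n / 2)

/-- A finite string used as a (partial) oracle. -/
def strOracle (τ : List Bool) : ℕ →. ℕ := fun n =>
  if h : n < τ.length then Part.some (cond (τ.get ⟨n, h⟩) 1 0) else Part.none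

/-- `Ψ^{τ₀}` and `Ψ^{τ₁}` are incompatible: they give different outputs somewhere. -/
def SplitPair (c : OracleCode) (τ₀ τ₁ : List Bool) : Prop :=
  ∃ (n v₀ v₁ : ℕ), v₀ ∈ c.eval (strOracle τ₀) n ∧ v₁ ∈ c.eval (strOracle τ₁) n ∧ v₀ ≠ v₁

/-- `(U,V)` is a `Ψ`-splitting above `τ`. -/
def SplittingAbove (c : OracleCode) (τ : List Bool) (U V : Finset (List Bool)) : Prop :=
  (∃ ℓ : ℕ, ∀ σ ∈ U ∪ V, σ.length = ℓ ∧ τ <+: σ) ∧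
    ∀ σ₀ ∈ U, ∀ σ₁ ∈ V, SplitPair c σ₀ σ₁

/-- The output sequence `Ψ^X` of the functional `c` on oracle `X`
    (defaults to `false` when not total). -/
noncomputable def outSeq (c : OracleCode) (X : ℕ → Bool) : ℕ → Bool := fun n =>
  @dite _ (∃ Y : ℕ → Bool, FTotal c X Y) (Classical.dec _) (fun h => h.choose n) fun _ => false

/-- `Ψ^X ↾ n`, as a finite string. -/
noncomputable def outStr (c : OracleCode) (X : ℕ → Bool) (n : ℕ) : List Bool :=
  List.ofFn fun i : Fin n => outSeq c X i.1

/-- The degree of `M` is a minimal Turing degree. -/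
def MinimalDeg (M : ℕ → Bool) : Prop :=
  ¬ ComputableSeq M ∧ ∀ Z : ℕ → Bool, TRed Z M → ComputableSeq Z ∨ TRed M Z


section PartZ

theorem nil_prefix_le {α : Type*} {l : List α} : ([] : List α) <+: l := ⟨l, List.nil_append l⟩

theorem take_prefix_le {α : Type*} (n : ℕ) (l : List α) : l.take n <+: l :=
  ⟨l.drop n, List.take_append_drop n l⟩

theorem prefix_comparable {α : Type*} {l₁ l₂ l₃ : List α} (h₁ : l₁ <+: l₃) (h₂ : l₂ <+: l₃) :
    l₁ <+: l₂ ∨ l₂ <+: l₁ := by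
  rcases le_total l₁.length l₂.length with h | h
  · exact Or.inl (List.prefix_of_prefix_length_le h₁ h₂ h)
  · exact Or.inr (List.prefix_of_prefix_length_le h₂ h₁ h)

end PartZ

section PartA1

/-! ### Oracle codes -/

/-- Substitute a code for the oracle. -/
def OracleCode.subst (d : OracleCode) : OracleCode → OracleCode
  | .zero => .zero
  | .succ => .succ
  | .left => .left
  | .right => .right
  | .oracle => d
  | .pair a b => .pair (subst d a) (subst d b)
  | .comp a b => .comp (subst d a) (subst d b)
  | .prec a b => .prec (subst d a) (subst d b)
  | .rfind' a => .rfind' (subst d a)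

theorem OracleCode.eval_subst (g : ℕ →. ℕ) (d c : OracleCode) :
    (OracleCode.subst d c).eval g = c.eval (d.eval g) := by
  induction c <;> simp_all [OracleCode.subst, OracleCode.eval] <;> rfl

theorem RedIn.trans {f g h : ℕ →. ℕ} (h1 : RedIn f g) (h2 : RedIn g h) : RedIn f h := by
  obtain ⟨c, rfl⟩ := h1
  obtain ⟨d, rfl⟩ := h2
  exact ⟨_, OracleCode.eval_subst _ _ _⟩

theorem TRed.trans {X Y Z : ℕ → Bool} (h1 : TRed X Y) (h2 : TRed Y Z) : TRed X Z :=
  RedIn.trans h1 h2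

theorem ComputableSeq.tred {X : ℕ → Bool} (h : ComputableSeq X) (Y : ℕ → Bool) : TRed X Y := by
  refine TRed.trans h ⟨.zero, ?_⟩
  rfl

/-- Embed ordinary codes in oracle codes. -/
def ofCode : Nat.Partrec.Code → OracleCode
  | .zero => .zero
  | .succ => .succ
  | .left => .left
  | .right => .right
  | .pair a b => .pair (ofCode a) (ofCode b)
  | .comp a b => .comp (ofCode a) (ofCode b)
  | .prec a b => .prec (ofCode a) (ofCode b)
  | .rfind' a => .rfind' (ofCode a)

theorem eval_ofCode (g : ℕ →. ℕ) (c : Nat.Partrec.Code) : (ofCode c).eval g = c.eval := by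
  induction c <;> simp_all [ofCode, OracleCode.eval, Nat.Partrec.Code.eval] <;> rfl

theorem exists_ofPartrec {f : ℕ →. ℕ} (hf : Nat.Partrec f) :
    ∃ c : OracleCode, ∀ g, c.eval g = f := by
  obtain ⟨c, rfl⟩ := Nat.Partrec.Code.exists_code.1 hf
  exact ⟨ofCode c, fun g => eval_ofCode g c⟩

theorem exists_ofPrimrec {f : ℕ → ℕ} (hf : Primrec f) :
    ∃ c : OracleCode, ∀ g n, c.eval g n = Part.some (f n) := by
  obtain ⟨c, hc⟩ := exists_ofPartrec (f := (f : ℕ →. ℕ)) (Nat.Partrec.of_primrec (Primrec.nat_iff.1 hf))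
  exact ⟨c, fun g n => by rw [hc]; rfl⟩

theorem mem_eval_comp {g : ℕ →. ℕ} {a b : OracleCode} {n v : ℕ} :
    v ∈ (OracleCode.comp a b).eval g n ↔ ∃ x, x ∈ b.eval g n ∧ v ∈ a.eval g x := by
  have : (OracleCode.comp a b).eval g n = (b.eval g n).bind (fun x => a.eval g x) := rfl
  rw [this, Part.mem_bind_iff]

theorem mem_eval_pair {g : ℕ →. ℕ} {a b : OracleCode} {n v : ℕ} :
    v ∈ (OracleCode.pair a b).eval g n ↔ ∃ x y, x ∈ a.eval g n ∧ y ∈ b.eval g n ∧ v = Nat.pair x y := by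
  have : (OracleCode.pair a b).eval g n =
    ((a.eval g n).map Nat.pair).bind (fun f => (b.eval g n).map f) := rfl
  rw [this, Part.mem_bind_iff]
  simp only [Part.mem_map_iff]
  constructor
  · rintro ⟨f, ⟨x, hx, rfl⟩, y, hy, rfl⟩
    exact ⟨x, y, hx, hy, rfl⟩
  · rintro ⟨x, y, hx, hy, rfl⟩
    exact ⟨_, ⟨x, hx, rfl⟩, y, hy, rfl⟩

/-- Auxiliary primitive recursion. -/
def precAux (F H : ℕ → Part ℕ) (x : ℕ) : ℕ → Part ℕ
  | 0 => F x
  | n+1 => (precAux F H x n).bind fun i => H (Nat.pair x (Nat.pair n i))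

theorem eval_prec' (g : ℕ →. ℕ) (a b : OracleCode) (n : ℕ) :
    (OracleCode.prec a b).eval g n = precAux (fun x => a.eval g x) (fun x => b.eval g x) n.unpair.1 n.unpair.2 := by
  have : ∀ x m, (Nat.rec (a.eval g x) (fun y (IH : Part ℕ) => IH.bind fun i => b.eval g (Nat.pair x (Nat.pair y i))) m : Part ℕ) =
      precAux (fun x => a.eval g x) (fun x => b.eval g x) x m := by
    intro x m
    induction m with
    | zero => rfl
    | succ m ih => simp only [precAux]; rw [← ih]
  exact this _ _

theorem mem_precAux_succ {F H : ℕ → Part ℕ} {x n v : ℕ} :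
    v ∈ precAux F H x (n+1) ↔ ∃ i, i ∈ precAux F H x n ∧ v ∈ H (Nat.pair x (Nat.pair n i)) := by
  rw [precAux, Part.mem_bind_iff]

theorem mem_eval_rfind {g : ℕ →. ℕ} {a : OracleCode} {n v : ℕ} :
    v ∈ (OracleCode.rfind' a).eval g n ↔ ∃ w, v = w + n.unpair.2 ∧
      0 ∈ a.eval g (Nat.pair n.unpair.1 (w + n.unpair.2)) ∧
      ∀ j < w, ∃ y, y ≠ 0 ∧ y ∈ a.eval g (Nat.pair n.unpair.1 (j + n.unpair.2)) := by
  have : (OracleCode.rfind' a).eval g n = (Nat.rfind fun k =>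
    (a.eval g (Nat.pair n.unpair.1 (k + n.unpair.2))).map (fun m => decide (m = 0))).map (· + n.unpair.2) := rfl
  rw [this, Part.mem_map_iff]
  constructor
  · rintro ⟨w, hw, rfl⟩
    replace hw := Nat.mem_rfind.1 hw
    refine ⟨w, rfl, ?_, fun j hj => ?_⟩
    · obtain ⟨y, hy, hy'⟩ := (Part.mem_map_iff _).1 hw.1
      have : y = 0 := by simpa using hy'
      exact this ▸ hy
    · obtain ⟨y, hy, hy'⟩ := (Part.mem_map_iff _).1 (hw.2 hj)
      exact ⟨y, by simpa using hy', hy⟩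
  · rintro ⟨w, rfl, h0, h1⟩
    refine ⟨w, ?_, rfl⟩
    refine Nat.mem_rfind.2 ⟨(Part.mem_map_iff _).2 ⟨0, h0, by simp⟩, fun {j} hj => ?_⟩
    obtain ⟨y, hy, hy'⟩ := h1 j hj
    exact (Part.mem_map_iff _).2 ⟨y, hy', by simpa using hy⟩

theorem eval_comp_some {g : ℕ →. ℕ} {a b : OracleCode} {n m : ℕ} (h : b.eval g n = Part.some m) :
    (OracleCode.comp a b).eval g n = a.eval g m := by
  apply Part.ext
  intro v
  rw [mem_eval_comp, h]
  simp

theorem eval_pair_some {g : ℕ →. ℕ} {a b : OracleCode} {n m k : ℕ} (h : a.eval g n = Part.some m)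
    (h' : b.eval g n = Part.some k) :
    (OracleCode.pair a b).eval g n = Part.some (Nat.pair m k) := by
  apply Part.ext
  intro v
  rw [mem_eval_pair, h, h']
  simp

/-- Oracle restricted to initial segments. -/
def pre (X : ℕ → Bool) (k : ℕ) : List Bool := (List.range k).map X

@[simp] theorem pre_length (X : ℕ → Bool) (k : ℕ) : (pre X k).length = k := by simp [pre]

theorem pre_succ (X : ℕ → Bool) (k : ℕ) : pre X (k+1) = pre X k ++ [X k] := by
  simp [pre, List.range_succ]

theorem mem_strOracle {τ : List Bool} {n v : ℕ} :
    v ∈ strOracle τ n ↔ ∃ b, τ[n]? = some b ∧ v = cond b 1 0 := by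
  unfold strOracle
  split_ifs with h
  · simp [h]
  · simp [h]

theorem eval_mono {g g' : ℕ →. ℕ} (h : ∀ n v, v ∈ g n → v ∈ g' n) (c : OracleCode) :
    ∀ n v, v ∈ c.eval g n → v ∈ c.eval g' n := by
  induction c with
  | zero => exact fun _ _ h => h
  | succ => exact fun _ _ h => h
  | left => exact fun _ _ h => h
  | right => exact fun _ _ h => h
  | oracle => exact h
  | pair a b iha ihb =>
    intro n v hv
    rw [mem_eval_pair] at hv ⊢
    obtain ⟨x, y, hx, hy, rfl⟩ := hv
    exact ⟨x, y, iha _ _ hx, ihb _ _ hy, rfl⟩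
  | comp a b iha ihb =>
    intro n v hv
    rw [mem_eval_comp] at hv ⊢
    obtain ⟨x, hx, hy⟩ := hv
    exact ⟨x, ihb _ _ hx, iha _ _ hy⟩
  | prec a b iha ihb =>
    intro n v hv
    rw [eval_prec'] at hv ⊢
    generalize n.unpair.2 = m at hv ⊢
    induction m generalizing v with
    | zero => exact iha _ _ hv
    | succ k ih =>
      rw [mem_precAux_succ] at hv ⊢
      obtain ⟨w, hw, hv⟩ := hv
      exact ⟨w, ih _ hw, ihb _ _ hv⟩
  | rfind' a iha =>
    intro n v hv
    rw [mem_eval_rfind] at hv ⊢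
    obtain ⟨w, rfl, h0, h1⟩ := hv
    refine ⟨w, rfl, iha _ _ h0, fun j hj => ?_⟩
    obtain ⟨y, hy, hy'⟩ := h1 j hj
    exact ⟨y, hy, iha _ _ hy'⟩

theorem eval_cont {g : ℕ →. ℕ} {G : ℕ → ℕ →. ℕ} (hG : ∀ k k', k ≤ k' → ∀ n v, v ∈ G k n → v ∈ G k' n)
    (h : ∀ n v, v ∈ g n → ∃ k, v ∈ G k n) (c : OracleCode) :
    ∀ n v, v ∈ c.eval g n → ∃ k, v ∈ c.eval (G k) n := by
  have mono : ∀ (c : OracleCode) {k k'}, k ≤ k' → ∀ {n v}, v ∈ c.eval (G k) n → v ∈ c.eval (G k') n :=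
    fun c k k' hk n v hv => eval_mono (hG k k' hk) c n v hv
  induction c with
  | zero => exact fun _ _ h => ⟨0, h⟩
  | succ => exact fun _ _ h => ⟨0, h⟩
  | left => exact fun _ _ h => ⟨0, h⟩
  | right => exact fun _ _ h => ⟨0, h⟩
  | oracle => exact h
  | pair a b iha ihb =>
    intro n v hv
    rw [mem_eval_pair] at hv
    obtain ⟨x, y, hx, hy, rfl⟩ := hv
    obtain ⟨k, hk⟩ := iha _ _ hx
    obtain ⟨k', hk'⟩ := ihb _ _ hy
    refine ⟨max k k', ?_⟩
    rw [mem_eval_pair]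
    exact ⟨x, y, mono _ (le_max_left _ _) hk, mono _ (le_max_right _ _) hk', rfl⟩
  | comp a b iha ihb =>
    intro n v hv
    rw [mem_eval_comp] at hv
    obtain ⟨x, hx, hy⟩ := hv
    obtain ⟨k, hk⟩ := ihb _ _ hx
    obtain ⟨k', hk'⟩ := iha _ _ hy
    refine ⟨max k k', ?_⟩
    rw [mem_eval_comp]
    exact ⟨x, mono _ (le_max_left _ _) hk, mono _ (le_max_right _ _) hk'⟩
  | prec a b iha ihb =>
    intro n v hv
    simp only [eval_prec'] at hv ⊢
    generalize n.unpair.2 = m at hv ⊢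
    generalize n.unpair.1 = x at hv ⊢
    have key : ∀ (m v : ℕ) k k', k ≤ k' →
        v ∈ precAux (fun x => a.eval (G k) x) (fun x => b.eval (G k) x) x m →
        v ∈ precAux (fun x => a.eval (G k') x) (fun x => b.eval (G k') x) x m := by
      intro m v k k' hk hv
      induction m generalizing v with
      | zero => exact mono _ hk hv
      | succ m ih =>
        rw [mem_precAux_succ] at hv ⊢
        obtain ⟨w, hw, hv⟩ := hv
        exact ⟨w, ih _ hw, mono _ hk hv⟩
    induction m generalizing v with
    | zero => exact iha _ _ hv
    | succ m ih =>
      rw [mem_precAux_succ] at hv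
      obtain ⟨w, hw, hv⟩ := hv
      obtain ⟨k, hk⟩ := ih _ hw
      obtain ⟨k', hk'⟩ := ihb _ _ hv
      refine ⟨max k k', ?_⟩
      rw [mem_precAux_succ]
      exact ⟨w, key _ _ _ _ (le_max_left _ _) hk, mono _ (le_max_right _ _) hk'⟩
  | rfind' a iha =>
    intro n v hv
    rw [mem_eval_rfind] at hv
    obtain ⟨w, rfl, h0, h1⟩ := hv
    obtain ⟨k, hk⟩ := iha _ _ h0
    have : ∀ m ≤ w, ∃ K, ∀ j < m, ∃ y, y ≠ 0 ∧ y ∈ a.eval (G K) (Nat.pair n.unpair.1 (j + n.unpair.2)) := by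
      intro m
      induction m with
      | zero => exact fun _ => ⟨0, by simp⟩
      | succ m ih =>
        intro hm
        obtain ⟨K, hK⟩ := ih (by omega)
        obtain ⟨y, hy, hy'⟩ := h1 m (by omega)
        obtain ⟨K', hK'⟩ := iha _ _ hy'
        refine ⟨max K K', fun j hj => ?_⟩
        rcases Nat.lt_succ_iff_lt_or_eq.1 hj with hj | rfl
        · obtain ⟨y, hy, hy'⟩ := hK j hj
          exact ⟨y, hy, mono _ (le_max_left _ _) hy'⟩
        · exact ⟨y, hy, mono _ (le_max_right _ _) hK'⟩
    obtain ⟨K, hK⟩ := this w le_rfl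
    refine ⟨max k K, ?_⟩
    rw [mem_eval_rfind]
    refine ⟨w, rfl, mono _ (le_max_left _ _) hk, fun j hj => ?_⟩
    obtain ⟨y, hy, hy'⟩ := hK j hj
    exact ⟨y, hy, mono _ (le_max_right _ _) hy'⟩

theorem pre_getElem? (X : ℕ → Bool) (k n : ℕ) : (pre X k)[n]? = if n < k then some (X n) else none := by
  unfold pre
  split_ifs with h <;> simp [h]

theorem strOracle_mono {σ τ : List Bool} (h : σ <+: τ) (n v : ℕ) (hv : v ∈ strOracle σ n) :
    v ∈ strOracle τ n := by
  rw [mem_strOracle] at *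
  obtain ⟨b, hb, rfl⟩ := hv
  obtain ⟨r, rfl⟩ := h
  refine ⟨b, ?_, rfl⟩
  rw [List.getElem?_append_left]
  · exact hb
  · exact (List.getElem?_eq_some_iff.1 hb).1

theorem pre_prefix_le (X : ℕ → Bool) {k k' : ℕ} (h : k ≤ k') : pre X k <+: pre X k' := by
  induction h with
  | refl => exact List.prefix_rfl
  | step h ih => rw [pre_succ]; exact ih.trans (List.prefix_append _ _)

theorem mem_eval_chi_iff {c : OracleCode} {X : ℕ → Bool} {n v : ℕ} :
    v ∈ c.eval (chi X) n ↔ ∃ k, v ∈ c.eval (strOracle (pre X k)) n := by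
  constructor
  · refine eval_cont (G := fun k => strOracle (pre X k)) (fun k k' hk n v => strOracle_mono (pre_prefix_le X hk) n v) ?_ c n v
    intro n v hv
    refine ⟨n+1, ?_⟩
    rw [mem_strOracle]
    refine ⟨X n, ?_, by simpa [chi] using hv⟩
    rw [pre_getElem?, if_pos (Nat.lt_succ_self n)]
  · rintro ⟨k, hk⟩
    refine eval_mono ?_ c n v hk
    intro n v hv
    rw [mem_strOracle] at hv
    obtain ⟨b, hb, rfl⟩ := hv
    rw [pre_getElem?] at hb
    split_ifs at hb with h
    simp at hb
    simp [chi, hb]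

theorem partrec_eval_strOracle (c : OracleCode) :
    Partrec fun p : List Bool × ℕ => c.eval (strOracle p.1) p.2 := by
  induction c with
  | zero => exact (Computable.const 0)
  | succ => exact (Computable.succ.comp Computable.snd)
  | left => exact ((Computable.fst.comp Computable.unpair).comp Computable.snd)
  | right => exact ((Computable.snd.comp Computable.unpair).comp Computable.snd)
  | oracle =>
    have h : Computable fun p : List Bool × ℕ => (p.1[p.2]?).map (fun b => cond b 1 0) := by
      refine Primrec.to_comp (Primrec.option_map ?_ ?_)
      · exact Primrec.list_getElem?.comp Primrec.fst Primrec.snd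
      · exact (Primrec.dom_bool (fun b => cond b 1 0)).comp Primrec.snd
    refine (Computable.ofOption h).of_eq fun p => ?_
    apply Part.ext
    intro v
    rw [OracleCode.eval, mem_strOracle]
    simp [eq_comm]
  | pair a b iha ihb =>
    have : Partrec fun p : List Bool × ℕ => (a.eval (strOracle p.1) p.2).bind fun x => (b.eval (strOracle p.1) p.2).map (fun y => Nat.pair x y) := by
      refine Partrec.bind iha (Partrec.map (ihb.comp Computable.fst) ?_)
      exact (Primrec₂.natPair.comp (Primrec.snd.comp Primrec.fst) Primrec.snd).to_comp
    refine this.of_eq fun p => ?_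
    simp [OracleCode.eval, Seq.seq, Part.bind_map]
  | comp a b iha ihb =>
    have h1 : Partrec₂ fun (p : List Bool × ℕ) (y : ℕ) => (a.eval (strOracle p.1) y : Part ℕ) :=
      iha.comp ((Computable.fst.comp Computable.fst).pair Computable.snd)
    refine (Partrec.bind ihb h1).of_eq fun p => Part.ext fun v => ?_
    rw [mem_eval_comp, Part.mem_bind_iff]
  | prec a b iha ihb =>
    have h1 : Computable fun p : List Bool × ℕ => p.2.unpair.2 :=
      (Computable.snd.comp Computable.unpair).comp Computable.snd
    have h2 : Partrec fun p : List Bool × ℕ => a.eval (strOracle p.1) p.2.unpair.1 :=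
      iha.comp (Computable.fst.pair ((Computable.fst.comp Computable.unpair).comp Computable.snd))
    have h3 : Partrec₂ fun (p : List Bool × ℕ) (q : ℕ × ℕ) =>
        (b.eval (strOracle p.1) (Nat.pair p.2.unpair.1 (Nat.pair q.1 q.2)) : Part ℕ) := by
      have e1 : Computable fun q : (List Bool × ℕ) × ℕ × ℕ => q.1.2.unpair.1 :=
        (Computable.fst.comp Computable.unpair).comp (Computable.snd.comp Computable.fst)
      have e2 : Computable fun q : (List Bool × ℕ) × ℕ × ℕ => Nat.pair q.2.1 q.2.2 :=
        Primrec₂.natPair.to_comp.comp (Computable.fst.comp Computable.snd) (Computable.snd.comp Computable.snd)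
      have e3 : Computable fun q : (List Bool × ℕ) × ℕ × ℕ => Nat.pair q.1.2.unpair.1 (Nat.pair q.2.1 q.2.2) :=
        Primrec₂.natPair.to_comp.comp e1 e2
      exact ihb.comp ((Computable.fst.comp Computable.fst).pair e3)
    refine (Partrec.nat_rec h1 h2 h3).of_eq fun p => ?_
    rw [eval_prec']
    generalize p.2.unpair.2 = m
    induction m with
    | zero => rfl
    | succ m ih => 
      simp only [precAux]
      rw [← ih]
  | rfind' a iha =>
    have h0 : Partrec₂ fun (p : List Bool × ℕ) (n : ℕ) => ((a.eval (strOracle p.1) (Nat.pair p.2.unpair.1 (n + p.2.unpair.2))).map fun m => decide (m = 0) : Part Bool) := by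
      have e1 : Computable fun q : (List Bool × ℕ) × ℕ => q.1.2.unpair.1 :=
        (Computable.fst.comp Computable.unpair).comp (Computable.snd.comp Computable.fst)
      have e2 : Computable fun q : (List Bool × ℕ) × ℕ => q.2 + q.1.2.unpair.2 :=
        Primrec.nat_add.to_comp.comp Computable.snd ((Computable.snd.comp Computable.unpair).comp (Computable.snd.comp Computable.fst))
      have e3 : Computable fun q : (List Bool × ℕ) × ℕ => Nat.pair q.1.2.unpair.1 (q.2 + q.1.2.unpair.2) :=
        Primrec₂.natPair.to_comp.comp e1 e2
      have e4 : Partrec fun q : (List Bool × ℕ) × ℕ => (a.eval (strOracle q.1.1) (Nat.pair q.1.2.unpair.1 (q.2 + q.1.2.unpair.2)) : Part ℕ) :=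
        iha.comp ((Computable.fst.comp Computable.fst).pair e3)
      have e5 : Primrec fun m : ℕ => decide (m = 0) := (PrimrecRel.comp Primrec.eq Primrec.id (Primrec.const 0)).decide
      have e6 : Computable₂ fun (q : (List Bool × ℕ) × ℕ) (m : ℕ) => decide (m = 0) :=
        (e5.comp Primrec.snd).to_comp
      exact Partrec.map e4 e6
    have h2 : Computable₂ fun (p : List Bool × ℕ) (n : ℕ) => n + p.2.unpair.2 :=
      (Primrec.nat_add.comp Primrec.snd (((Primrec.snd.comp Primrec.unpair).comp (Primrec.snd.comp Primrec.fst)))).to_comp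
    exact (Partrec.map (Partrec.rfind h0) h2).of_eq fun p => rfl


end PartA1

section PartA2
open Encodable

theorem exists_code_of_partrec {α : Type*} [Primcodable α] {f : α →. ℕ} (hf : Partrec f) :
    ∃ c : Nat.Partrec.Code, ∀ a, c.eval (encode a) = f a := by
  obtain ⟨c, hc⟩ := Nat.Partrec.Code.exists_code.1 hf
  refine ⟨c, fun a => ?_⟩
  rw [hc]
  apply Part.ext
  intro v
  simp [encodek]

theorem exists_code_re {α : Type*} [Primcodable α] {R : α → ℕ → Bool} (hR : Primrec₂ R) :
    ∃ e : Nat.Partrec.Code, ∀ a, (e.eval (encode a)).Dom ↔ ∃ k, R a k = true := by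
  have h0 : Computable₂ R := hR.to_comp
  obtain ⟨c, hc⟩ := exists_code_of_partrec (Partrec.rfind (p := fun a k => Part.some (R a k)) h0)
  refine ⟨c, fun a => ?_⟩
  rw [hc]
  refine Nat.rfind_dom.trans ⟨fun ⟨k, h, _⟩ => ⟨k, (Part.mem_some_iff.1 h).symm⟩,
    fun ⟨k, h⟩ => ⟨k, Part.mem_some_iff.2 h.symm, fun _ => trivial⟩⟩

/-- Constant codes. -/
def kcode : ℕ → OracleCode
  | 0 => .zero
  | n+1 => .comp .succ (kcode n)

theorem eval_kcode (g : ℕ →. ℕ) (n x : ℕ) : (kcode n).eval g x = Part.some n := by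
  induction n with
  | zero => rfl
  | succ n ih => rw [kcode, eval_comp_some ih]; rfl

theorem primrec_encode_kcode : Primrec fun n => (kcode n).encodeCode := by
  have : Primrec fun n : ℕ => (Nat.rec 0 (fun _ i => 4 * Nat.pair 1 i + 6) n : ℕ) := by
    refine Primrec.nat_rec₁ 0 ?_
    refine Primrec.nat_add.comp (Primrec.nat_mul.comp (Primrec.const 4) (Primrec₂.natPair.comp (Primrec.const 1) Primrec.snd)) (Primrec.const 6)
  refine this.of_eq fun n => ?_
  induction n with
  | zero => rfl
  | succ n ih => simp only [kcode, OracleCode.encodeCode]; rw [← ih]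

theorem encodeCode_inj : ∀ {c d : OracleCode}, c.encodeCode = d.encodeCode → c = d := by
  intro c
  induction c with
  | pair a b iha ihb =>
    intro d h
    cases d <;> simp only [OracleCode.encodeCode] at h <;> try omega
    rename_i a' b'
    have : Nat.pair a.encodeCode b.encodeCode = Nat.pair a'.encodeCode b'.encodeCode := by omega
    rw [Nat.pair_eq_pair] at this
    rw [iha this.1, ihb this.2]
  | comp a b iha ihb =>
    intro d h
    cases d <;> simp only [OracleCode.encodeCode] at h <;> try omega
    rename_i a' b'
    have : Nat.pair a.encodeCode b.encodeCode = Nat.pair a'.encodeCode b'.encodeCode := by omega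
    rw [Nat.pair_eq_pair] at this
    rw [iha this.1, ihb this.2]
  | prec a b iha ihb =>
    intro d h
    cases d <;> simp only [OracleCode.encodeCode] at h <;> try omega
    rename_i a' b'
    have : Nat.pair a.encodeCode b.encodeCode = Nat.pair a'.encodeCode b'.encodeCode := by omega
    rw [Nat.pair_eq_pair] at this
    rw [iha this.1, ihb this.2]
  | rfind' a iha =>
    intro d h
    cases d <;> simp only [OracleCode.encodeCode] at h <;> try omega
    rename_i a'
    have : Nat.pair a.encodeCode a.encodeCode = Nat.pair a'.encodeCode a'.encodeCode := by omega
    rw [Nat.pair_eq_pair] at this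
    rw [iha this.1]
  | zero => intro d h; cases d <;> simp only [OracleCode.encodeCode] at h <;> first | rfl | omega
  | succ => intro d h; cases d <;> simp only [OracleCode.encodeCode] at h <;> first | rfl | omega
  | left => intro d h; cases d <;> simp only [OracleCode.encodeCode] at h <;> first | rfl | omega
  | right => intro d h; cases d <;> simp only [OracleCode.encodeCode] at h <;> first | rfl | omega
  | oracle => intro d h; cases d <;> simp only [OracleCode.encodeCode] at h <;> first | rfl | omega

theorem zeroJump_code (c : OracleCode) :
    zeroJump c.encodeCode = true ↔ (c.eval (chi fun _ => false) c.encodeCode).Dom := by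
  unfold zeroJump jump
  refine (@decide_eq_true_iff _ (Classical.dec _)).trans ?_
  constructor
  · rintro ⟨d, hd, h⟩
    rwa [encodeCode_inj hd] at h
  · exact fun h => ⟨c, rfl, h⟩

theorem sigma2_uniformCE {V : ℕ → Set (List Bool)} {R : (ℕ × List Bool) × ℕ → ℕ → Bool}
    (hR : Primrec₂ R) (h : ∀ i σ, σ ∈ V i ↔ ∃ a, ∀ b, R ((i, σ), a) b = true) :
    UniformCEIn zeroJump V := by
  obtain ⟨e, he⟩ := exists_code_re (R := fun p b => !R p b) (Primrec.not.comp hR)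
  set d := ofCode e
  have hd : ∀ g p, (d.eval g (encode p)).Dom ↔ ∃ b, R p b = false := by
    intro g p
    rw [eval_ofCode, he]
    simp
  -- query function
  let q : ℕ → ℕ := fun n => (OracleCode.comp d (kcode n)).encodeCode
  have hq : Primrec q := by
    refine Primrec.nat_add.comp (Primrec.nat_mul.comp (Primrec.const 4) (Primrec₂.natPair.comp (Primrec.const _) primrec_encode_kcode)) (Primrec.const 6)
  have hq' : ∀ p, zeroJump (q (encode p)) = true ↔ ∃ b, R p b = false := by
    intro p
    rw [zeroJump_code, eval_comp_some (eval_kcode _ _ _), hd]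
  obtain ⟨Q, hQ⟩ := exists_ofPrimrec hq
  obtain ⟨P, hP⟩ := exists_ofPrimrec (f := fun n => Nat.pair n 0) (Primrec₂.natPair.comp Primrec.id (Primrec.const 0))
  refine ⟨.comp (.rfind' (.comp .oracle Q)) P, fun i σ => ?_⟩
  rw [eval_comp_some (hP _ _), h]
  have key : ∀ a, (OracleCode.comp .oracle Q).eval (chi zeroJump) (Nat.pair (Nat.pair i (encode σ)) a) =
      Part.some (cond (zeroJump (q (encode ((i, σ), a)))) 1 0) := by
    intro a
    rw [eval_comp_some (hQ _ _)]
    rfl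
  have key2 : ∀ a, (∀ b, R ((i, σ), a) b = true) ↔ zeroJump (q (encode ((i, σ), a))) = false := by
    intro a
    rw [← Bool.not_eq_true, hq']
    push Not
    simp
  simp only [key2]
  rw [Part.dom_iff_mem]
  constructor
  · intro hex
    classical
    refine ⟨_, mem_eval_rfind.2 ⟨Nat.find hex, rfl, ?_, fun j hj => ?_⟩⟩
    · simp only [Nat.unpair_pair, Nat.add_zero]
      rw [key, Nat.find_spec hex]
      simp
    · have := Nat.find_min hex hj
      simp only [Nat.unpair_pair, Nat.add_zero]
      rw [key]
      simp only [Bool.not_eq_false] at this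
      rw [this]
      exact ⟨1, by simp⟩
  · rintro ⟨v, hv⟩
    obtain ⟨w, -, hw, -⟩ := mem_eval_rfind.1 hv
    simp only [Nat.unpair_pair, Nat.add_zero] at hw
    rw [key] at hw
    refine ⟨w, ?_⟩
    by_contra hc
    simp only [Bool.not_eq_false] at hc
    rw [hc] at hw
    simp at hw

theorem tred_of_search {M Z : ℕ → Bool} {h : List Bool → ℕ → Option Bool} (hh : Primrec₂ h)
    (H : ∀ n, ∃ k, (h (pre M k) n).isSome) (H' : ∀ n k b, h (pre M k) n = some b → b = Z n) :
    TRed Z M := by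
  -- code for initial segments
  let app : ℕ → ℕ := fun p => encode (((decode (α := List Bool) p.unpair.1).getD []) ++ [decide (p.unpair.2 = 1)])
  have happ : Primrec app := by
    refine Primrec.encode.comp (Primrec.list_append.comp (Primrec.option_getD.comp (Primrec.decode.comp (Primrec.fst.comp Primrec.unpair)) (Primrec.const [])) ?_)
    exact Primrec.list_cons.comp (Primrec.eq.decide.comp (Primrec.snd.comp Primrec.unpair) (Primrec.const 1)) (Primrec.const [])
  obtain ⟨A, hA⟩ := exists_ofPrimrec happ
  let snd' : ℕ → ℕ := fun p => p.unpair.2.unpair.2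
  let fst' : ℕ → ℕ := fun p => p.unpair.2.unpair.1
  obtain ⟨S, hS⟩ := exists_ofPrimrec (f := snd') (Primrec.snd.comp (Primrec.unpair.comp (Primrec.snd.comp Primrec.unpair)))
  obtain ⟨F, hF⟩ := exists_ofPrimrec (f := fst') (Primrec.fst.comp (Primrec.unpair.comp (Primrec.snd.comp Primrec.unpair)))
  let G : OracleCode := .prec (kcode (encode ([] : List Bool))) (.comp A (.pair S (.comp .oracle F)))
  have hG : ∀ n k, G.eval (chi M) (Nat.pair n k) = Part.some (encode (pre M k)) := by
    intro n k
    rw [eval_prec']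
    simp only [Nat.unpair_pair]
    induction k with
    | zero => simp only [precAux]; rw [eval_kcode]; rfl
    | succ k ih =>
      rw [precAux, ih, Part.bind_some]
      rw [eval_comp_some (m := Nat.pair (encode (pre M k)) (cond (M k) 1 0))]
      · rw [hA]
        simp only [app, Nat.unpair_pair, encodek, Option.getD_some, pre_succ]
        cases M k <;> rfl
      · apply eval_pair_some
        · rw [hS]; simp [snd']
        · rw [eval_comp_some (hF _ _)]
          simp [fst', OracleCode.eval, chi]
  -- test
  let t : ℕ → ℕ := fun p => match h ((decode (α := List Bool) p.unpair.1).getD []) p.unpair.2 with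
    | none => 2 | some b => cond b 1 0
  have ht : Primrec t := by
    have h1 : Primrec fun p : ℕ => h ((decode (α := List Bool) p.unpair.1).getD []) p.unpair.2 :=
      hh.comp (Primrec.option_getD.comp (Primrec.decode.comp (Primrec.fst.comp Primrec.unpair)) (Primrec.const [])) (Primrec.snd.comp Primrec.unpair)
    refine (Primrec.option_casesOn h1 (Primrec.const 2) ((Primrec.dom_bool (fun b => cond b 1 0)).comp Primrec.snd).to₂).of_eq fun p => ?_
    simp only [t]
    cases h ((decode (α := List Bool) p.unpair.1).getD []) p.unpair.2 <;> rfl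
  have ht' : ∀ k n, t (Nat.pair (encode (pre M k)) n) = match h (pre M k) n with
    | none => 2 | some b => cond b 1 0 := by
    intro k n; simp [t]
  obtain ⟨T, hT⟩ := exists_ofPrimrec ht
  -- n,k ↦ t(M|k,n)
  let U : OracleCode := .comp T (.pair G .left)
  have hU : ∀ n k, U.eval (chi M) (Nat.pair n k) = Part.some (t (Nat.pair (encode (pre M k)) n)) := by
    intro n k
    rw [eval_comp_some (m := Nat.pair (encode (pre M k)) n) (eval_pair_some (hG n k) (by simp [OracleCode.eval])), hT]
  obtain ⟨N, hN⟩ := exists_ofPrimrec (f := fun v => v - 1) (Primrec.nat_sub.comp Primrec.id (Primrec.const 1))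
  obtain ⟨P, hP⟩ := exists_ofPrimrec (f := fun n => Nat.pair n 0) (Primrec₂.natPair.comp Primrec.id (Primrec.const 0))
  obtain ⟨I, hI⟩ := exists_ofPrimrec (f := fun n => n) Primrec.id
  let B : OracleCode := .comp (.rfind' (.comp N U)) P
  have hB : ∀ n, ∃ k b, h (pre M k) n = some b ∧ B.eval (chi M) n = Part.some k := by
    intro n
    classical
    have key : ∀ k, (OracleCode.comp N U).eval (chi M) (Nat.pair n k) = Part.some (t (Nat.pair (encode (pre M k)) n) - 1) := by
      intro k
      rw [eval_comp_some (hU n k), hN]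
    obtain ⟨b, hb⟩ := Option.isSome_iff_exists.1 (Nat.find_spec (H n))
    refine ⟨Nat.find (H n), b, hb, ?_⟩
    rw [Part.eq_some_iff, eval_comp_some (hP _ _), mem_eval_rfind]
    refine ⟨Nat.find (H n), by simp, ?_, fun j hj => ?_⟩
    · simp only [Nat.unpair_pair, Nat.add_zero]
      rw [key, ht', hb]
      cases b <;> simp
    · have hm := Nat.find_min (H n) hj
      simp only [Nat.unpair_pair, Nat.add_zero]
      rw [key, ht']
      simp only [Bool.not_eq_true, Option.isSome_eq_false_iff, Option.isNone_iff_eq_none] at hm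
      rw [hm]
      exact ⟨1, by simp⟩
  refine ⟨.comp U (.pair I B), ?_⟩
  funext n
  obtain ⟨k, b, hb, hk⟩ := hB n
  rw [eval_comp_some (eval_pair_some (hI _ _) hk), hU, ht', hb, H' _ _ _ hb]
  rfl

theorem computableSeq_of_search {Z : ℕ → Bool} {h : ℕ → ℕ → Option Bool} (hh : Primrec₂ h)
    (H : ∀ n, ∃ k, (h k n).isSome) (H' : ∀ n k b, h k n = some b → b = Z n) :
    ComputableSeq Z := by
  refine tred_of_search (h := fun x n => h x.length n) (hh.comp (Primrec.list_length.comp Primrec.fst) Primrec.snd) ?_ ?_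
  · simpa using H
  · simpa using H'


end PartA2

section PartA3
open Encodable

/-- Longest initial run of defined bits. -/
def run (f : ℕ → Option Bool) : ℕ → List Bool
  | 0 => []
  | m+1 => if (run f m).length = m then run f m ++ (f m).toList else run f m

theorem run_length_le (f : ℕ → Option Bool) (m : ℕ) : (run f m).length ≤ m := by
  induction m with
  | zero => simp [run]
  | succ m ih =>
    rw [run]
    split_ifs
    · cases f m <;> simp <;> omega
    · omega

theorem run_mono_right (f : ℕ → Option Bool) {a b : ℕ} (h : a ≤ b) : run f a <+: run f b := by
  induction h with
  | refl => exact List.prefix_rfl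
  | step h ih =>
    refine ih.trans ?_
    rw [run]
    split_ifs
    · exact List.prefix_append _ _
    · exact List.prefix_rfl

theorem run_mono_left {f g : ℕ → Option Bool} (h : ∀ n b, f n = some b → g n = some b) (a : ℕ) :
    run f a <+: run g a := by
  induction a with
  | zero => simp [run]
  | succ m ih =>
    by_cases hl : (run f m).length = m
    · have he : run f m = run g m := ih.eq_of_length (by
        have := run_length_le g m
        have := ih.length_le
        omega)
      cases hf : f m with
      | none =>
        have : run f (m+1) = run f m := by simp [run, hf]
        rw [this]
        exact ih.trans (run_mono_right g (Nat.le_succ m))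
      | some b =>
        have : run f (m+1) = run g (m+1) := by
          rw [run, run, ← he, hf, h _ _ hf]
        rw [this]
    · have : run f (m+1) = run f m := by simp [run, hl]
      rw [this]
      exact ih.trans (run_mono_right g (Nat.le_succ m))

theorem run_some (M : ℕ → Bool) (m : ℕ) : run (fun n => some (M n)) m = pre M m := by
  induction m with
  | zero => rfl
  | succ m ih => rw [run, ih, pre_succ]; simp

theorem run_length_eq {f : ℕ → Option Bool} {n : ℕ} (h : ∀ j < n, (f j).isSome) : (run f n).length = n := by
  induction n with
  | zero => rfl
  | succ n ih =>
    have h1 := ih (fun j hj => h j (by omega))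
    obtain ⟨b, hb⟩ := Option.isSome_iff_exists.1 (h n (by omega))
    rw [run, if_pos h1, hb]
    simp [h1]

theorem prefix_pre {M : ℕ → Bool} {n : ℕ} {y : List Bool} (h : y <+: pre M n) : y = pre M y.length := by
  have h2 := pre_prefix_le M (le_of_le_of_eq h.length_le (pre_length M n))
  exact (List.prefix_of_prefix_length_le h h2 (by simp)).eq_of_length (by simp)

theorem exists_psi {A M : ℕ → Bool} (h : TRed M A) : ∃ ψ : List Bool → List Bool, Primrec ψ ∧
    (∀ x y, x <+: y → ψ x <+: ψ y) ∧ (∀ x, (ψ x).length ≤ x.length) ∧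
    (∀ k, ψ (pre A k) = pre M (ψ (pre A k)).length) ∧ ∀ n, ∃ k, n ≤ (ψ (pre A k)).length := by
  obtain ⟨c, hc⟩ := h
  obtain ⟨d, hd⟩ := exists_code_of_partrec (partrec_eval_strOracle c)
  replace hd : ∀ (x : List Bool) (n : ℕ), d.eval (Nat.pair (encode x) n) = c.eval (strOracle x) n := fun x n => hd (x, n)
  let hh : List Bool → ℕ → Option Bool := fun x n =>
    ((List.range (x.length+1)).filterMap (fun k => Nat.Partrec.Code.evaln x.length d (Nat.pair (encode (x.take k)) n))).head?.map (fun v => decide (v = 1))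
  have hhp : Primrec₂ hh := by
    refine Primrec.option_map (Primrec.list_head?.comp (Primrec.listFilterMap (f := fun p : List Bool × ℕ => List.range (p.1.length+1)) (g := fun p k => Nat.Partrec.Code.evaln p.1.length d (Nat.pair (encode (p.1.take k)) p.2)) ?_ ?_)) ?_
    · exact Primrec.list_range.comp (Primrec.succ.comp (Primrec.list_length.comp Primrec.fst))
    · refine Nat.Partrec.Code.primrec_evaln.comp (((Primrec.list_length.comp (Primrec.fst.comp Primrec.fst)).pair (Primrec.const d)).pair ?_)
      refine Primrec₂.natPair.comp (Primrec.encode.comp (Primrec.list_take.comp Primrec.snd (Primrec.fst.comp Primrec.fst))) (Primrec.snd.comp Primrec.fst)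
    · exact (Primrec.eq.decide.comp Primrec.snd (Primrec.const 1))
  have hh1 : ∀ x n b, hh x n = some b → ∃ v ∈ c.eval (strOracle x) n, b = decide (v = 1) := by
    intro x n b hb
    simp only [hh, Option.map_eq_some_iff] at hb
    obtain ⟨v, hv, rfl⟩ := hb
    refine ⟨v, ?_, rfl⟩
    have hv' := List.mem_of_mem_head? hv
    rw [List.mem_filterMap] at hv'
    obtain ⟨k, -, hk⟩ := hv'
    have := Nat.Partrec.Code.evaln_sound hk
    rw [hd] at this
    exact eval_mono (strOracle_mono (take_prefix_le k x)) c n v this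
  have hh2 : ∀ x n k v, k ≤ x.length → v ∈ Nat.Partrec.Code.evaln x.length d (Nat.pair (encode (x.take k)) n) → (hh x n).isSome := by
    intro x n k v hk hv
    simp only [hh, Option.isSome_map, List.isSome_head?]
    refine List.ne_nil_of_mem (a := v) ?_
    rw [List.mem_filterMap]
    exact ⟨k, by simp; omega, hv⟩
  have hh3 : ∀ x y n, x <+: y → (hh x n).isSome → (hh y n).isSome := by
    intro x y n hxy hx
    obtain ⟨b, hb⟩ := Option.isSome_iff_exists.1 hx
    simp only [hh, Option.map_eq_some_iff] at hb
    obtain ⟨v, hv, -⟩ := hb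
    have hv' := List.mem_of_mem_head? hv
    rw [List.mem_filterMap] at hv'
    obtain ⟨k, hk1, hk⟩ := hv'
    have hk1 : k ≤ x.length := by simp at hk1; omega
    have hl := hxy.length_le
    refine hh2 y n k v (hk1.trans hl) (Nat.Partrec.Code.evaln_mono hl ?_)
    have : y.take k = x.take k := by
      obtain ⟨r, rfl⟩ := hxy
      exact List.take_append_of_le_length hk1
    rw [this]
    exact hk
  have hmono : ∀ x y, x <+: y → ∀ n b, hh x n = some b → hh y n = some b := by
    intro x y hxy n b hb
    obtain ⟨b', hb'⟩ := Option.isSome_iff_exists.1 (hh3 x y n hxy (by rw [hb]; rfl))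
    rw [hb']
    obtain ⟨v, hv, rfl⟩ := hh1 _ _ _ hb
    obtain ⟨v', hv', rfl⟩ := hh1 _ _ _ hb'
    have := eval_mono (strOracle_mono hxy) c n v hv
    rw [Part.mem_unique this hv']
  refine ⟨fun x => run (hh x) x.length, ?_, ?_, fun x => run_length_le _ _, ?_, ?_⟩
  · have : Primrec fun x : List Bool => (Nat.rec [] (fun m (l : List Bool) => if l.length = m then l ++ (hh x m).toList else l) x.length : List Bool) := by
      refine Primrec.nat_rec' (β := List Bool) (f := List.length) (g := fun _ => []) (h := fun x q => if q.2.length = q.1 then q.2 ++ (hh x q.1).toList else q.2) Primrec.list_length (Primrec.const []) ?_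
      have e : Primrec fun q : List Bool × ℕ × List Bool => q.2.2 := Primrec.snd.comp Primrec.snd
      refine Primrec.ite (PrimrecRel.comp Primrec.eq (Primrec.list_length.comp e) (Primrec.fst.comp Primrec.snd)) ?_ (Primrec.snd.comp Primrec.snd)
      refine Primrec.list_append.comp (Primrec.snd.comp Primrec.snd) (Primrec.optionToList.comp (hhp.comp Primrec.fst (Primrec.fst.comp Primrec.snd)))
    refine this.of_eq fun x => ?_
    generalize x.length = m
    induction m with
    | zero => rfl
    | succ m ih => simp only [run]; rw [← ih]
  · intro x y hxy
    exact (run_mono_left (hmono x y hxy) _).trans (run_mono_right _ hxy.length_le)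
  · intro k
    refine prefix_pre (n := k) ?_
    rw [← run_some M]
    simp only [pre_length]
    refine run_mono_left ?_ _
    intro n b hb
    obtain ⟨v, hv, rfl⟩ := hh1 _ _ _ hb
    have : v ∈ c.eval (chi A) n := mem_eval_chi_iff.2 ⟨k, hv⟩
    rw [hc, chi, Part.mem_some_iff] at this
    subst this
    cases M n <;> rfl
  · intro n
    have h1 : ∀ j, ∃ k, (hh (pre A k) j).isSome := by
      intro j
      have : cond (M j) 1 0 ∈ c.eval (chi A) j := by rw [hc]; simp [chi]
      obtain ⟨k, hk⟩ := mem_eval_chi_iff.1 this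
      rw [← hd] at hk
      obtain ⟨s, hs⟩ := Nat.Partrec.Code.evaln_complete.1 hk
      refine ⟨max k s, hh2 _ _ k (cond (M j) 1 0) (by simp) (Nat.Partrec.Code.evaln_mono (k₁ := s) (by simp) ?_)⟩
      have : (pre A (max k s)).take k = pre A k := by
        have h := pre_prefix_le A (le_max_left k s)
        have := prefix_pre ((take_prefix_le k (pre A (max k s))))
        rw [this]; simp
      rw [this]
      exact hs
    have h2 : ∃ k, ∀ j < n, (hh (pre A k) j).isSome := by
      clear * - h1 hh3
      induction n with
      | zero => exact ⟨0, by simp⟩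
      | succ n ih =>
        obtain ⟨k, hk⟩ := ih
        obtain ⟨k', hk'⟩ := h1 n
        refine ⟨max k k', fun j hj => ?_⟩
        rcases Nat.lt_succ_iff_lt_or_eq.1 hj with hj | rfl
        · exact hh3 _ _ _ (pre_prefix_le A (le_max_left _ _)) (hk j hj)
        · exact hh3 _ _ _ (pre_prefix_le A (le_max_right _ _)) hk'
    obtain ⟨k, hk⟩ := h2
    refine ⟨max k n, ?_⟩
    have h3 : ∀ j < n, (hh (pre A (max k n)) j).isSome := fun j hj => hh3 _ _ _ (pre_prefix_le A (le_max_left _ _)) (hk j hj)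
    have := (run_mono_right (hh (pre A (max k n))) (le_max_right k n)).length_le
    rw [run_length_eq h3] at this
    simpa using this


end PartA3

section PartA0
open Encodable

/-- 1-genericity phrased with ordinary codes. -/
def Generic1 (Z : ℕ → Bool) : Prop := ∀ e : Nat.Partrec.Code, ∃ n, (e.eval (encode (pre Z n))).Dom ∨
  ∀ σ, pre Z n <+: σ → ¬ (e.eval (encode σ)).Dom

/-- Parity part of a sequence. -/
def half (b : ℕ) (Z : ℕ → Bool) : ℕ → Bool := fun n => Z (2 * n + b)

/-- Parity part of a string. -/
def halfL (b : ℕ) (ζ : List Bool) : List Bool := (List.range (ζ.length / 2)).map fun j => ζ.getD (2 * j + b) false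

theorem halfL_pre {b : ℕ} (hb : b ≤ 1) (Z : ℕ → Bool) (n : ℕ) : halfL b (pre Z n) = pre (half b Z) (n / 2) := by
  unfold halfL
  rw [pre_length, pre.eq_def (half b Z)]
  apply List.map_congr_left
  intro j hj
  have : j < n / 2 := by simpa using hj
  rw [List.getD_eq_getElem?_getD, pre_getElem?, if_pos (by omega)]
  rfl

theorem primrec_halfL (b : ℕ) : Primrec (halfL b) := by
  refine Primrec.list_map (f := fun ζ : List Bool => List.range (ζ.length / 2)) (g := fun ζ j => ζ.getD (2 * j + b) false) ?_ ?_
  · exact Primrec.list_range.comp (Primrec.nat_div.comp Primrec.list_length (Primrec.const 2))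
  · exact (Primrec.list_getD false).comp Primrec.fst (Primrec.nat_add.comp (Primrec.nat_mul.comp (Primrec.const 2) Primrec.snd) (Primrec.const b))

theorem half_tred (b : ℕ) (Z : ℕ → Bool) : TRed (half b Z) Z := by
  refine tred_of_search (h := fun x n => x[2 * n + b]?) ?_ ?_ ?_
  · exact Primrec.list_getElem?.comp Primrec.fst (Primrec.nat_add.comp (Primrec.nat_mul.comp (Primrec.const 2) Primrec.snd) (Primrec.const b))
  · intro n
    refine ⟨2 * n + b + 1, ?_⟩
    rw [pre_getElem?, if_pos (by omega)]; rfl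
  · intro n k c h
    rw [pre_getElem?] at h
    split_ifs at h
    simpa [half, eq_comm] using h

theorem half_not_tred {Z : ℕ → Bool} (hZ : Generic1 Z) {b c : ℕ} (hb : b ≤ 1) (hbc : b ≠ c) (hc : c ≤ 1) :
    ¬ TRed (half c Z) (half b Z) := by
  rintro ⟨k, hk⟩
  obtain ⟨d, hd⟩ := exists_code_of_partrec (partrec_eval_strOracle k)
  replace hd : ∀ (x : List Bool) (n : ℕ), d.eval (Nat.pair (encode x) n) = k.eval (strOracle x) n := fun x n => hd (x, n)
  let E : List Bool → ℕ → Option ℕ := fun ζ m => Nat.Partrec.Code.evaln m.unpair.2 d (Nat.pair (encode (halfL b ζ)) m.unpair.1)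
  let R : List Bool → ℕ → Bool := fun ζ m => decide (2 * m.unpair.1 + c < ζ.length) && ((E ζ m).isSome &&
    !decide (E ζ m = some (cond (ζ.getD (2 * m.unpair.1 + c) false) 1 0)))
  have hE : Primrec₂ E := by
    refine Nat.Partrec.Code.primrec_evaln.comp (((Primrec.snd.comp (Primrec.unpair.comp Primrec.snd)).pair (Primrec.const d)).pair ?_)
    refine Primrec₂.natPair.comp (Primrec.encode.comp ((primrec_halfL b).comp Primrec.fst)) (Primrec.fst.comp (Primrec.unpair.comp Primrec.snd))
  have hix : Primrec fun p : List Bool × ℕ => 2 * p.2.unpair.1 + c :=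
    Primrec.nat_add.comp (Primrec.nat_mul.comp (Primrec.const 2) (Primrec.fst.comp (Primrec.unpair.comp Primrec.snd))) (Primrec.const c)
  have hR : Primrec₂ R := by
    refine Primrec.and.comp (Primrec.nat_lt.decide.comp hix (Primrec.list_length.comp Primrec.fst)) (Primrec.and.comp (Primrec.option_isSome.comp hE) (Primrec.not.comp ?_))
    refine Primrec.eq.decide.comp hE (Primrec.option_some.comp ((Primrec.dom_bool fun b => cond b 1 0).comp ((Primrec.list_getD false).comp Primrec.fst hix)))
  obtain ⟨e, he⟩ := exists_code_re hR
  obtain ⟨n0, h | h⟩ := hZ e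
  · rw [he] at h
    obtain ⟨m, hm⟩ := h
    simp only [R, Bool.and_eq_true, decide_eq_true_eq, Bool.not_eq_true', decide_eq_false_iff_not] at hm
    obtain ⟨hm1, hm2, hm3⟩ := hm
    obtain ⟨v, hv⟩ := Option.isSome_iff_exists.1 hm2
    have h1 := Nat.Partrec.Code.evaln_sound hv
    rw [hd, halfL_pre hb] at h1
    have h2 := mem_eval_chi_iff.2 ⟨_, h1⟩
    rw [hk, chi, Part.mem_some_iff] at h2
    rw [hv, h2] at hm3
    apply hm3
    rw [List.getD_eq_getElem?_getD, pre_getElem?, if_pos (by simpa using hm1)]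
    rfl
  · have h1 : cond (half c Z n0) 1 0 ∈ k.eval (chi (half b Z)) n0 := by rw [hk]; simp [chi]
    obtain ⟨m', h1⟩ := mem_eval_chi_iff.1 h1
    obtain ⟨m, hm', hm⟩ : ∃ m, m' ≤ m ∧ n0 + 1 ≤ m := ⟨max m' (n0+1), by simp, by simp⟩
    replace h1 := eval_mono (strOracle_mono (pre_prefix_le (half b Z) hm')) k _ _ h1
    let Z' : ℕ → Bool := Function.update Z (2 * n0 + c) (!Z (2 * n0 + c))
    have hZ' : half b Z' = half b Z := by
      funext j
      simp only [half, Z']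
      rw [Function.update_of_ne]
      omega
    have hp : pre Z' n0 = pre Z n0 := by
      apply List.map_congr_left
      intro j hj
      have : j < n0 := by simpa using hj
      simp only [Z']
      rw [Function.update_of_ne]
      omega
    refine h (pre Z' (2 * m)) (hp ▸ pre_prefix_le Z' (by omega)) ?_
    rw [he]
    rw [← hZ', ← hd] at h1
    obtain ⟨s, hs⟩ := Nat.Partrec.Code.evaln_complete.1 h1
    refine ⟨Nat.pair n0 s, ?_⟩
    have hE' : E (pre Z' (2 * m)) (Nat.pair n0 s) = some (cond (half c Z n0) 1 0) := by
      simp only [E, Nat.unpair_pair]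
      rw [halfL_pre hb, Nat.mul_div_cancel_left _ (by norm_num)]
      exact hs
    simp only [R, hE', Nat.unpair_pair]
    rw [List.getD_eq_getElem?_getD, pre_getElem?, if_pos (by omega)]
    have : Z' (2 * n0 + c) = !Z (2 * n0 + c) := by simp [Z']
    simp only [Option.getD_some, this, half, pre_length]
    cases Z (2 * n0 + c) <;> simp <;> omega

theorem not_minimal_of_generic {M Z : ℕ → Bool} (hZ : Generic1 Z) (hZM : TRed Z M) : ¬ MinimalDeg M := by
  rintro ⟨-, hmin⟩
  rcases hmin (half 0 Z) ((half_tred 0 Z).trans hZM) with h | h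
  · exact half_not_tred hZ (b := 1) (c := 0) (by norm_num) (by norm_num) (by norm_num) (h.tred _)
  · exact half_not_tred hZ (b := 0) (c := 1) (by norm_num) (by norm_num) (by norm_num) (((half_tred 1 Z).trans hZM).trans h)


end PartA0

section PartB1
open Encodable

/-! ### Primitive recursion helpers -/

section prim
variable {α β : Type*} [Primcodable α] [Primcodable β]

theorem prim_filter {f : α → List β} {p : α → β → Bool} (hf : Primrec f) (hp : Primrec₂ p) :
    Primrec fun a => (f a).filter (p a) := by
  have : Primrec fun a => (f a).filterMap fun b => if p a b = true then some b else none := by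
    refine Primrec.listFilterMap hf ?_
    exact Primrec.ite (Primrec.eq.comp hp (Primrec.const true)) (Primrec.option_some.comp Primrec.snd) (Primrec.const none)
  refine this.of_eq fun a => ?_
  induction f a with
  | nil => rfl
  | cons b l ih => 
    cases h : p a b <;> simp [h, ih]

theorem prim_countP {f : α → List β} {p : α → β → Bool} (hf : Primrec f) (hp : Primrec₂ p) :
    Primrec fun a => (f a).countP (p a) :=
  (Primrec.list_length.comp (prim_filter hf hp)).of_eq fun a => (List.countP_eq_length_filter).symm

theorem prim_all {f : α → List β} {p : α → β → Bool} (hf : Primrec f) (hp : Primrec₂ p) :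
    Primrec fun a => (f a).all (p a) := by
  have : Primrec fun a => decide ((f a).countP (p a) = (f a).length) :=
    Primrec.eq.decide.comp (prim_countP hf hp) (Primrec.list_length.comp hf)
  refine this.of_eq fun a => ?_
  rw [Bool.eq_iff_iff]
  simp [List.countP_eq_length]

theorem prim_any {f : α → List β} {p : α → β → Bool} (hf : Primrec f) (hp : Primrec₂ p) :
    Primrec fun a => (f a).any (p a) := by
  have : Primrec fun a => !((f a).all fun b => !p a b) :=
    Primrec.not.comp (prim_all hf (Primrec.not.comp hp))
  refine this.of_eq fun a => ?_
  rw [Bool.eq_iff_iff]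
  simp

theorem prim_pow : Primrec₂ ((· ^ ·) : ℕ → ℕ → ℕ) := Primrec₂.unpaired'.1 Nat.Primrec.pow

end prim

/-- Boolean initial segment test. -/
def pfx (x y : List Bool) : Bool := decide (y.take x.length = x)

theorem pfx_iff {x y : List Bool} : pfx x y = true ↔ x <+: y := by
  simp only [pfx, decide_eq_true_eq]
  rw [List.prefix_iff_eq_take, eq_comm]

theorem prim_pfx {α : Type*} [Primcodable α] {f g : α → List Bool} (hf : Primrec f) (hg : Primrec g) :
    Primrec fun a => pfx (f a) (g a) :=
  Primrec.eq.decide.comp (Primrec.list_take.comp (Primrec.list_length.comp hf) hg) hf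

/-- All strings of length `s`. -/
def strs : ℕ → List (List Bool)
  | 0 => [[]]
  | s+1 => (strs s).flatMap fun x => [x ++ [false], x ++ [true]]

theorem prim_strs : Primrec strs := by
  have : Primrec fun s : ℕ => (Nat.rec [[]] (fun _ l => l.flatMap fun x => [x ++ [false], x ++ [true]]) s : List (List Bool)) := by
    refine Primrec.nat_rec₁ _ ?_
    refine Primrec.list_flatMap Primrec.snd ?_
    refine Primrec.list_cons.comp ?_ (Primrec.list_cons.comp ?_ (Primrec.const []))
    · exact Primrec.list_append.comp Primrec.snd (Primrec.const _)
    · exact Primrec.list_append.comp Primrec.snd (Primrec.const _)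
  refine this.of_eq fun s => ?_
  induction s with
  | zero => rfl
  | succ s ih => rw [strs, ← ih]

theorem mem_strs {s : ℕ} {x : List Bool} : x ∈ strs s ↔ x.length = s := by
  induction s generalizing x with
  | zero => simp [strs]
  | succ s ih =>
    simp only [strs, List.mem_flatMap, List.mem_cons, List.not_mem_nil, or_false]
    constructor
    · rintro ⟨y, hy, rfl | rfl⟩ <;> simp [ih.1 hy]
    · intro h
      have hne : x ≠ [] := by rintro rfl; simp at h
      refine ⟨x.dropLast, ih.2 (by simp [h]), ?_⟩
      have := List.dropLast_append_getLast hne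
      cases hb : x.getLast hne <;> rw [hb] at this <;> simp [this]

theorem nodup_strs (s : ℕ) : (strs s).Nodup := by
  induction s with
  | zero => simp [strs]
  | succ s ih =>
    rw [strs, List.nodup_flatMap]
    refine ⟨fun x _ => by simp, ?_⟩
    refine ih.imp ?_
    intro x y hxy
    simp [List.disjoint_left, hxy]

/-- All prefixes of `v` satisfy `q`. -/
def allp (v : List Bool) (q : List Bool → Bool) : Bool := (List.range (v.length + 1)).all fun n => q (v.take n)

theorem allp_iff {v : List Bool} {q : List Bool → Bool} : allp v q = true ↔ ∀ τ, τ <+: v → q τ = true := by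
  simp only [allp, List.all_eq_true, List.mem_range]
  constructor
  · intro h τ hτ
    have := h τ.length (Nat.lt_succ_of_le hτ.length_le)
    rwa [← List.prefix_iff_eq_take.1 hτ] at this
  · intro h n _
    exact h _ (take_prefix_le _ _)

theorem prim_allp {α : Type*} [Primcodable α] {f : α → List Bool} {q : α → List Bool → Bool}
    (hf : Primrec f) (hq : Primrec₂ q) : Primrec fun a => allp (f a) (q a) := by
  refine prim_all (f := fun a => List.range ((f a).length + 1)) (p := fun a n => q a ((f a).take n)) ?_ ?_
  · exact Primrec.list_range.comp (Primrec.succ.comp (Primrec.list_length.comp hf))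
  · exact hq.comp Primrec.fst (Primrec.list_take.comp Primrec.snd (hf.comp Primrec.fst))

/-! ### The construction -/

/-- Local removal criterion. -/
def okL (C l : ℕ) (K : List (List Bool)) (τ : List Bool) : Bool :=
  decide (K.countP (pfx τ) ≤ C * K.countP (fun v => pfx τ v && decide (l ≤ v.length)))

theorem prim_okL {α : Type*} [Primcodable α] {C l : α → ℕ} {K : α → List (List Bool)} {τ : α → List Bool}
    (hC : Primrec C) (hl : Primrec l) (hK : Primrec K) (hτ : Primrec τ) :
    Primrec fun x => okL (C x) (l x) (K x) (τ x) := by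
  have h1 : Primrec fun x => (K x).countP (pfx (τ x)) :=
    prim_countP hK (p := fun x v => pfx (τ x) v) (prim_pfx (hτ.comp Primrec.fst) Primrec.snd)
  have h2 : Primrec fun x => (K x).countP (fun v => pfx (τ x) v && decide (l x ≤ v.length)) :=
    prim_countP hK (p := fun x v => pfx (τ x) v && decide (l x ≤ v.length))
      (Primrec.and.comp (prim_pfx (hτ.comp Primrec.fst) Primrec.snd)
        (Primrec.nat_le.decide.comp (hl.comp Primrec.fst) (Primrec.list_length.comp Primrec.snd)))
  exact Primrec.nat_le.decide.comp h1 (Primrec.nat_mul.comp hC h2)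

/-- Survivors of the removal process. -/
def KL (ψ : List Bool → List Bool) (C s : ℕ) : ℕ → List (List Bool)
  | 0 => (strs s).map ψ
  | l+1 => (KL ψ C s l).filter fun v => allp v (okL C l (KL ψ C s l))

variable {ψ : List Bool → List Bool}

theorem prim_KL (hψ : Primrec ψ) : Primrec fun p : (ℕ × ℕ) × ℕ => KL ψ p.1.1 p.1.2 p.2 := by
  have : Primrec₂ fun (p : ℕ × ℕ) (l : ℕ) => (Nat.rec ((strs p.2).map ψ) (fun l K => K.filter fun v => allp v (okL p.1 l K)) l : List (List Bool)) := by
    refine Primrec.nat_rec (f := fun p : ℕ × ℕ => (strs p.2).map ψ) (g := fun p q => q.2.filter fun v => allp v (okL p.1 q.1 q.2)) ?_ ?_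
    · exact Primrec.list_map (prim_strs.comp Primrec.snd) (hψ.comp Primrec.snd)
    · have h2 : Primrec fun q : (ℕ × ℕ) × ℕ × List (List Bool) => q.2.2 := Primrec.snd.comp Primrec.snd
      refine prim_filter h2 ?_
      refine prim_allp (f := fun q : ((ℕ × ℕ) × ℕ × List (List Bool)) × List Bool => q.2) (q := fun q τ => okL q.1.1.1 q.1.2.1 q.1.2.2 τ) Primrec.snd ?_
      have g1 : Primrec fun q : (((ℕ × ℕ) × ℕ × List (List Bool)) × List Bool) × List Bool => q.1.1.1.1 :=
        Primrec.fst.comp (Primrec.fst.comp (Primrec.fst.comp Primrec.fst))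
      have g2 : Primrec fun q : (((ℕ × ℕ) × ℕ × List (List Bool)) × List Bool) × List Bool => q.1.1.2.1 :=
        Primrec.fst.comp (Primrec.snd.comp (Primrec.fst.comp Primrec.fst))
      have g3 : Primrec fun q : (((ℕ × ℕ) × ℕ × List (List Bool)) × List Bool) × List Bool => q.1.1.2.2 :=
        Primrec.snd.comp (Primrec.snd.comp (Primrec.fst.comp Primrec.fst))
      exact prim_okL g1 g2 g3 Primrec.snd
  refine Primrec.of_eq this fun p => ?_
  obtain ⟨⟨C, s⟩, l⟩ := p
  dsimp only
  induction l with
  | zero => rfl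
  | succ l ih => rw [KL, ← ih]

/-- Removal criterion at stage `s`, step `l`. -/
def ok (ψ : List Bool → List Bool) (C s l : ℕ) (τ : List Bool) : Bool := okL C l (KL ψ C s l) τ

/-- `y` is allowed at stage `s`. -/
def allowed (ψ : List Bool → List Bool) (C s : ℕ) (y : List Bool) : Bool :=
  (List.range (y.length + 1)).all fun l => allp y (ok ψ C s l)

theorem prim_allowed (hψ : Primrec ψ) : Primrec fun p : (ℕ × ℕ) × List Bool => allowed ψ p.1.1 p.1.2 p.2 := by
  refine prim_all (f := fun p : (ℕ × ℕ) × List Bool => List.range (p.2.length + 1)) (p := fun p l => allp p.2 (ok ψ p.1.1 p.1.2 l)) ?_ ?_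
  · exact Primrec.list_range.comp (Primrec.succ.comp (Primrec.list_length.comp Primrec.snd))
  · refine prim_allp (f := fun q : ((ℕ × ℕ) × List Bool) × ℕ => q.1.2) (q := fun q τ => ok ψ q.1.1.1 q.1.1.2 q.2 τ) (Primrec.snd.comp Primrec.fst) ?_
    have g1 : Primrec fun q : (((ℕ × ℕ) × List Bool) × ℕ) × List Bool => q.1.1.1.1 :=
      Primrec.fst.comp (Primrec.fst.comp (Primrec.fst.comp Primrec.fst))
    have g2 : Primrec fun q : (((ℕ × ℕ) × List Bool) × ℕ) × List Bool => q.1.2 := Primrec.snd.comp Primrec.fst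
    have g0 : Primrec fun q : (((ℕ × ℕ) × List Bool) × ℕ) × List Bool => q.1.1.1 :=
      Primrec.fst.comp (Primrec.fst.comp Primrec.fst)
    have g3 : Primrec fun q : (((ℕ × ℕ) × List Bool) × ℕ) × List Bool => KL ψ q.1.1.1.1 q.1.1.1.2 q.1.2 :=
      (prim_KL hψ).comp (Primrec.pair g0 g2)
    exact prim_okL g1 g2 g3 Primrec.snd

/-- Activation stage of `z`, if it is at most `s`. -/
def aOpt (ψ : List Bool → List Bool) (C s : ℕ) (z : List Bool) : Option ℕ :=
  ((List.range (s + 1)).filter fun a => decide (z.length ≤ a) && allowed ψ C a z).head?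

theorem prim_aOpt (hψ : Primrec ψ) : Primrec fun p : (ℕ × ℕ) × List Bool => aOpt ψ p.1.1 p.1.2 p.2 := by
  refine Primrec.list_head?.comp (prim_filter (f := fun p : (ℕ × ℕ) × List Bool => List.range (p.1.2 + 1))
    (p := fun p a => decide (p.2.length ≤ a) && allowed ψ p.1.1 a p.2) ?_ ?_)
  · exact Primrec.list_range.comp (Primrec.succ.comp (Primrec.snd.comp Primrec.fst))
  · refine Primrec.and.comp (Primrec.nat_le.decide.comp (Primrec.list_length.comp (Primrec.snd.comp Primrec.fst)) Primrec.snd) ?_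
    exact (prim_allowed hψ).comp (Primrec.pair (Primrec.pair (Primrec.fst.comp (Primrec.fst.comp Primrec.fst)) Primrec.snd) (Primrec.snd.comp Primrec.fst))

/-- Number of strings of length `s` mapped above `τ`. -/
def mm (ψ : List Bool → List Bool) (s : ℕ) (τ : List Bool) : ℕ := (strs s).countP fun x => pfx τ (ψ x)

theorem prim_mm (hψ : Primrec ψ) : Primrec₂ (mm ψ) :=
  prim_countP (f := fun p : ℕ × List Bool => strs p.1) (p := fun p x => pfx p.2 (ψ x)) (prim_strs.comp Primrec.fst)
    (prim_pfx (Primrec.snd.comp Primrec.fst) (hψ.comp Primrec.snd))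

/-- Search for an extension of `ζ` in the `e`-th c.e. set. -/
def succL (e : ℕ) (ζ : List Bool) (t : ℕ) : Option (List Bool) :=
  ((List.range (t + 1)).filterMap fun n => (decode (α := List Bool) n).bind fun η =>
    if (pfx ζ η && (Nat.Partrec.Code.evaln t (Denumerable.ofNat Nat.Partrec.Code e) (encode η)).isSome) = true then some η else none).head?

theorem prim_succL : Primrec fun p : (ℕ × List Bool) × ℕ => succL p.1.1 p.1.2 p.2 := by
  refine Primrec.list_head?.comp (Primrec.listFilterMap (f := fun p : (ℕ × List Bool) × ℕ => List.range (p.2 + 1))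
    (g := fun p n => (decode (α := List Bool) n).bind fun η =>
    if (pfx p.1.2 η && (Nat.Partrec.Code.evaln p.2 (Denumerable.ofNat Nat.Partrec.Code p.1.1) (encode η)).isSome) = true then some η else none) ?_ ?_)
  · exact Primrec.list_range.comp (Primrec.succ.comp Primrec.snd)
  · refine Primrec.option_bind (Primrec.decode.comp Primrec.snd) ?_
    refine Primrec.ite (Primrec.eq.comp (Primrec.and.comp ?_ (Primrec.option_isSome.comp ?_)) (Primrec.const true)) (Primrec.option_some.comp Primrec.snd) (Primrec.const none)
    · exact prim_pfx (Primrec.snd.comp (Primrec.fst.comp (Primrec.fst.comp Primrec.fst))) Primrec.snd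
    · refine Nat.Partrec.Code.primrec_evaln.comp (Primrec.pair (Primrec.pair (Primrec.snd.comp (Primrec.fst.comp Primrec.fst)) ((Primrec.ofNat _).comp ?_)) (Primrec.encode.comp Primrec.snd))
      exact Primrec.fst.comp (Primrec.fst.comp (Primrec.fst.comp Primrec.fst))

/-- Is `τ` still heavy at stage `s`? -/
def heavy (ψ : List Bool → List Bool) (i e a s : ℕ) (z τ : List Bool) : Bool :=
  decide (mm ψ a z * 2 ^ s ≤ mm ψ s τ * 2 ^ (e + i + 4) * 2 ^ a)

/-- One step of the moving target. -/
def rstep (ψ : List Bool → List Bool) (i e : ℕ) (z : List Bool) (s : ℕ) (r : List Bool) : List Bool :=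
  match aOpt ψ (2 ^ (i + 2)) s z with
  | none => r
  | some a => if heavy ψ i e a (s + 1) z (r ++ [false]) = true then r ++ [false]
      else if heavy ψ i e a (s + 1) z (r ++ [true]) = true then r ++ [true] else r

/-- The moving target. -/
def rr (ψ : List Bool → List Bool) (i e : ℕ) (z : List Bool) : ℕ → List Bool
  | 0 => z
  | s+1 => rstep ψ i e z s (rr ψ i e z s)

theorem prim_heavy (hψ : Primrec ψ) {α : Type*} [Primcodable α] {i e a s : α → ℕ} {z τ : α → List Bool}
    (hi : Primrec i) (he : Primrec e) (ha : Primrec a) (hs : Primrec s) (hz : Primrec z) (hτ : Primrec τ) :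
    Primrec fun x => heavy ψ (i x) (e x) (a x) (s x) (z x) (τ x) := by
  refine Primrec.nat_le.decide.comp (Primrec.nat_mul.comp ((prim_mm hψ).comp ha hz) (prim_pow.comp (Primrec.const 2) hs))
    (Primrec.nat_mul.comp (Primrec.nat_mul.comp ((prim_mm hψ).comp hs hτ) (prim_pow.comp (Primrec.const 2) ?_)) (prim_pow.comp (Primrec.const 2) ha))
  exact Primrec.nat_add.comp (Primrec.nat_add.comp he hi) (Primrec.const 4)

theorem prim_rstep (hψ : Primrec ψ) {α : Type*} [Primcodable α] {i e s : α → ℕ} {z r : α → List Bool}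
    (hi : Primrec i) (he : Primrec e) (hs : Primrec s) (hz : Primrec z) (hr : Primrec r) :
    Primrec fun x => rstep ψ (i x) (e x) (z x) (s x) (r x) := by
  have h1 : Primrec fun x => aOpt ψ (2 ^ (i x + 2)) (s x) (z x) :=
    (prim_aOpt hψ).comp (Primrec.pair (Primrec.pair (prim_pow.comp (Primrec.const 2) (Primrec.nat_add.comp hi (Primrec.const 2))) hs) hz)
  have hrb : ∀ b, Primrec fun x : α × ℕ => r x.1 ++ [b] := fun b => Primrec.list_append.comp (hr.comp Primrec.fst) (Primrec.const _)
  have hh : ∀ b, Primrec fun x : α × ℕ => heavy ψ (i x.1) (e x.1) x.2 (s x.1 + 1) (z x.1) (r x.1 ++ [b]) := fun b =>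
    prim_heavy hψ (hi.comp Primrec.fst) (he.comp Primrec.fst) Primrec.snd (Primrec.succ.comp (hs.comp Primrec.fst)) (hz.comp Primrec.fst) (hrb b)
  have h2 : Primrec₂ fun (x : α) (a : ℕ) => if heavy ψ (i x) (e x) a (s x + 1) (z x) (r x ++ [false]) = true then r x ++ [false]
      else if heavy ψ (i x) (e x) a (s x + 1) (z x) (r x ++ [true]) = true then r x ++ [true] else r x :=
    Primrec.ite (Primrec.eq.comp (hh false) (Primrec.const true)) (hrb false)
      (Primrec.ite (Primrec.eq.comp (hh true) (Primrec.const true)) (hrb true) (hr.comp Primrec.fst))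
  refine (Primrec.option_casesOn h1 hr h2).of_eq fun x => ?_
  simp only [rstep]
  cases aOpt ψ (2 ^ (i x + 2)) (s x) (z x) <;> rfl

theorem prim_rr (hψ : Primrec ψ) : Primrec fun p : (ℕ × ℕ × List Bool) × ℕ => rr ψ p.1.1 p.1.2.1 p.1.2.2 p.2 := by
  have : Primrec₂ fun (p : ℕ × ℕ × List Bool) (s : ℕ) => (Nat.rec p.2.2 (fun s r => rstep ψ p.1 p.2.1 p.2.2 s r) s : List Bool) := by
    refine Primrec.nat_rec (f := fun p : ℕ × ℕ × List Bool => p.2.2) (g := fun p q => rstep ψ p.1 p.2.1 p.2.2 q.1 q.2) (Primrec.snd.comp Primrec.snd) ?_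
    exact prim_rstep hψ (Primrec.fst.comp Primrec.fst) (Primrec.fst.comp (Primrec.snd.comp Primrec.fst))
      (Primrec.fst.comp Primrec.snd) (Primrec.snd.comp (Primrec.snd.comp Primrec.fst)) (Primrec.snd.comp Primrec.snd)
  refine Primrec.of_eq this fun p => ?_
  obtain ⟨p, s⟩ := p
  dsimp only
  induction s with
  | zero => rfl
  | succ l ih => rw [rr, ← ih]

/-- Construction states: decisions so far, current node, current output. -/
abbrev St := List (Option (List Bool)) × List Bool × List Bool

/-- Least pending requirement that now succeeds. -/
def trig (low : List (Option (List Bool))) (t : ℕ) : Option ℕ :=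
  ((List.range low.length).filter fun j => ((low[j]?.getD none).bind fun ζ => succL j ζ t).isSome).head?

theorem prim_trig : Primrec₂ trig := by
  refine Primrec.list_head?.comp (prim_filter (f := fun p : List (Option (List Bool)) × ℕ => List.range p.1.length)
    (p := fun p j => ((p.1[j]?.getD none).bind fun ζ => succL j ζ p.2).isSome) (Primrec.list_range.comp (Primrec.list_length.comp Primrec.fst)) ?_)
  refine Primrec.option_isSome.comp (Primrec.option_bind ?_ ?_)
  · exact Primrec.option_getD.comp (Primrec.list_getElem?.comp (Primrec.fst.comp Primrec.fst) Primrec.snd) (Primrec.const none)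
  · exact prim_succL.comp (Primrec.pair (Primrec.pair (Primrec.snd.comp Primrec.fst) Primrec.snd) (Primrec.snd.comp (Primrec.fst.comp Primrec.fst)))

/-- One step of the construction, reading `y` of length `t + 1`. -/
def step (ψ : List Bool → List Bool) (i t : ℕ) (st : St) (y : List Bool) : St :=
  match trig st.1 t with
  | some j => (st.1.take j, y, st.2.2)
  | none =>
    match succL st.1.length st.2.2 t with
    | some η => if pfx (rr ψ i st.1.length st.2.1 t) y = true then (st.1 ++ [none], y, η) else (st.1, y, st.2.2)
    | none => if pfx (rr ψ i st.1.length st.2.1 t) y = true then st else (st.1 ++ [some st.2.2], y, st.2.2)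

theorem prim_step (hψ : Primrec ψ) {α : Type*} [Primcodable α] {i t : α → ℕ} {st : α → St} {y : α → List Bool}
    (hi : Primrec i) (ht : Primrec t) (hst : Primrec st) (hy : Primrec y) :
    Primrec fun x => step ψ (i x) (t x) (st x) (y x) := by
  have hl : Primrec fun x => (st x).1 := Primrec.fst.comp hst
  have hz : Primrec fun x => (st x).2.1 := Primrec.fst.comp (Primrec.snd.comp hst)
  have hζ : Primrec fun x => (st x).2.2 := Primrec.snd.comp (Primrec.snd.comp hst)
  have hlen : Primrec fun x => (st x).1.length := Primrec.list_length.comp hl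
  have hp : Primrec fun x => pfx (rr ψ (i x) (st x).1.length (st x).2.1 (t x)) (y x) :=
    prim_pfx ((prim_rr hψ).comp (Primrec.pair (Primrec.pair hi (Primrec.pair hlen hz)) ht)) hy
  have hs : Primrec fun x => succL (st x).1.length (st x).2.2 (t x) := prim_succL.comp (Primrec.pair (Primrec.pair hlen hζ) ht)
  have h1 : Primrec₂ fun (x : α) (j : ℕ) => (((st x).1.take j, y x, (st x).2.2) : St) :=
    Primrec.pair (Primrec.list_take.comp Primrec.snd (hl.comp Primrec.fst)) (Primrec.pair (hy.comp Primrec.fst) (hζ.comp Primrec.fst))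
  have h2 : Primrec₂ fun (x : α) (η : List Bool) => ((if pfx (rr ψ (i x) (st x).1.length (st x).2.1 (t x)) (y x) = true then ((st x).1 ++ [none], y x, η) else ((st x).1, y x, (st x).2.2)) : St) := by
    refine Primrec.ite (Primrec.eq.comp (hp.comp Primrec.fst) (Primrec.const true)) ?_ ?_
    · exact Primrec.pair (Primrec.list_append.comp (hl.comp Primrec.fst) (Primrec.const _)) (Primrec.pair (hy.comp Primrec.fst) Primrec.snd)
    · exact Primrec.pair (hl.comp Primrec.fst) (Primrec.pair (hy.comp Primrec.fst) (hζ.comp Primrec.fst))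
  have h3 : Primrec fun (x : α) => ((if pfx (rr ψ (i x) (st x).1.length (st x).2.1 (t x)) (y x) = true then st x else ((st x).1 ++ [some (st x).2.2], y x, (st x).2.2)) : St) := by
    refine Primrec.ite (Primrec.eq.comp hp (Primrec.const true)) hst ?_
    exact Primrec.pair (Primrec.list_append.comp hl (Primrec.list_cons.comp (Primrec.option_some.comp hζ) (Primrec.const []))) (Primrec.pair hy hζ)
  refine (Primrec.option_casesOn (prim_trig.comp hl ht) (Primrec.option_casesOn hs h3 h2) h1).of_eq fun x => ?_
  simp only [step]
  cases trig (st x).1 (t x) with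
  | some j => rfl
  | none => cases succL (st x).1.length (st x).2.2 (t x) <;> rfl

/-- The state of the construction along `y`, after `n` steps. -/
def SSn (ψ : List Bool → List Bool) (i : ℕ) (y : List Bool) : ℕ → St
  | 0 => ([], [], [])
  | t+1 => step ψ i t (SSn ψ i y t) (y.take (t + 1))

/-- The state of the construction at `y`. -/
def SS (ψ : List Bool → List Bool) (i : ℕ) (y : List Bool) : St := SSn ψ i y y.length

theorem prim_SS (hψ : Primrec ψ) : Primrec₂ (SS ψ) := by
  have : Primrec fun (p : ℕ × List Bool) => (Nat.rec ([], [], []) (fun t st => step ψ p.1 t st (p.2.take (t + 1))) p.2.length : St) := by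
    refine Primrec.nat_rec' (β := St) (f := fun p : ℕ × List Bool => p.2.length) (g := fun _ => ([], [], [])) (h := fun p q => step ψ p.1 q.1 q.2 (p.2.take (q.1 + 1)))
      (Primrec.list_length.comp Primrec.snd) (Primrec.const _) ?_
    exact prim_step hψ (Primrec.fst.comp Primrec.fst) (Primrec.fst.comp Primrec.snd) (Primrec.snd.comp Primrec.snd)
      (Primrec.list_take.comp (Primrec.succ.comp (Primrec.fst.comp Primrec.snd)) (Primrec.snd.comp Primrec.fst))
  refine Primrec.of_eq this fun p => ?_
  obtain ⟨i, y⟩ := p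
  simp only [SS]
  generalize y.length = n
  induction n with
  | zero => rfl
  | succ n ih => rw [SSn, ← ih]


end PartB1

section PartB2
open Encodable

/-! ### Measure on Cantor space -/

open MeasureTheory

/-- The fair coin. -/
noncomputable def coin : Measure Bool := (PMF.uniformOfFintype Bool).toMeasure

instance : IsProbabilityMeasure coin := by unfold coin; infer_instance

/-- Lebesgue measure on Cantor space. -/
noncomputable def lam : Measure (ℕ → Bool) := Measure.infinitePi fun _ => coin

instance : IsProbabilityMeasure lam := by unfold lam; infer_instance

theorem coin_singleton (b : Bool) : coin {b} = 2⁻¹ := by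
  unfold coin
  rw [PMF.toMeasure_apply_singleton _ _ (measurableSet_singleton b)]
  simp

theorem pre_eq_iff {X : ℕ → Bool} {x : List Bool} : pre X x.length = x ↔ extendsStr X x := by
  constructor
  · intro h i
    have := pre_getElem? X x.length i.1
    rw [h] at this
    simpa [eq_comm] using this
  · intro h
    apply List.ext_getElem (by simp)
    intro n h1 h2
    have := h ⟨n, h2⟩
    simpa [pre] using this

theorem meas_pre (s : ℕ) (p : List Bool → Prop) : MeasurableSet {X : ℕ → Bool | p (pre X s)} := by
  have h : Measurable fun (X : ℕ → Bool) (i : Fin s) => X i := by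
    apply measurable_pi_lambda
    intro i
    exact measurable_pi_apply _
  have e : {X : ℕ → Bool | p (pre X s)} = (fun (X : ℕ → Bool) (i : Fin s) => X i) ⁻¹' {f | p (List.ofFn f)} := by
    ext X
    have : pre X s = List.ofFn fun i : Fin s => X i := by
      apply List.ext_getElem (by simp)
      intro n h1 h2
      simp [pre]
    simp [this]
  rw [e]
  exact h (Set.toFinite _).measurableSet

theorem lam_cyl (x : List Bool) : lam {X | pre X x.length = x} = (2⁻¹ : ℝ≥0∞) ^ x.length := by
  have e : {X : ℕ → Bool | pre X x.length = x} = Set.pi (Finset.range x.length : Set ℕ) (fun i => {x[i]?.getD false}) := by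
    ext X
    simp only [Set.mem_ofPred_eq, pre_eq_iff, extendsStr, Set.mem_pi, Finset.coe_range, Set.mem_Iio, Set.mem_singleton_iff]
    constructor
    · intro h i hi
      simpa [hi] using h ⟨i, hi⟩
    · intro h i
      have := h i.1 i.2
      simpa using this
  rw [e, lam, Measure.infinitePi_pi (fun _ => coin) (fun _ _ => measurableSet_singleton _)]
  simp [coin_singleton]

theorem lam_pre (s : ℕ) (p : List Bool → Bool) :
    lam {X | p (pre X s) = true} = ((strs s).countP p : ℝ≥0∞) * (2⁻¹ : ℝ≥0∞) ^ s := by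
  have e : {X | p (pre X s) = true} = ⋃ x ∈ ((strs s).filter p).toFinset, {X | pre X x.length = x} := by
    ext X
    simp only [Set.mem_ofPred_eq, List.mem_toFinset, List.mem_filter, mem_strs, Set.mem_iUnion, exists_prop]
    constructor
    · intro h
      exact ⟨pre X s, ⟨by simp, h⟩, by simp⟩
    · rintro ⟨x, ⟨rfl, h⟩, h2⟩
      rwa [h2]
  rw [e, measure_biUnion_finset]
  · rw [Finset.sum_congr rfl (g := fun _ => (2⁻¹ : ℝ≥0∞) ^ s)]
    · rw [Finset.sum_const, List.toFinset_card_of_nodup ((nodup_strs s).filter _), List.countP_eq_length_filter, nsmul_eq_mul]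
    · intro x hx
      simp only [List.mem_toFinset, List.mem_filter, mem_strs] at hx
      rw [lam_cyl, hx.1]
  · intro x hx y hy hxy
    simp only [Finset.mem_coe, List.mem_toFinset, List.mem_filter, mem_strs] at hx hy
    refine Set.disjoint_left.2 fun X h1 h2 => hxy ?_
    simp only [Set.mem_ofPred_eq] at h1 h2
    rw [hx.1] at h1; rw [hy.1] at h2
    exact h1.symm.trans h2
  · intro x hx
    exact meas_pre _ (fun y => y = x)

theorem stringMeasure_le (V : Set (List Bool)) : stringMeasure V ≤ lam (openOf V) := by
  classical
  refine iSup_le fun n => ?_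
  have h1 : lam {X | decide (∃ σ ∈ V, σ <+: pre X n) = true} ≤ lam (openOf V) := by
    refine measure_mono fun X hX => ?_
    simp only [Set.mem_ofPred_eq, decide_eq_true_eq] at hX
    obtain ⟨σ, hσ, h⟩ := hX
    exact ⟨σ, hσ, pre_eq_iff.1 (prefix_pre h).symm⟩
  refine le_trans ?_ h1
  rw [lam_pre n (fun x => decide (∃ σ ∈ V, σ <+: x)), ENNReal.div_eq_inv_mul, mul_comm, ENNReal.inv_pow]
  gcongr
  let T : Finset (List Bool) := ((strs n).filter (fun x => decide (∃ σ ∈ V, σ <+: x))).toFinset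
  have hT : T.card = (strs n).countP (fun x => decide (∃ σ ∈ V, σ <+: x)) := by
    rw [List.toFinset_card_of_nodup ((nodup_strs n).filter _), List.countP_eq_length_filter]
  rw [← hT]
  have hT2 : T.card = Nat.card (T : Set (List Bool)) := by simp
  rw [hT2]
  refine Nat.card_le_card_of_injective (fun f => ⟨List.ofFn f.1, ?_⟩) ?_
  · simp only [T, Finset.mem_coe, List.mem_toFinset, List.mem_filter, mem_strs, List.length_ofFn, true_and, decide_eq_true_eq]
    exact f.2
  · intro f g h
    have := congrArg Subtype.val h
    exact Subtype.ext (List.ofFn_injective this)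

/-! ### Tree families -/

/-- A family of measurable sets indexed by strings, antitone and disjoint on incomparable strings. -/
structure TreeFam {Ω : Type*} [MeasurableSpace Ω] (Q : List Bool → Set Ω) : Prop where
  meas : ∀ β, MeasurableSet (Q β)
  anti : ∀ β γ, β <+: γ → Q γ ⊆ Q β
  disj : ∀ β γ, ¬ β <+: γ → ¬ γ <+: β → Disjoint (Q β) (Q γ)

/-- Minimal elements. -/
def minB (B : Set (List Bool)) : Set (List Bool) := {β | β ∈ B ∧ ∀ γ ∈ B, γ <+: β → γ = β}

theorem exists_minB {B : Set (List Bool)} {β : List Bool} (h : β ∈ B) : ∃ γ ∈ minB B, γ <+: β := by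
  induction hn : β.length using Nat.strong_induction_on generalizing β with
  | _ n ih =>
    by_cases hm : β ∈ minB B
    · exact ⟨β, hm, List.prefix_refl _⟩
    · simp only [minB, Set.mem_ofPred_eq, not_and, not_forall] at hm
      obtain ⟨γ, hγ, hp, hne⟩ := hm h
      have : γ.length < n := by
        rw [← hn]
        exact lt_of_le_of_ne hp.length_le fun h => hne (hp.eq_of_length h)
      obtain ⟨δ, hδ, hδγ⟩ := ih _ this hγ rfl
      exact ⟨δ, hδ, hδγ.trans hp⟩

theorem TreeFam.measure_union {Ω : Type*} [MeasurableSpace Ω] {Q : List Bool → Set Ω} (hQ : TreeFam Q)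
    (m : Measure Ω) (B : Set (List Bool)) : m (⋃ β ∈ B, Q β) = ∑' β : minB B, m (Q β) := by
  have e : (⋃ β ∈ B, Q β) = ⋃ β ∈ minB B, Q β := by
    apply Set.Subset.antisymm
    · refine Set.iUnion₂_subset fun β hβ => ?_
      obtain ⟨γ, hγ, h⟩ := exists_minB hβ
      exact (hQ.anti _ _ h).trans (Set.subset_biUnion_of_mem (u := Q) hγ)
    · exact Set.biUnion_subset_biUnion_left fun β h => h.1
  rw [e, measure_biUnion (Set.to_countable _)]
  · intro β hβ γ hγ hne
    apply hQ.disj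
    · intro h; exact hne (hγ.2 _ hβ.1 h)
    · intro h; exact hne (hβ.2 _ hγ.1 h).symm
  · intro β _; exact hQ.meas β

theorem group3 {Ω₁ Ω₂ Ω₃ : Type*} [MeasurableSpace Ω₁] [MeasurableSpace Ω₂] [MeasurableSpace Ω₃]
    {Q₁ : List Bool → Set Ω₁} {Q₂ : List Bool → Set Ω₂} {Q₃ : List Bool → Set Ω₃}
    (h₁ : TreeFam Q₁) (h₂ : TreeFam Q₂) (h₃ : TreeFam Q₃)
    (m₁ : Measure Ω₁) (m₂ : Measure Ω₂) (m₃ : Measure Ω₃) (B : Set (List Bool))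
    (h : ∀ β ∈ minB B, m₁ (Q₁ β) ≤ m₂ (Q₂ β) + m₃ (Q₃ β)) :
    m₁ (⋃ β ∈ B, Q₁ β) ≤ m₂ (⋃ β ∈ B, Q₂ β) + m₃ (⋃ β ∈ B, Q₃ β) := by
  rw [h₁.measure_union, h₂.measure_union, h₃.measure_union, ← ENNReal.tsum_add]
  exact ENNReal.tsum_le_tsum fun β => h β β.2

theorem group2 {Ω₁ Ω₂ : Type*} [MeasurableSpace Ω₁] [MeasurableSpace Ω₂]
    {Q₁ : List Bool → Set Ω₁} {Q₂ : List Bool → Set Ω₂}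
    (h₁ : TreeFam Q₁) (h₂ : TreeFam Q₂)
    (m₁ : Measure Ω₁) (m₂ : Measure Ω₂) (B : Set (List Bool))
    (h : ∀ β ∈ minB B, m₁ (Q₁ β) ≤ m₂ (Q₂ β)) :
    m₁ (⋃ β ∈ B, Q₁ β) ≤ m₂ (⋃ β ∈ B, Q₂ β) := by
  rw [h₁.measure_union, h₂.measure_union]
  exact ENNReal.tsum_le_tsum fun β => h β β.2

theorem TreeFam.inter {Ω : Type*} [MeasurableSpace Ω] {Q : List Bool → Set Ω} (hQ : TreeFam Q) {F : Set Ω}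
    (hF : MeasurableSet F) : TreeFam fun β => Q β ∩ F where
  meas β := (hQ.meas β).inter hF
  anti β γ h := Set.inter_subset_inter_left _ (hQ.anti β γ h)
  disj β γ h1 h2 := (hQ.disj β γ h1 h2).mono Set.inter_subset_left Set.inter_subset_left

/-! ### The push-forward tree -/

/-- Basic assumptions on the approximation of the functional. -/
structure Good (ψ : List Bool → List Bool) : Prop where
  prim : Primrec ψ
  mono : ∀ x y, x <+: y → ψ x <+: ψ y
  len : ∀ x, (ψ x).length ≤ x.length

variable {ψ : List Bool → List Bool}

/-- Preimage of `τ` at stage `s`. -/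
def PS (ψ : List Bool → List Bool) (s : ℕ) (τ : List Bool) : Set (ℕ → Bool) := {X | τ <+: ψ (pre X s)}

/-- Preimage of `τ`. -/
def PP (ψ : List Bool → List Bool) (τ : List Bool) : Set (ℕ → Bool) := ⋃ s, PS ψ s τ

theorem treeFam_PS (ψ : List Bool → List Bool) (s : ℕ) : TreeFam (PS ψ s) where
  meas β := meas_pre s fun x => β <+: ψ x
  anti β γ h X hX := h.trans hX
  disj β γ h1 h2 := by
    refine Set.disjoint_left.2 fun X hX hX' => ?_
    rcases prefix_comparable hX hX' with h | h
    · exact h1 h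
    · exact h2 h

theorem PS_mono (hψ : Good ψ) {s t : ℕ} (h : s ≤ t) (τ : List Bool) : PS ψ s τ ⊆ PS ψ t τ :=
  fun X hX => List.IsPrefix.trans hX (hψ.mono _ _ (pre_prefix_le X h))

theorem PS_sub_PP (s : ℕ) (τ : List Bool) : PS ψ s τ ⊆ PP ψ τ := Set.subset_iUnion (fun s => PS ψ s τ) s

theorem mem_PP {τ : List Bool} {X : ℕ → Bool} : X ∈ PP ψ τ ↔ ∃ s, τ <+: ψ (pre X s) := by
  simp [PP, PS]

/-- Two strings along the same output are comparable. -/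
theorem PP_comparable (hψ : Good ψ) {X : ℕ → Bool} {β γ : List Bool} (h1 : X ∈ PP ψ β) (h2 : X ∈ PP ψ γ) :
    β <+: γ ∨ γ <+: β := by
  obtain ⟨s, hs⟩ := mem_PP.1 h1
  obtain ⟨t, ht⟩ := mem_PP.1 h2
  have a := hs.trans (hψ.mono _ _ (pre_prefix_le X (le_max_left s t)))
  have b := ht.trans (hψ.mono _ _ (pre_prefix_le X (le_max_right s t)))
  exact prefix_comparable a b

theorem treeFam_PP (hψ : Good ψ) : TreeFam (PP ψ) where
  meas β := MeasurableSet.iUnion fun s => (treeFam_PS ψ s).meas β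
  anti β γ h := Set.iUnion_mono fun s => (treeFam_PS ψ s).anti β γ h
  disj β γ h1 h2 := by
    refine Set.disjoint_left.2 fun X hX hX' => ?_
    rcases PP_comparable hψ hX hX' with h | h
    · exact h1 h
    · exact h2 h

theorem PP_le (hψ : Good ψ) {τ : List Bool} {c : ℝ≥0∞} (s0 : ℕ) (h : ∀ s, s0 ≤ s → lam (PS ψ s τ) ≤ c) : lam (PP ψ τ) ≤ c := by
  have hm : Monotone fun s => PS ψ s τ := fun s t hst => PS_mono hψ hst τ
  rw [PP, hm.measure_iUnion]
  refine iSup_le fun s => ?_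
  exact (measure_mono (PS_mono hψ (le_max_left s s0) τ)).trans (h _ (le_max_right _ _))

theorem lam_PS (s : ℕ) (τ : List Bool) : lam (PS ψ s τ) = (mm ψ s τ : ℝ≥0∞) * (2⁻¹ : ℝ≥0∞) ^ s := by
  rw [mm, ← lam_pre s (fun x => pfx τ (ψ x))]
  simp only [pfx_iff]; rfl


end PartB2

section PartB3
open Encodable MeasureTheory

variable {ψ : List Bool → List Bool}

/-! ### The removal process -/

/-- `v` survives the first `l` steps at stage `s`. -/
def Kept (ψ : List Bool → List Bool) (C s l : ℕ) (v : List Bool) : Prop :=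
  ∀ l', l' < l → ∀ τ, τ <+: v → ok ψ C s l' τ = true

open Classical in
theorem KL_eq (C s l : ℕ) : KL ψ C s l = ((strs s).map ψ).filter fun v => decide (Kept ψ C s l v) := by
  induction l with
  | zero => simp [KL, Kept]
  | succ l ih =>
    rw [KL]
    conv_lhs => rw [ih]
    rw [List.filter_filter]
    apply List.filter_congr
    intro v _
    rw [Bool.eq_iff_iff]
    simp only [Bool.and_eq_true, decide_eq_true_eq, ← ih, allp_iff]
    constructor
    · rintro ⟨h1, h2⟩ l' hl' τ hτ
      rcases Nat.lt_succ_iff_lt_or_eq.1 hl' with h | rfl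
      · exact h2 l' h τ hτ
      · exact h1 τ hτ
    · intro h
      exact ⟨fun τ hτ => h l (Nat.lt_succ_self l) τ hτ, fun l' hl' τ hτ => h l' (hl'.trans (Nat.lt_succ_self l)) τ hτ⟩

/-- Survivors, as a set of oracles. -/
def KS (ψ : List Bool → List Bool) (C s l : ℕ) : Set (ℕ → Bool) := {X | Kept ψ C s l (ψ (pre X s))}

/-- Oracles with long output. -/
def LS (ψ : List Bool → List Bool) (s l : ℕ) : Set (ℕ → Bool) := {X | l ≤ (ψ (pre X s)).length}

theorem meas_KS (C s l : ℕ) : MeasurableSet (KS ψ C s l) := meas_pre s fun x => Kept ψ C s l (ψ x)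
theorem meas_LS (s l : ℕ) : MeasurableSet (LS ψ s l) := meas_pre s fun x => l ≤ (ψ x).length

theorem lam_KL (C s l : ℕ) (q : List Bool → Bool) :
    lam ({X | q (ψ (pre X s)) = true} ∩ KS ψ C s l) = ((KL ψ C s l).countP q : ℝ≥0∞) * (2⁻¹ : ℝ≥0∞) ^ s := by
  classical
  have : (KL ψ C s l).countP q = (strs s).countP fun x => q (ψ x) && decide (Kept ψ C s l (ψ x)) := by
    rw [KL_eq, List.countP_filter, List.countP_map]; rfl
  rw [this, ← lam_pre s (fun x => q (ψ x) && decide (Kept ψ C s l (ψ x)))]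
  simp only [Bool.and_eq_true, decide_eq_true_eq]; rfl

theorem ok_iff (C s l : ℕ) (τ : List Bool) :
    ok ψ C s l τ = true ↔ lam (PS ψ s τ ∩ KS ψ C s l) ≤ C * lam (PS ψ s τ ∩ KS ψ C s l ∩ LS ψ s l) := by
  have h1 : PS ψ s τ ∩ KS ψ C s l = {X | pfx τ (ψ (pre X s)) = true} ∩ KS ψ C s l := by
    simp only [pfx_iff]; rfl
  have h2 : PS ψ s τ ∩ KS ψ C s l ∩ LS ψ s l = {X | (pfx τ (ψ (pre X s)) && decide (l ≤ (ψ (pre X s)).length)) = true} ∩ KS ψ C s l := by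
    ext X
    simp only [Bool.and_eq_true, pfx_iff, decide_eq_true_eq, PS, LS, Set.mem_inter_iff, Set.mem_ofPred_eq]
    tauto
  rw [h2, h1, lam_KL, lam_KL _ _ _ (fun v => pfx τ v && decide (l ≤ v.length)), ok, okL, decide_eq_true_eq, ← mul_assoc]
  have hp : ((2⁻¹ : ℝ≥0∞) ^ s) ≠ 0 := by simp
  have ht : ((2⁻¹ : ℝ≥0∞) ^ s) ≠ ⊤ := by simp
  rw [ENNReal.mul_le_mul_iff_left hp ht]
  exact_mod_cast Iff.rfl

theorem ok_of_len {C s l : ℕ} (hC : 1 ≤ C) {τ : List Bool} (h : l ≤ τ.length) : ok ψ C s l τ = true := by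
  rw [ok_iff]
  have e : PS ψ s τ ∩ KS ψ C s l ∩ LS ψ s l = PS ψ s τ ∩ KS ψ C s l := by
    apply Set.inter_eq_left.2
    rintro X ⟨h1, -⟩
    exact h.trans (List.IsPrefix.length_le h1)
  rw [e]
  calc lam (PS ψ s τ ∩ KS ψ C s l) = 1 * lam (PS ψ s τ ∩ KS ψ C s l) := (one_mul _).symm
    _ ≤ _ := by gcongr; exact_mod_cast hC

theorem allowed_iff {C s : ℕ} {y : List Bool} : allowed ψ C s y = true ↔ ∀ l, l ≤ y.length → ∀ τ, τ <+: y → ok ψ C s l τ = true := by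
  simp [allowed, allp_iff]

theorem allowed_prefix_le {C s : ℕ} {y z : List Bool} (h : z <+: y) (hy : allowed ψ C s y = true) : allowed ψ C s z = true := by
  rw [allowed_iff] at hy ⊢
  exact fun l hl τ hτ => hy l (hl.trans h.length_le) τ (hτ.trans h)

/-- Bad extensions of `τ`. -/
def BadAt (ψ : List Bool → List Bool) (C s l : ℕ) (τ : List Bool) : Set (List Bool) := {β | τ <+: β ∧ ¬ ok ψ C s l β = true}

/-- Oracles removed above `τ` at step `l`. -/
def Rm (ψ : List Bool → List Bool) (C s l : ℕ) (τ : List Bool) : Set (ℕ → Bool) :=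
  ⋃ β ∈ BadAt ψ C s l τ, PS ψ s β ∩ KS ψ C s l

theorem meas_Rm (C s l : ℕ) (τ : List Bool) : MeasurableSet (Rm ψ C s l τ) :=
  MeasurableSet.biUnion (Set.to_countable _) fun β _ => ((treeFam_PS ψ s).meas β).inter (meas_KS C s l)

theorem lemmaP (C s l : ℕ) (τ : List Bool) : C * lam (Rm ψ C s l τ ∩ LS ψ s l) ≤ lam (Rm ψ C s l τ) := by
  have hT := (treeFam_PS ψ s).inter (meas_KS (ψ := ψ) C s l)
  have := group2 (hT.inter (meas_LS (ψ := ψ) s l)) hT ((C : ℝ≥0∞) • lam) lam (BadAt ψ C s l τ) ?_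
  · have e : (⋃ β ∈ BadAt ψ C s l τ, (PS ψ s β ∩ KS ψ C s l) ∩ LS ψ s l) = Rm ψ C s l τ ∩ LS ψ s l := by
      rw [Rm, Set.iUnion₂_inter]
    rw [e] at this
    simpa [Rm] using this
  · intro β hβ
    have := hβ.1.2
    rw [ok_iff, not_le] at this
    simpa using this.le

/-- If `τ` is good at step `l` then the part surviving step `l` above `τ` has many long elements. -/
theorem survivors_long {C s l : ℕ} {τ : List Bool} (h : ok ψ C s l τ = true) :
    lam ((PS ψ s τ ∩ KS ψ C s l) \ Rm ψ C s l τ) ≤ C * lam (((PS ψ s τ ∩ KS ψ C s l) \ Rm ψ C s l τ) ∩ LS ψ s l) := by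
  rw [ok_iff] at h
  set F := PS ψ s τ ∩ KS ψ C s l
  set R := Rm ψ C s l τ with hR
  have hRF : R ⊆ F := by
    refine Set.iUnion₂_subset fun β hβ => Set.inter_subset_inter_left _ ?_
    exact (treeFam_PS ψ s).anti _ _ hβ.1
  have h1 : lam F = lam (F \ R) + lam R := by
    rw [← measure_sdiff_add_inter F (meas_Rm C s l τ), Set.inter_eq_right.2 hRF]
  have h2 : lam (F ∩ LS ψ s l) = lam ((F \ R) ∩ LS ψ s l) + lam (R ∩ LS ψ s l) := by
    rw [← measure_sdiff_add_inter (F ∩ LS ψ s l) (meas_Rm C s l τ)]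
    congr 2
    · ext X; simp only [Set.mem_sdiff, Set.mem_inter_iff, hR]; tauto
    · ext X; simp only [Set.mem_inter_iff, hR]
      constructor
      · tauto
      · rintro ⟨a, b⟩; exact ⟨⟨hRF a, b⟩, a⟩
  rw [h1, h2, mul_add] at h
  have h3 := lemmaP (ψ := ψ) C s l τ
  have h4 : lam (F \ R) + lam R ≤ C * lam ((F \ R) ∩ LS ψ s l) + lam R := h.trans (by gcongr)
  exact (ENNReal.add_le_add_iff_right (measure_ne_top _ _)).1 h4

/-! ### Strings that are never allowed -/

/-- `y` is never allowed. -/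
def Never (ψ : List Bool → List Bool) (C : ℕ) (y : List Bool) : Prop := ∀ s, y.length ≤ s → allowed ψ C s y = false

theorem lossOne (hψ : Good ψ) {C : ℕ} : C * lam (⋃ y ∈ {y | Never ψ C y}, PP ψ y) ≤ 1 := by
  have e : (⋃ y ∈ {y | Never ψ C y}, PP ψ y) = ⋃ n, ⋃ y ∈ {y | Never ψ C y}, PS ψ n y := by
    ext X; simp only [PP, Set.mem_iUnion]; 
    constructor
    · rintro ⟨y, hy, s, hs⟩; exact ⟨s, y, hy, hs⟩
    · rintro ⟨s, y, hy, hs⟩; exact ⟨y, hy, s, hs⟩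
  have hm : Monotone fun n => ⋃ y ∈ {y | Never ψ C y}, PS ψ n y := by
    intro s t hst
    exact Set.iUnion₂_mono fun y _ => PS_mono hψ hst y
  rw [e, hm.measure_iUnion, ENNReal.mul_iSup]
  refine iSup_le fun n => ?_
  have hsub : (⋃ y ∈ {y | Never ψ C y}, PS ψ n y) ⊆ ⋃ l, Rm ψ C n l [] ∩ LS ψ n l := by
    intro X hX
    simp only [Set.mem_iUnion, Set.mem_ofPred_eq, exists_prop] at hX
    obtain ⟨y, hy, hX⟩ := hX
    have hX : y <+: ψ (pre X n) := hX
    have hyn : y.length ≤ n := hX.length_le.trans ((hψ.len _).trans (by simp))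
    have h1 : ¬ allowed ψ C n y = true := by simp [hy n hyn]
    rw [allowed_iff] at h1
    push Not at h1
    obtain ⟨l, hl, τ, hτ, hb⟩ := h1
    have hex : ∃ l, ∃ τ, τ <+: ψ (pre X n) ∧ ok ψ C n l τ ≠ true := ⟨l, τ, hτ.trans hX, hb⟩
    classical
    let l0 := Nat.find hex
    obtain ⟨τ0, h0, hb0⟩ := Nat.find_spec hex
    have hle : l0 ≤ l := Nat.find_min' hex ⟨τ, hτ.trans hX, hb⟩
    refine Set.mem_iUnion.2 ⟨l0, ?_, ?_⟩
    · refine Set.mem_iUnion₂.2 ⟨τ0, ⟨nil_prefix_le, hb0⟩, h0, ?_⟩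
      intro l' hl' σ hσ
      by_contra hc
      exact Nat.find_min hex hl' ⟨σ, hσ, hc⟩
    · exact hle.trans (hl.trans hX.length_le)
  have hdisj : Pairwise fun l l' => Disjoint (Rm ψ C n l []) (Rm ψ C n l' []) := by
    have aux : ∀ l l', l < l' → Disjoint (Rm ψ C n l []) (Rm ψ C n l' []) := by
      intro l l' hll
      refine Set.disjoint_left.2 fun X hX hX' => ?_
      obtain ⟨β, hβ, hXβ, -⟩ := Set.mem_iUnion₂.1 hX
      obtain ⟨β', hβ', -, hk⟩ := Set.mem_iUnion₂.1 hX'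
      exact hβ.2 (hk l hll β hXβ)
    intro l l' hne
    rcases lt_or_gt_of_ne hne with h | h
    · exact aux _ _ h
    · exact (aux _ _ h).symm
  calc C * lam (⋃ y ∈ {y | Never ψ C y}, PS ψ n y) ≤ C * lam (⋃ l, Rm ψ C n l [] ∩ LS ψ n l) := by gcongr
    _ ≤ C * ∑' l, lam (Rm ψ C n l [] ∩ LS ψ n l) := by gcongr; exact measure_iUnion_le _
    _ = ∑' l, C * lam (Rm ψ C n l [] ∩ LS ψ n l) := ENNReal.tsum_mul_left.symm
    _ ≤ ∑' l, lam (Rm ψ C n l []) := ENNReal.tsum_le_tsum fun l => lemmaP C n l []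
    _ = lam (⋃ l, Rm ψ C n l []) := (measure_iUnion hdisj fun l => meas_Rm C n l []).symm
    _ ≤ 1 := prob_le_one

/-! ### Activation -/

/-- `z` is activated at stage `a`. -/
def ActAt (ψ : List Bool → List Bool) (C : ℕ) (z : List Bool) (a : ℕ) : Prop :=
  z.length ≤ a ∧ allowed ψ C a z = true ∧ ∀ s, z.length ≤ s → s < a → ¬ allowed ψ C s z = true

theorem ActAt.unique {C a b : ℕ} {z : List Bool} (h : ActAt ψ C z a) (h' : ActAt ψ C z b) : a = b := by
  rcases lt_trichotomy a b with hl | rfl | hl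
  · exact absurd h.2.1 (h'.2.2 _ h.1 hl)
  · rfl
  · exact absurd h'.2.1 (h.2.2 _ h'.1 hl)

theorem exists_actAt {C s : ℕ} {z : List Bool} (hs : z.length ≤ s) (h : allowed ψ C s z = true) : ∃ a, a ≤ s ∧ ActAt ψ C z a := by
  classical
  have hex : ∃ s, z.length ≤ s ∧ allowed ψ C s z = true := ⟨s, hs, h⟩
  refine ⟨Nat.find hex, Nat.find_min' hex ⟨hs, h⟩, (Nat.find_spec hex).1, (Nat.find_spec hex).2, ?_⟩
  intro t ht hlt hc
  exact Nat.find_min hex hlt ⟨ht, hc⟩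

theorem ActAt.prefix_le {C a : ℕ} {y z : List Bool} (h : ActAt ψ C y a) (hz : z <+: y) : ∃ b, b ≤ a ∧ ActAt ψ C z b :=
  exists_actAt (hz.length_le.trans h.1) (allowed_prefix_le hz h.2.1)

theorem aOpt_eq_some {C s a : ℕ} {z : List Bool} : aOpt ψ C s z = some a ↔ a ≤ s ∧ ActAt ψ C z a := by
  have key : aOpt ψ C s z = (List.range (s+1)).find? fun a => decide (z.length ≤ a) && allowed ψ C a z := by
    rw [aOpt, List.head?_filter]
  rw [key, List.find?_range_eq_some]
  simp only [Bool.and_eq_true, decide_eq_true_eq, List.mem_range, ActAt, Nat.lt_succ_iff, Bool.not_eq_eq_eq_not, Bool.not_true, Bool.and_eq_false_iff, decide_eq_false_iff_not, not_le]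
  constructor
  · rintro ⟨⟨h1, h2⟩, h3, h4⟩
    refine ⟨h3, h1, h2, fun t ht hlt => ?_⟩
    rcases h4 t hlt with h | h
    · omega
    · simp [h]
  · rintro ⟨h1, h2, h3, h4⟩
    refine ⟨⟨h2, h3⟩, h1, fun t hlt => ?_⟩
    by_cases ht : z.length ≤ t
    · right; simpa using h4 t ht hlt
    · left; omega

theorem aOpt_isSome_mono {C s t : ℕ} {z : List Bool} (h : s ≤ t) (hs : (aOpt ψ C s z).isSome) : (aOpt ψ C t z).isSome := by
  obtain ⟨a, ha⟩ := Option.isSome_iff_exists.1 hs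
  rw [aOpt_eq_some] at ha
  have := (aOpt_eq_some (ψ := ψ) (C := C) (s := t)).2 ⟨ha.1.trans h, ha.2⟩
  simp [this]

/-- `z` is activated at some stage. -/
def Act (ψ : List Bool → List Bool) (C : ℕ) (z : List Bool) : Prop := ∃ a, ActAt ψ C z a

theorem act_iff {C : ℕ} {z : List Bool} : Act ψ C z ↔ ¬ Never ψ C z := by
  constructor
  · rintro ⟨a, ha⟩ hn
    simpa [ha.2.1] using hn a ha.1
  · intro h
    simp only [Never, not_forall] at h
    obtain ⟨s, hs, h⟩ := h
    obtain ⟨a, -, ha⟩ := exists_actAt (ψ := ψ) (C := C) hs (by simpa using h)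
    exact ⟨a, ha⟩

theorem Act.prefix_le {C : ℕ} {y z : List Bool} (h : Act ψ C y) (hz : z <+: y) : Act ψ C z := by
  obtain ⟨a, ha⟩ := h
  obtain ⟨b, -, hb⟩ := ha.prefix_le hz
  exact ⟨b, hb⟩


end PartB3

section PartB4
open Encodable MeasureTheory

variable {ψ : List Bool → List Bool}

instance instMeasListBool : MeasurableSpace (List Bool) := ⊤

/-- Weight of `y` at its activation. -/
noncomputable def wt (ψ : List Bool → List Bool) (C : ℕ) (y : List Bool) : ℝ≥0∞ := ⨆ (a : ℕ) (_ : ActAt ψ C y a), lam (PS ψ a y)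

theorem wt_eq {C a : ℕ} {y : List Bool} (h : ActAt ψ C y a) : wt ψ C y = lam (PS ψ a y) := by
  apply le_antisymm
  · exact iSup₂_le fun b hb => by rw [hb.unique h]
  · exact le_iSup₂ (f := fun a (_ : ActAt ψ C y a) => lam (PS ψ a y)) a h

theorem wt_le (C : ℕ) (y : List Bool) : wt ψ C y ≤ lam (PP ψ y) :=
  iSup₂_le fun b _ => measure_mono (PS_sub_PP b y)

/-- Weights on strings of length `l`, as a measure. -/
noncomputable def mT (ψ : List Bool → List Bool) (C l : ℕ) : Measure (List Bool) :=
  Measure.sum fun y => (if y.length = l then wt ψ C y else 0) • Measure.dirac y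

theorem mT_apply (C l : ℕ) (S : Set (List Bool)) : mT ψ C l S = ∑' y, S.indicator (fun y => if y.length = l then wt ψ C y else 0) y := by
  have hS : MeasurableSet S := trivial
  rw [mT, Measure.sum_apply _ hS]
  congr 1; funext y
  simp only [Measure.smul_apply, Measure.dirac_apply' _ hS, smul_eq_mul]
  by_cases hy : y ∈ S <;> simp [hy]

theorem treeFam_up : TreeFam fun β : List Bool => {y : List Bool | β <+: y} where
  meas _ := trivial
  anti _ _ h _ hX := h.trans hX
  disj β γ h1 h2 := by
    refine Set.disjoint_left.2 fun X hX hX' => ?_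
    rcases prefix_comparable hX hX' with h | h
    · exact h1 h
    · exact h2 h

/-- Oracles whose output passes through an activated string of length `l`. -/
def DD (ψ : List Bool → List Bool) (C l : ℕ) : Set (ℕ → Bool) := ⋃ y ∈ {y : List Bool | y.length = l ∧ Act ψ C y}, PP ψ y

theorem meas_DD (hψ : Good ψ) (C l : ℕ) : MeasurableSet (DD ψ C l) :=
  MeasurableSet.biUnion (Set.to_countable _) fun β _ => (treeFam_PP hψ).meas β

theorem lemmaT (hψ : Good ψ) {C l : ℕ} (hC : 1 ≤ C) : ∀ (k : ℕ) (τ : List Bool) (s0 : ℕ), τ.length + k = l →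
    (∀ y a, y.length = l → τ <+: y → ActAt ψ C y a → s0 ≤ a) →
    lam (PS ψ s0 τ) ≤ C * (mT ψ C l {y | τ <+: y} + lam (PP ψ τ \ DD ψ C l)) := by
  intro k
  induction k using Nat.strong_induction_on with
  | _ k ih =>
  intro τ s0 hk hs0
  have hC' : (1 : ℝ≥0∞) ≤ C := by exact_mod_cast hC
  by_cases hact : ∃ y, y.length = l ∧ τ <+: y ∧ Act ψ C y
  swap
  · have e : PP ψ τ \ DD ψ C l = PP ψ τ := by
      refine sdiff_eq_left.2 (Set.disjoint_left.2 fun X hX hD => hact ?_)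
      obtain ⟨y, ⟨hy, ha⟩, hXy⟩ := Set.mem_iUnion₂.1 hD
      rcases PP_comparable hψ hX hXy with h | h
      · exact ⟨y, hy, h, ha⟩
      · have : y = τ := h.eq_of_length_le (by omega)
        exact ⟨y, hy, by rw [this], ha⟩
    rw [e]
    calc lam (PS ψ s0 τ) ≤ lam (PP ψ τ) := measure_mono (PS_sub_PP _ _)
      _ ≤ mT ψ C l {y | τ <+: y} + lam (PP ψ τ) := le_add_self
      _ = 1 * (mT ψ C l {y | τ <+: y} + lam (PP ψ τ)) := (one_mul _).symm
      _ ≤ _ := by gcongr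
  classical
  have hex : ∃ s, ∃ y, y.length = l ∧ τ <+: y ∧ ActAt ψ C y s := by
    obtain ⟨y, h1, h2, a, ha⟩ := hact
    exact ⟨a, y, h1, h2, ha⟩
  obtain ⟨ys, hys1, hys2, hys3⟩ := Nat.find_spec hex
  have hmin : ∀ y a, y.length = l → τ <+: y → ActAt ψ C y a → Nat.find hex ≤ a := fun y a h1 h2 h3 =>
    Nat.find_min' hex ⟨y, h1, h2, h3⟩
  set s := Nat.find hex
  have hs : s0 ≤ s := hs0 ys s hys1 hys2 hys3
  refine (measure_mono (PS_mono hψ hs τ)).trans ?_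
  have hall := allowed_iff.1 hys3.2.1
  rw [hys1] at hall
  -- the bad set
  set B : Set (List Bool) := {β | τ <+: β ∧ ∃ l' ≤ l, ¬ ok ψ C s l' β = true} with hB
  have hBlen : ∀ β ∈ B, τ.length < β.length ∧ β.length < l := by
    rintro β ⟨h1, l', hl', hb⟩
    constructor
    · refine lt_of_le_of_ne h1.length_le fun he => hb ?_
      rw [← h1.eq_of_length he]
      exact hall l' hl' τ hys2
    · by_contra hc
      exact hb (ok_of_len hC (by omega))
  have hgroup : lam (⋃ β ∈ B, PS ψ s β) ≤ C * (mT ψ C l (⋃ β ∈ B, {y | β <+: y}) + lam ((⋃ β ∈ B, PP ψ β) \ DD ψ C l)) := by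
    have h := group3 (treeFam_PS ψ s) treeFam_up ((treeFam_PP hψ).inter (meas_DD hψ C l).compl) lam ((C : ℝ≥0∞) • mT ψ C l) ((C : ℝ≥0∞) • lam) B ?_
    · rw [← Set.iUnion₂_inter] at h
      rw [mul_add]
      simpa [Set.sdiff_eq] using h
    · intro β hβ
      have hl := hBlen β hβ.1
      have := ih (l - β.length) (by omega) β s (by omega) fun y a h1 h2 h3 => hmin y a h1 (hβ.1.1.trans h2) h3
      rw [mul_add] at this
      simpa [Set.sdiff_eq] using this
  -- the surviving part
  set F : Set (ℕ → Bool) := (PS ψ s τ ∩ KS ψ C s l) \ Rm ψ C s l τ with hF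
  have hFl := survivors_long (hall l le_rfl τ hys2)
  rw [← hF] at hFl
  have hFok : ∀ X ∈ F, ∀ l' ≤ l, ∀ β, β <+: ψ (pre X s) → ok ψ C s l' β = true := by
    rintro X ⟨⟨h1, h2⟩, h3⟩ l' hl' β hβ
    rcases hl'.lt_or_eq with hlt | rfl
    · exact h2 l' hlt β hβ
    · by_contra hb
      rcases prefix_comparable h1 hβ with h | h
      · exact h3 (Set.mem_iUnion₂.2 ⟨β, ⟨h, hb⟩, hβ, h2⟩)
      · exact hb (hall _ le_rfl β (h.trans hys2))
  set Y : Set (List Bool) := {y | y.length = l ∧ τ <+: y ∧ ActAt ψ C y s} with hY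
  have hFsub : F ∩ LS ψ s l ⊆ ⋃ y ∈ Y, PS ψ s y := by
    rintro X ⟨hX, hlong⟩
    have hlong : l ≤ (ψ (pre X s)).length := hlong
    have hτX : τ <+: ψ (pre X s) := hX.1.1
    set y := (ψ (pre X s)).take l
    have hyl : y.length = l := by simp [y, hlong]
    have hyp : y <+: ψ (pre X s) := take_prefix_le _ _
    have hτy : τ <+: y := List.prefix_of_prefix_length_le hτX hyp (by omega)
    have hal : allowed ψ C s y = true := allowed_iff.2 fun l' hl' β hβ => hFok X hX l' (by omega) β (hβ.trans hyp)
    have hls : l ≤ s := by rw [← hys1]; exact hys3.1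
    obtain ⟨a, ha, hact⟩ := exists_actAt (by omega) hal
    have : a = s := le_antisymm ha (hmin y a hyl hτy hact)
    rw [this] at hact
    exact Set.mem_iUnion₂.2 ⟨y, ⟨hyl, hτy, hact⟩, hyp⟩
  have hFm : lam (F ∩ LS ψ s l) ≤ mT ψ C l Y := by
    refine (measure_mono hFsub).trans ?_
    rw [Set.biUnion_eq_iUnion]
    refine (measure_iUnion_le _).trans ?_
    rw [mT_apply, ← tsum_subtype]
    refine ENNReal.tsum_le_tsum fun y => ?_
    have := y.2
    simp only [hY, Set.mem_ofPred_eq] at this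
    simp [this.1, wt_eq this.2.2]
  have hcover : PS ψ s τ ⊆ F ∪ ⋃ β ∈ B, PS ψ s β := by
    intro X hX
    by_cases hXF : X ∈ F
    · exact Or.inl hXF
    right
    have : ∃ l' ≤ l, ∃ β, β <+: ψ (pre X s) ∧ ¬ ok ψ C s l' β = true := by
      by_contra hc
      push Not at hc
      apply hXF
      refine ⟨⟨hX, fun l' hl' β hβ => hc l' hl'.le β hβ⟩, fun hR => ?_⟩
      obtain ⟨β, hβ, hβX, -⟩ := Set.mem_iUnion₂.1 hR
      exact hβ.2 (hc l le_rfl β hβX)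
    obtain ⟨l', hl', β, hβ, hb⟩ := this
    refine Set.mem_iUnion₂.2 ⟨β, ⟨?_, l', hl', hb⟩, hβ⟩
    rcases prefix_comparable hX hβ with h | h
    · exact h
    · exact absurd (hall l' hl' β (h.trans hys2)) hb
  have hdisj : Disjoint Y (⋃ β ∈ B, {y : List Bool | β <+: y}) := by
    refine Set.disjoint_left.2 fun y hy hy' => ?_
    obtain ⟨β, ⟨h1, l', hl', hb⟩, hβ⟩ := Set.mem_iUnion₂.1 hy'
    exact hb (allowed_iff.1 hy.2.2.2.1 l' (by rw [hy.1]; exact hl') β hβ)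
  calc lam (PS ψ s τ) ≤ lam F + lam (⋃ β ∈ B, PS ψ s β) := (measure_mono hcover).trans (measure_union_le _ _)
    _ ≤ C * mT ψ C l Y + C * (mT ψ C l (⋃ β ∈ B, {y | β <+: y}) + lam ((⋃ β ∈ B, PP ψ β) \ DD ψ C l)) := by
        gcongr
        exact hFl.trans (by gcongr)
    _ = C * (mT ψ C l (Y ∪ ⋃ β ∈ B, {y | β <+: y}) + lam ((⋃ β ∈ B, PP ψ β) \ DD ψ C l)) := by
        rw [measure_union hdisj trivial, ← mul_add, ← add_assoc]
    _ ≤ _ := by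
        gcongr
        · refine Set.union_subset (fun y hy => hy.2.1) (Set.iUnion₂_subset fun β hβ y hy => hβ.1.trans hy)
        · exact Set.iUnion₂_subset fun β hβ => (treeFam_PP hψ).anti _ _ hβ.1


end PartB4

section PartB5
open Encodable MeasureTheory

variable {ψ : List Bool → List Bool}

/-! ### The moving target -/

theorem heavy_iff {i e a s : ℕ} {z τ : List Bool} :
    heavy ψ i e a s z τ = true ↔ lam (PS ψ a z) ≤ (2 : ℝ≥0∞) ^ (e + i + 4) * lam (PS ψ s τ) := by
  rw [heavy, decide_eq_true_eq, lam_PS, lam_PS]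
  have hp : ∀ n : ℕ, (2 : ℝ≥0∞) ^ n ≠ 0 := fun n => by simp
  have ht : ∀ n : ℕ, (2 : ℝ≥0∞) ^ n ≠ ⊤ := fun n => by simp
  have hi : ∀ n : ℕ, (2⁻¹ : ℝ≥0∞) ^ n * 2 ^ n = 1 := fun n => by
    rw [← mul_pow, ENNReal.inv_mul_cancel (by simp) (by simp), one_pow]
  rw [← ENNReal.mul_le_mul_iff_left (hp a) (ht a), ← ENNReal.mul_le_mul_iff_left (hp s) (ht s)]
  have e1 : (mm ψ a z : ℝ≥0∞) * (2⁻¹) ^ a * 2 ^ a * 2 ^ s = mm ψ a z * 2 ^ s := by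
    rw [mul_assoc (mm ψ a z : ℝ≥0∞), hi, mul_one]
  have e2 : (2 : ℝ≥0∞) ^ (e + i + 4) * (mm ψ s τ * (2⁻¹) ^ s) * 2 ^ a * 2 ^ s = mm ψ s τ * 2 ^ (e + i + 4) * 2 ^ a := by
    calc (2 : ℝ≥0∞) ^ (e + i + 4) * (mm ψ s τ * (2⁻¹) ^ s) * 2 ^ a * 2 ^ s
        = mm ψ s τ * 2 ^ (e + i + 4) * 2 ^ a * ((2⁻¹) ^ s * 2 ^ s) := by ring
      _ = _ := by rw [hi, mul_one]
  rw [e1, e2]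
  exact_mod_cast Iff.rfl

section rr
variable {i e : ℕ} {z : List Bool}

theorem rr_cases (i e : ℕ) (z : List Bool) (s : ℕ) :
    (rr ψ i e z (s + 1) = rr ψ i e z s ∧ ∀ a, a ≤ s → ActAt ψ (2 ^ (i + 2)) z a → ∀ b, ¬ heavy ψ i e a (s + 1) z (rr ψ i e z s ++ [b]) = true) ∨
    ∃ b a, a ≤ s ∧ ActAt ψ (2 ^ (i + 2)) z a ∧ rr ψ i e z (s + 1) = rr ψ i e z s ++ [b] ∧ heavy ψ i e a (s + 1) z (rr ψ i e z s ++ [b]) = true := by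
  rw [rr, rstep]
  cases h : aOpt ψ (2 ^ (i + 2)) s z with
  | none =>
    left
    refine ⟨rfl, fun a ha hact => ?_⟩
    rw [aOpt_eq_some.2 ⟨ha, hact⟩] at h
    cases h
  | some a =>
    rw [aOpt_eq_some] at h
    simp only
    split_ifs with h1 h2
    · exact Or.inr ⟨false, a, h.1, h.2, rfl, h1⟩
    · exact Or.inr ⟨true, a, h.1, h.2, rfl, h2⟩
    · refine Or.inl ⟨rfl, fun a' ha' hact b => ?_⟩
      rw [hact.unique h.2]
      cases b
      · exact h1
      · exact h2

theorem rr_mono {s t : ℕ} (h : s ≤ t) : rr ψ i e z s <+: rr ψ i e z t := by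
  induction h with
  | refl => exact List.prefix_refl _
  | step h ih =>
    refine ih.trans ?_
    rcases rr_cases (ψ := ψ) i e z _ with h | ⟨b, a, -, -, h, -⟩ 
    · rw [h.1]
    · rw [h]; exact List.prefix_append _ _

theorem rr_ext (s : ℕ) : z <+: rr ψ i e z s := rr_mono (ψ := ψ) (i := i) (e := e) (z := z) (Nat.zero_le s)

theorem rr_len (s : ℕ) : (rr ψ i e z s).length ≤ max z.length s := by
  induction s with
  | zero => simp [rr]
  | succ s ih =>
    rcases rr_cases (ψ := ψ) i e z s with h | ⟨b, a, ha, hact, h, -⟩ 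
    · rw [h.1]; omega
    · rw [h, List.length_append]
      have := hact.1
      simp only [List.length_singleton]; omega

theorem rr_of_le {a s : ℕ} (ha : ActAt ψ (2 ^ (i + 2)) z a) (h : s ≤ a) : rr ψ i e z s = z := by
  induction s with
  | zero => rfl
  | succ s ih =>
    rcases rr_cases (ψ := ψ) i e z s with h1 | ⟨b, a', ha', hact, h1, -⟩ 
    · rw [h1.1]; exact ih (by omega)
    · have := hact.unique ha
      omega

theorem rr_heavy (hψ : Good ψ) {a s : ℕ} (ha : ActAt ψ (2 ^ (i + 2)) z a) (h : a ≤ s) :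
    wt ψ (2 ^ (i + 2)) z ≤ (2 : ℝ≥0∞) ^ (e + i + 4) * lam (PS ψ s (rr ψ i e z s)) := by
  rw [wt_eq ha]
  induction h with
  | refl =>
    rw [rr_of_le ha le_rfl]
    calc lam (PS ψ a z) = 1 * lam (PS ψ a z) := (one_mul _).symm
      _ ≤ _ := by gcongr; exact one_le_pow₀ (by norm_num)
  | step h ih =>
    rcases rr_cases (ψ := ψ) i e z _ with h1 | ⟨b, a', ha', hact, h1, h2⟩ 
    · rw [h1.1]
      refine ih.trans ?_
      gcongr
      exact PS_mono hψ (Nat.le_succ _) _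
    · rw [hact.unique ha] at h2
      rw [h1]
      exact heavy_iff.1 h2

/-- If the target is stable at `r`, its children are light. -/
theorem rr_stable (hψ : Good ψ) {a s0 : ℕ} {r : List Bool} (ha : ActAt ψ (2 ^ (i + 2)) z a)
    (hr : ∀ s, s0 ≤ s → rr ψ i e z s = r) (b : Bool) :
    (2 : ℝ≥0∞) ^ (e + i + 4) * lam (PP ψ (r ++ [b])) ≤ lam (PP ψ z) := by
  have h1 : ∀ s, max s0 a + 1 ≤ s → (2 : ℝ≥0∞) ^ (e + i + 4) * lam (PS ψ s (r ++ [b])) ≤ lam (PP ψ z) := by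
    intro s hs
    obtain ⟨s, rfl⟩ : ∃ s', s = s' + 1 := ⟨s - 1, by omega⟩
    rcases rr_cases (ψ := ψ) i e z s with h1 | ⟨b', a', ha', hact, h1, h2⟩ 
    · have := h1.2 a (by omega) ha b
      rw [hr s (by omega), heavy_iff, not_le] at this
      exact this.le.trans (measure_mono (PS_sub_PP _ _))
    · rw [hr s (by omega), hr (s+1) (by omega)] at h1
      simp at h1
  have hp : (2 : ℝ≥0∞) ^ (e + i + 4) ≠ 0 := by simp
  have ht : (2 : ℝ≥0∞) ^ (e + i + 4) ≠ ⊤ := by simp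
  rw [mul_comm, ← ENNReal.le_div_iff_mul_le (Or.inl hp) (Or.inl ht)]
  refine PP_le hψ (max s0 a + 1) fun s hs => ?_
  rw [ENNReal.le_div_iff_mul_le (Or.inl hp) (Or.inl ht), mul_comm]
  exact h1 s hs

end rr

/-! ### Searching and triggering -/

/-- The `e`-th c.e. set of strings. -/
def Wset (e : ℕ) (σ : List Bool) : Prop := ((Denumerable.ofNat Nat.Partrec.Code e).eval (encode σ)).Dom

theorem succL_mem {e t : ℕ} {ζ η : List Bool} (h : succL e ζ t = some η) : ζ <+: η ∧ Wset e η := by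
  have h := List.mem_of_mem_head? (Option.mem_def.2 h)
  simp only [List.mem_filterMap, List.mem_range, Option.bind_eq_some_iff, Option.ite_none_right_eq_some,
    Bool.and_eq_true, Option.some.injEq] at h
  obtain ⟨n, -, η', hd, ⟨hp, hs⟩, rfl⟩ := h
  refine ⟨pfx_iff.1 hp, ?_⟩
  obtain ⟨x, hx⟩ := Option.isSome_iff_exists.1 hs
  exact Part.dom_iff_mem.2 ⟨x, Nat.Partrec.Code.evaln_sound (Option.mem_def.2 hx)⟩

theorem succL_isSome {e t : ℕ} {ζ : List Bool} : (succL e ζ t).isSome ↔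
    ∃ n η, n ≤ t ∧ decode (α := List Bool) n = some η ∧ ζ <+: η ∧
      (Nat.Partrec.Code.evaln t (Denumerable.ofNat Nat.Partrec.Code e) (encode η)).isSome := by
  rw [succL, List.isSome_head?, ← List.isEmpty_eq_false_iff, List.isEmpty_eq_false_iff_exists_mem]
  simp only [List.mem_filterMap, List.mem_range, Option.bind_eq_some_iff, Option.ite_none_right_eq_some,
    Bool.and_eq_true, Option.some.injEq]
  constructor
  · rintro ⟨η, n, hn, η', hd, ⟨hp, hs⟩, rfl⟩
    exact ⟨n, η', by omega, hd, pfx_iff.1 hp, hs⟩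
  · rintro ⟨n, η, hn, hd, hp, hs⟩
    exact ⟨η, n, by omega, η, hd, ⟨pfx_iff.2 hp, hs⟩, rfl⟩

theorem succL_mono {e s t : ℕ} {ζ : List Bool} (hst : s ≤ t) (h : (succL e ζ s).isSome) : (succL e ζ t).isSome := by
  rw [succL_isSome] at h ⊢
  obtain ⟨n, η, h1, hd, h2, h3⟩ := h
  refine ⟨n, η, h1.trans hst, hd, h2, ?_⟩
  obtain ⟨x, hx⟩ := Option.isSome_iff_exists.1 h3
  have := Nat.Partrec.Code.evaln_mono hst (Option.mem_def.2 hx)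
  rw [Option.mem_def.1 this]; rfl

theorem succL_complete {e : ℕ} {ζ η : List Bool} (h : ζ <+: η) (hη : Wset e η) : ∃ t, (succL e ζ t).isSome := by
  obtain ⟨x, hx⟩ := Part.dom_iff_mem.1 hη
  obtain ⟨k, hk⟩ := Nat.Partrec.Code.evaln_complete.1 hx
  refine ⟨max k (encode η), succL_isSome.2 ⟨encode η, η, le_max_right _ _, by simp, h, ?_⟩⟩
  have := Nat.Partrec.Code.evaln_mono (le_max_left k (encode η)) hk
  rw [Option.mem_def.1 this]; rfl

theorem trig_some {low : List (Option (List Bool))} {t j : ℕ} (h : trig low t = some j) :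
    (∃ ζ, low[j]? = some (some ζ) ∧ (succL j ζ t).isSome) ∧
      ∀ j' < j, ∀ ζ, low[j']? = some (some ζ) → succL j' ζ t = none := by
  rw [trig, List.head?_filter, List.find?_range_eq_some] at h
  obtain ⟨h1, h2, h3⟩ := h
  constructor
  · rw [Option.isSome_bind] at h1
    have hj : j < low.length := List.mem_range.1 h2
    rw [List.getElem?_eq_getElem hj] at h1 ⊢
    simp only [Option.getD_some] at h1
    cases hl : low[j] with
    | none => rw [hl] at h1; simp at h1
    | some ζ => rw [hl] at h1; exact ⟨ζ, rfl, by simpa using h1⟩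
  · intro j' hj' ζ hζ
    have := h3 j' hj'
    simpa [hζ] using this

theorem trig_none {low : List (Option (List Bool))} {t : ℕ} (h : trig low t = none) {j : ℕ} {ζ : List Bool}
    (hj : low[j]? = some (some ζ)) : succL j ζ t = none := by
  rw [trig, List.head?_filter, List.find?_range_eq_none] at h
  have hl : j < low.length := by
    by_contra hc
    rw [List.getElem?_eq_none (by omega)] at hj
    cases hj
  have := h j hl
  simpa [hj] using this

/-! ### States -/

theorem SSn_take (i : ℕ) (y y' : List Bool) (n : ℕ) (h : y.take n = y'.take n) : SSn ψ i y n = SSn ψ i y' n := by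
  induction n with
  | zero => rfl
  | succ n ih =>
    rw [SSn, SSn, h, ih]
    have := congrArg (List.take n) h
    simpa [List.take_take] using this

theorem SS_nil (i : ℕ) : SS ψ i [] = ([], [], []) := rfl

theorem SS_snoc (i : ℕ) (y : List Bool) (b : Bool) : SS ψ i (y ++ [b]) = step ψ i y.length (SS ψ i y) (y ++ [b]) := by
  rw [SS, List.length_append, List.length_singleton, SSn]
  rw [List.take_of_length_le (by simp), SSn_take i (y ++ [b]) y y.length (by simp)]
  rfl

/-- The possible transitions. -/
theorem SS_cases (i : ℕ) (y : List Bool) (b : Bool) :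
    (∃ j, trig (SS ψ i y).1 y.length = some j ∧ SS ψ i (y ++ [b]) = ((SS ψ i y).1.take j, y ++ [b], (SS ψ i y).2.2)) ∨
    (trig (SS ψ i y).1 y.length = none ∧
      ((∃ η, succL (SS ψ i y).1.length (SS ψ i y).2.2 y.length = some η ∧
          ((rr ψ i (SS ψ i y).1.length (SS ψ i y).2.1 y.length <+: y ++ [b] ∧ SS ψ i (y ++ [b]) = ((SS ψ i y).1 ++ [none], y ++ [b], η)) ∨
           (¬ rr ψ i (SS ψ i y).1.length (SS ψ i y).2.1 y.length <+: y ++ [b] ∧ SS ψ i (y ++ [b]) = ((SS ψ i y).1, y ++ [b], (SS ψ i y).2.2)))) ∨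
        (succL (SS ψ i y).1.length (SS ψ i y).2.2 y.length = none ∧
          ((rr ψ i (SS ψ i y).1.length (SS ψ i y).2.1 y.length <+: y ++ [b] ∧ SS ψ i (y ++ [b]) = SS ψ i y) ∨
           (¬ rr ψ i (SS ψ i y).1.length (SS ψ i y).2.1 y.length <+: y ++ [b] ∧
            SS ψ i (y ++ [b]) = ((SS ψ i y).1 ++ [some (SS ψ i y).2.2], y ++ [b], (SS ψ i y).2.2)))))) := by
  rw [SS_snoc, step]
  cases trig (SS ψ i y).1 y.length with
  | some j => exact Or.inl ⟨j, rfl, rfl⟩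
  | none =>
    right; refine ⟨rfl, ?_⟩
    cases succL (SS ψ i y).1.length (SS ψ i y).2.2 y.length with
    | some η =>
      left; refine ⟨η, rfl, ?_⟩
      by_cases h : rr ψ i (SS ψ i y).1.length (SS ψ i y).2.1 y.length <+: y ++ [b]
      · left; simp [pfx_iff.2 h, h]
      · right; simp [mt pfx_iff.1 h, h]
    | none =>
      right; refine ⟨rfl, ?_⟩
      by_cases h : rr ψ i (SS ψ i y).1.length (SS ψ i y).2.1 y.length <+: y ++ [b]
      · left; simp [pfx_iff.2 h, h]
      · right; simp [mt pfx_iff.1 h, h]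

theorem ext_ind {P : List Bool → Prop} {z : List Bool} (h0 : P z)
    (hs : ∀ y b, z <+: y → P y → P (y ++ [b])) {y : List Bool} (h : z <+: y) : P y := by
  obtain ⟨w, rfl⟩ := h
  induction w using List.reverseRecOn with
  | nil => simpa using h0
  | append_singleton w b ih =>
    rw [← List.append_assoc]
    exact hs _ _ (List.prefix_append _ _) ih

theorem SS_node (i : ℕ) (y : List Bool) : (SS ψ i y).2.1 <+: y ∧ SS ψ i (SS ψ i y).2.1 = SS ψ i y := by
  refine ext_ind (P := fun y => (SS ψ i y).2.1 <+: y ∧ SS ψ i (SS ψ i y).2.1 = SS ψ i y) (z := []) ?_ ?_ nil_prefix_le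
  · simp [SS_nil]
  · intro y b _ ih
    have key : ((SS ψ i (y ++ [b])).2.1 = y ++ [b]) ∨ SS ψ i (y ++ [b]) = SS ψ i y := by
      rcases SS_cases (ψ := ψ) i y b with ⟨j, -, h⟩ | ⟨-, ⟨η, -, ⟨-, h⟩ | ⟨-, h⟩⟩ | ⟨-, ⟨-, h⟩ | ⟨-, h⟩⟩⟩
      · left; rw [h]
      · left; rw [h]
      · left; rw [h]
      · right; rw [h]
      · left; rw [h]
    rcases key with h | h
    · rw [h]; exact ⟨List.prefix_refl _, rfl⟩
    · rw [h]; exact ⟨ih.1.trans (List.prefix_append _ _), ih.2⟩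

theorem SS_out_step (i : ℕ) (y : List Bool) (b : Bool) : (SS ψ i y).2.2 <+: (SS ψ i (y ++ [b])).2.2 := by
  rcases SS_cases (ψ := ψ) i y b with ⟨j, -, h⟩ | ⟨-, ⟨η, hη, ⟨-, h⟩ | ⟨-, h⟩⟩ | ⟨-, ⟨-, h⟩ | ⟨-, h⟩⟩⟩
  · rw [h]
  · rw [h]; exact (succL_mem hη).1
  · rw [h]
  · rw [h]
  · rw [h]

theorem SS_out_mono (i : ℕ) {y y' : List Bool} (h : y <+: y') : (SS ψ i y).2.2 <+: (SS ψ i y').2.2 :=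
  ext_ind (P := fun y' => (SS ψ i y).2.2 <+: (SS ψ i y').2.2) (List.prefix_refl _) (fun y' b _ ih => ih.trans (SS_out_step i y' b)) h

/-- Invariant on decisions. -/
def LowInv (low : List (Option (List Bool))) (ζ : List Bool) : Prop :=
  (∀ (j : ℕ) ζ', low[j]? = some (some ζ') → ζ' <+: ζ) ∧ ∀ j : ℕ, low[j]? = some none → ∃ η, η <+: ζ ∧ Wset j η

theorem LowInv.mono {low : List (Option (List Bool))} {ζ ζ' : List Bool} (h : LowInv low ζ) (hz : ζ <+: ζ') : LowInv low ζ' :=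
  ⟨fun j x hx => (h.1 j x hx).trans hz, fun j hj => by
    obtain ⟨η, h1, h2⟩ := h.2 j hj
    exact ⟨η, h1.trans hz, h2⟩⟩

theorem getElem?_of_prefix_le {α : Type*} {l l' : List α} (h : l <+: l') {j : ℕ} {a : α} (hj : l[j]? = some a) : l'[j]? = some a := by
  obtain ⟨r, rfl⟩ := h
  have hl : j < l.length := by
    by_contra hc
    rw [List.getElem?_eq_none (by omega)] at hj
    cases hj
  rw [List.getElem?_append_left hl]; exact hj

theorem LowInv.sub {low low' : List (Option (List Bool))} {ζ : List Bool} (h : LowInv low ζ) (hz : low' <+: low) : LowInv low' ζ :=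
  ⟨fun j x hx => h.1 j x (getElem?_of_prefix_le hz hx), fun j hj => h.2 j (getElem?_of_prefix_le hz hj)⟩

theorem getElem?_snoc {α : Type*} {l : List α} {o a : α} {j : ℕ} (h : (l ++ [o])[j]? = some a) : l[j]? = some a ∨ (j = l.length ∧ a = o) := by
  rcases lt_trichotomy j l.length with hj | hj | hj
  · rw [List.getElem?_append_left hj] at h; exact Or.inl h
  · subst hj; simp at h; exact Or.inr ⟨rfl, h.symm⟩
  · rw [List.getElem?_eq_none (by simp; omega)] at h; cases h

theorem SS_lowInv (i : ℕ) (y : List Bool) : LowInv (SS ψ i y).1 (SS ψ i y).2.2 := by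
  refine ext_ind (P := fun y => LowInv (SS ψ i y).1 (SS ψ i y).2.2) (z := []) ?_ ?_ nil_prefix_le
  · simp [SS_nil, LowInv]
  · intro y b _ ih
    rcases SS_cases (ψ := ψ) i y b with ⟨j, -, h⟩ | ⟨-, ⟨η, hη, ⟨-, h⟩ | ⟨-, h⟩⟩ | ⟨-, ⟨-, h⟩ | ⟨-, h⟩⟩⟩
    · rw [h]; exact ih.sub (take_prefix_le _ _)
    · rw [h]
      have hm := succL_mem hη
      have ih' := ih.mono hm.1
      constructor
      · intro j ζ' hj
        rcases getElem?_snoc hj with hj | ⟨-, hj⟩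
        · exact ih'.1 j ζ' hj
        · cases hj
      · intro j hj
        rcases getElem?_snoc hj with hj | ⟨hj, -⟩
        · exact ih'.2 j hj
        · exact ⟨η, List.prefix_refl _, by rw [hj]; exact hm.2⟩
    · rw [h]; exact ih
    · rw [h]; exact ih
    · rw [h]
      constructor
      · intro j ζ' hj
        rcases getElem?_snoc hj with hj | ⟨-, hj⟩
        · exact ih.1 j ζ' hj
        · rw [Option.some.inj hj]
      · intro j hj
        rcases getElem?_snoc hj with hj | ⟨-, hj⟩
        · exact ih.2 j hj
        · cases hj


end PartB5

section PartB6
open Encodable MeasureTheory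

variable {ψ : List Bool → List Bool}

/-! ### Nodes where the construction gets stuck -/

/-- A fresh activated node at which no relevant search ever succeeds. -/
def NodeL (ψ : List Bool → List Bool) (i : ℕ) (z : List Bool) : Prop :=
  (SS ψ i z).2.1 = z ∧ Act ψ (2 ^ (i + 2)) z ∧ (∀ t, succL (SS ψ i z).1.length (SS ψ i z).2.2 t = none) ∧
    ∀ t, trig (SS ψ i z).1 t = none

theorem trig_sub {low low' : List (Option (List Bool))} {t : ℕ} (hp : low <+: low') (h : trig low t = none) {j : ℕ}
    (h' : trig low' t = some j) : low.length ≤ j := by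
  by_contra hc
  obtain ⟨⟨ζ, h1, h2⟩, -⟩ := trig_some h'
  have h3 : low[j]? = some (some ζ) := by
    obtain ⟨r, rfl⟩ := hp
    rwa [List.getElem?_append_left (by omega)] at h1
  rw [trig_none h h3] at h2
  cases h2

theorem trig_lt {low : List (Option (List Bool))} {t j : ℕ} (h : trig low t = some j) : j < low.length := by
  obtain ⟨⟨ζ, h1, h2⟩, -⟩ := trig_some h
  by_contra hc
  rw [List.getElem?_eq_none (by omega)] at h1
  cases h1

theorem prefix_take {α : Type*} {l l' : List α} {j : ℕ} (h : l <+: l') (hj : l.length ≤ j) : l <+: l'.take j := by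
  rw [List.prefix_take_iff]; exact ⟨h, hj⟩

theorem getElem?_last {α : Type*} {l l' : List α} {o : α} (h : l ++ [o] <+: l') : l'[l.length]? = some o :=
  getElem?_of_prefix_le h (by simp)

theorem after_node {i : ℕ} {z : List Bool} (hz : NodeL ψ i z) {y : List Bool} (h : z <+: y) :
    SS ψ i y = SS ψ i z ∨ (SS ψ i z).1 ++ [some (SS ψ i z).2.2] <+: (SS ψ i y).1 := by
  refine ext_ind (P := fun y => SS ψ i y = SS ψ i z ∨ (SS ψ i z).1 ++ [some (SS ψ i z).2.2] <+: (SS ψ i y).1) (Or.inl rfl) ?_ h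
  intro y b _ ih
  obtain ⟨-, -, hs, ht⟩ := hz
  rcases ih with ih | ih
  · rcases SS_cases (ψ := ψ) i y b with ⟨j, h1, h⟩ | ⟨-, ⟨η, hη, -⟩ | ⟨-, ⟨-, h⟩ | ⟨-, h⟩⟩⟩
    · rw [ih, ht] at h1; cases h1
    · rw [ih, hs] at hη; cases hη
    · left; rw [h, ih]
    · right; rw [h, ih]
  · right
    rcases SS_cases (ψ := ψ) i y b with ⟨j, h1, h⟩ | ⟨-, ⟨η, hη, ⟨-, h⟩ | ⟨-, h⟩⟩ | ⟨-, ⟨-, h⟩ | ⟨-, h⟩⟩⟩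
    · rw [h]
      have hle := trig_sub ((List.prefix_append _ _).trans ih) (ht _) h1
      rcases hle.eq_or_lt with he | hlt
      · obtain ⟨⟨ζ, h2, h3⟩, -⟩ := trig_some h1
        rw [← he, getElem?_last ih] at h2
        simp only [Option.some.injEq] at h2
        rw [← h2, ← he, hs] at h3
        cases h3
      · exact prefix_take ih (by simp; omega)
    · rw [h]; exact ih.trans (List.prefix_append _ _)
    · rw [h]; exact ih
    · rw [h]; exact ih
    · rw [h]; exact ih.trans (List.prefix_append _ _)

theorem node_antichain {i : ℕ} {z z' : List Bool} (hz : NodeL ψ i z) (hz' : NodeL ψ i z')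
    (hl : (SS ψ i z).1.length = (SS ψ i z').1.length) (h : z <+: z') : z = z' := by
  rcases after_node hz h with h1 | h1
  · rw [← hz.1, ← h1, hz'.1]
  · have := h1.length_le
    simp at this; omega

/-- Oracles leaving the stable target of `z`. -/
def Ch (ψ : List Bool → List Bool) (i e : ℕ) (z : List Bool) : Set (ℕ → Bool) :=
  {X | ∃ r b s0, (∀ s, s0 ≤ s → rr ψ i e z s = r) ∧ X ∈ PP ψ (r ++ [b])}

theorem lam_Ch (hψ : Good ψ) {i e : ℕ} {z : List Bool} (hz : Act ψ (2 ^ (i + 2)) z) :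
    (2 : ℝ≥0∞) ^ (e + i + 4) * lam (Ch ψ i e z) ≤ 2 * lam (PP ψ z) := by
  by_cases h : ∃ r s0, ∀ s, s0 ≤ s → rr ψ i e z s = r
  · obtain ⟨r, s0, hr⟩ := h
    obtain ⟨a, ha⟩ := hz
    have hsub : Ch ψ i e z ⊆ PP ψ (r ++ [false]) ∪ PP ψ (r ++ [true]) := by
      rintro X ⟨r', b, s1, h1, h2⟩
      have : r' = r := (h1 (max s0 s1) (le_max_right _ _)).symm.trans (hr _ (le_max_left _ _))
      subst this
      cases b
      · exact Or.inl h2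
      · exact Or.inr h2
    calc (2 : ℝ≥0∞) ^ (e + i + 4) * lam (Ch ψ i e z)
        ≤ 2 ^ (e + i + 4) * (lam (PP ψ (r ++ [false])) + lam (PP ψ (r ++ [true]))) := by
          gcongr; exact (measure_mono hsub).trans (measure_union_le _ _)
      _ = 2 ^ (e + i + 4) * lam (PP ψ (r ++ [false])) + 2 ^ (e + i + 4) * lam (PP ψ (r ++ [true])) := mul_add _ _ _
      _ ≤ lam (PP ψ z) + lam (PP ψ z) := add_le_add (rr_stable hψ ha hr false) (rr_stable hψ ha hr true)
      _ = 2 * lam (PP ψ z) := (two_mul _).symm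
  · have : Ch ψ i e z = ∅ := by
      refine Set.eq_empty_iff_forall_notMem.2 ?_
      rintro X ⟨r, b, s0, h1, -⟩
      exact h ⟨r, s0, h1⟩
    simp [this]

/-- Stuck nodes for the `e`-th requirement. -/
def NodeE (ψ : List Bool → List Bool) (i e : ℕ) : Set (List Bool) := {z | NodeL ψ i z ∧ (SS ψ i z).1.length = e}

theorem lam_lossTwo (hψ : Good ψ) (i e : ℕ) :
    (2 : ℝ≥0∞) ^ (e + i + 4) * lam (⋃ z ∈ NodeE ψ i e, Ch ψ i e z) ≤ 2 := by
  have h1 : lam (⋃ z ∈ NodeE ψ i e, PP ψ z) = ∑' z : NodeE ψ i e, lam (PP ψ z) := by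
    rw [measure_biUnion (Set.to_countable _)]
    · intro z hz z' hz' hne
      apply (treeFam_PP hψ).disj
      · intro h; exact hne (node_antichain hz.1 hz'.1 (hz.2.trans hz'.2.symm) h)
      · intro h; exact hne (node_antichain hz'.1 hz.1 (hz'.2.trans hz.2.symm) h).symm
    · intro z _; exact (treeFam_PP hψ).meas z
  calc (2 : ℝ≥0∞) ^ (e + i + 4) * lam (⋃ z ∈ NodeE ψ i e, Ch ψ i e z)
      ≤ 2 ^ (e + i + 4) * ∑' z : NodeE ψ i e, lam (Ch ψ i e z) := by
        gcongr; exact measure_biUnion_le _ (Set.to_countable _) _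
    _ = ∑' z : NodeE ψ i e, 2 ^ (e + i + 4) * lam (Ch ψ i e z) := ENNReal.tsum_mul_left.symm
    _ ≤ ∑' z : NodeE ψ i e, 2 * lam (PP ψ z) := ENNReal.tsum_le_tsum fun z => lam_Ch hψ z.2.1.2.1
    _ = 2 * lam (⋃ z ∈ NodeE ψ i e, PP ψ z) := by rw [ENNReal.tsum_mul_left, h1]
    _ ≤ 2 * 1 := by gcongr; exact prob_le_one
    _ = 2 := mul_one _

/-- All losses. -/
def LossSet (ψ : List Bool → List Bool) (i : ℕ) : Set (ℕ → Bool) :=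
  (⋃ y ∈ {y | Never ψ (2 ^ (i + 2)) y}, PP ψ y) ∪ ⋃ e, ⋃ z ∈ NodeE ψ i e, Ch ψ i e z

theorem le_of_pow_mul_le {n : ℕ} {a c : ℝ≥0∞} (h : (2 : ℝ≥0∞) ^ n * a ≤ c) : a ≤ c * (2⁻¹) ^ n := by
  have hi : (2⁻¹ : ℝ≥0∞) ^ n * 2 ^ n = 1 := by
    rw [← mul_pow, ENNReal.inv_mul_cancel (by simp) (by simp), one_pow]
  calc a = (2⁻¹) ^ n * 2 ^ n * a := by rw [hi, one_mul]
    _ = (2 ^ n * a) * (2⁻¹) ^ n := by ring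
    _ ≤ _ := by gcongr

theorem lam_LossSet (hψ : Good ψ) (i : ℕ) : lam (LossSet ψ i) < (2 : ℝ≥0∞)⁻¹ ^ i := by
  have h1 : lam (⋃ y ∈ {y | Never ψ (2 ^ (i + 2)) y}, PP ψ y) ≤ (2⁻¹) ^ (i + 2) := by
    have := lossOne hψ (C := 2 ^ (i + 2))
    push_cast at this
    simpa using le_of_pow_mul_le this
  have h2 : ∀ e, lam (⋃ z ∈ NodeE ψ i e, Ch ψ i e z) ≤ 2⁻¹ ^ (i + 3) * 2⁻¹ ^ e := by
    intro e
    refine (le_of_pow_mul_le (lam_lossTwo hψ i e)).trans (le_of_eq ?_)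
    have e1 : e + i + 4 = (i + 3 + e) + 1 := by ring
    rw [e1, pow_succ, mul_comm, mul_assoc, ENNReal.inv_mul_cancel (by simp) (by simp), mul_one, pow_add]
  have h3 : lam (⋃ e, ⋃ z ∈ NodeE ψ i e, Ch ψ i e z) ≤ 2⁻¹ ^ (i + 2) := by
    calc lam (⋃ e, ⋃ z ∈ NodeE ψ i e, Ch ψ i e z) ≤ ∑' e, lam (⋃ z ∈ NodeE ψ i e, Ch ψ i e z) := measure_iUnion_le _
      _ ≤ ∑' e, 2⁻¹ ^ (i + 3) * 2⁻¹ ^ e := ENNReal.tsum_le_tsum h2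
      _ = 2⁻¹ ^ (i + 3) * 2 := by
        rw [ENNReal.tsum_mul_left, ENNReal.tsum_geometric, ENNReal.one_sub_inv_two, inv_inv]
      _ = 2⁻¹ ^ (i + 2) := by
        rw [pow_succ, mul_assoc, ENNReal.inv_mul_cancel (by simp) (by simp), mul_one]
  have h4 : lam (LossSet ψ i) ≤ 2⁻¹ ^ (i + 1) := by
    calc lam (LossSet ψ i) ≤ 2⁻¹ ^ (i + 2) + 2⁻¹ ^ (i + 2) := (measure_union_le _ _).trans (add_le_add h1 h3)
      _ = 2⁻¹ ^ (i + 1) := by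
        rw [← two_mul, pow_succ _ (i + 1), mul_comm, mul_assoc, ENNReal.inv_mul_cancel (by simp) (by simp), mul_one]
  refine lt_of_le_of_lt h4 ?_
  rw [pow_succ]
  calc (2⁻¹ : ℝ≥0∞) ^ i * 2⁻¹ < 2⁻¹ ^ i * 1 := by
        refine ENNReal.mul_lt_mul_right (by simp) (by simp) ?_
        exact ENNReal.inv_lt_one.2 (by norm_num)
    _ = _ := mul_one _

/-! ### The loss test -/

section prim
variable {α : Type*} [Primcodable α]

theorem prim_allowed' (hψ : Primrec ψ) {C s : α → ℕ} {y : α → List Bool} (hC : Primrec C) (hs : Primrec s) (hy : Primrec y) :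
    Primrec fun x => allowed ψ (C x) (s x) (y x) :=
  (prim_allowed hψ).comp (Primrec.pair (Primrec.pair hC hs) hy)

theorem prim_aOpt' (hψ : Primrec ψ) {C s : α → ℕ} {y : α → List Bool} (hC : Primrec C) (hs : Primrec s) (hy : Primrec y) :
    Primrec fun x => aOpt ψ (C x) (s x) (y x) :=
  (prim_aOpt hψ).comp (Primrec.pair (Primrec.pair hC hs) hy)

theorem prim_rr' (hψ : Primrec ψ) {i e s : α → ℕ} {z : α → List Bool} (hi : Primrec i) (he : Primrec e) (hs : Primrec s) (hz : Primrec z) :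
    Primrec fun x => rr ψ (i x) (e x) (z x) (s x) :=
  (prim_rr hψ).comp (Primrec.pair (Primrec.pair hi (Primrec.pair he hz)) hs)

theorem prim_SS' (hψ : Primrec ψ) {i : α → ℕ} {z : α → List Bool} (hi : Primrec i) (hz : Primrec z) :
    Primrec fun x => SS ψ (i x) (z x) := (prim_SS hψ).comp hi hz

theorem prim_succL' {e t : α → ℕ} {z : α → List Bool} (he : Primrec e) (ht : Primrec t) (hz : Primrec z) :
    Primrec fun x => succL (e x) (z x) (t x) := prim_succL.comp (Primrec.pair (Primrec.pair he hz) ht)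

end prim

/-- First kind of loss. -/
def test1 (ψ : List Bool → List Bool) (i : ℕ) (y : List Bool) (b : ℕ) : Bool :=
  decide (b < y.length) || !allowed ψ (2 ^ (i + 2)) b y

/-- Second kind of loss. -/
def test2 (ψ : List Bool → List Bool) (i : ℕ) (z r : List Bool) (s0 b : ℕ) : Bool :=
  decide ((SS ψ i z).2.1 = z) && ((aOpt ψ (2 ^ (i + 2)) s0 z).isSome &&
    (!(succL (SS ψ i z).1.length (SS ψ i z).2.2 b).isSome && (!(trig (SS ψ i z).1 b).isSome &&
      (decide (b < s0) || decide (rr ψ i (SS ψ i z).1.length z b = r)))))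

theorem prim_test1 (hψ : Primrec ψ) {α : Type*} [Primcodable α] {i b : α → ℕ} {y : α → List Bool} (hi : Primrec i) (hb : Primrec b)
    (hy : Primrec y) : Primrec fun x => test1 ψ (i x) (y x) (b x) := by
  have hC : Primrec fun x => 2 ^ (i x + 2) := prim_pow.comp (Primrec.const 2) (Primrec.nat_add.comp hi (Primrec.const 2))
  exact Primrec.or.comp (Primrec.nat_lt.decide.comp hb (Primrec.list_length.comp hy)) (Primrec.not.comp (prim_allowed' hψ hC hb hy))

theorem prim_test2 (hψ : Primrec ψ) {α : Type*} [Primcodable α] {i b s0 : α → ℕ} {z r : α → List Bool} (hi : Primrec i) (hb : Primrec b)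
    (hs : Primrec s0) (hz : Primrec z) (hr : Primrec r) : Primrec fun x => test2 ψ (i x) (z x) (r x) (s0 x) (b x) := by
  have hC : Primrec fun x => 2 ^ (i x + 2) := prim_pow.comp (Primrec.const 2) (Primrec.nat_add.comp hi (Primrec.const 2))
  have hS : Primrec fun x => SS ψ (i x) (z x) := prim_SS' hψ hi hz
  have hl : Primrec fun x => (SS ψ (i x) (z x)).1 := Primrec.fst.comp hS
  have he : Primrec fun x => (SS ψ (i x) (z x)).1.length := Primrec.list_length.comp hl
  have hz' : Primrec fun x => (SS ψ (i x) (z x)).2.1 := Primrec.fst.comp (Primrec.snd.comp hS)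
  have hζ : Primrec fun x => (SS ψ (i x) (z x)).2.2 := Primrec.snd.comp (Primrec.snd.comp hS)
  have h1 : Primrec fun x => decide ((SS ψ (i x) (z x)).2.1 = z x) := Primrec.eq.decide.comp hz' hz
  have h2 : Primrec fun x => (aOpt ψ (2 ^ (i x + 2)) (s0 x) (z x)).isSome := Primrec.option_isSome.comp (prim_aOpt' hψ hC hs hz)
  have h3 : Primrec fun x => !(succL (SS ψ (i x) (z x)).1.length (SS ψ (i x) (z x)).2.2 (b x)).isSome :=
    Primrec.not.comp (Primrec.option_isSome.comp (prim_succL' he hb hζ))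
  have h4 : Primrec fun x => !(trig (SS ψ (i x) (z x)).1 (b x)).isSome :=
    Primrec.not.comp (Primrec.option_isSome.comp (prim_trig.comp hl hb))
  have h5 : Primrec fun x => decide (b x < s0 x) := Primrec.nat_lt.decide.comp hb hs
  have h6 : Primrec fun x => decide (rr ψ (i x) (SS ψ (i x) (z x)).1.length (z x) (b x) = r x) :=
    Primrec.eq.decide.comp (prim_rr' hψ hi he hb hz) hr
  exact Primrec.and.comp h1 (Primrec.and.comp h2 (Primrec.and.comp h3 (Primrec.and.comp h4 (Primrec.or.comp h5 h6))))

/-- The matrix of the loss test; the witness codes a case, two lengths and a stage. -/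
def lossR (ψ : List Bool → List Bool) (i : ℕ) (v : List Bool) (k n m s0 b : ℕ) : Bool :=
  cond (decide (k = 0)) (test1 ψ i (v.take n) b) (decide (m < v.length) && test2 ψ i (v.take n) (v.take m) s0 b)

/-- The loss test. -/
def lossV (ψ : List Bool → List Bool) (i : ℕ) : Set (List Bool) :=
  {σ | ∃ k n m s0, ∀ b, lossR ψ i (ψ σ) k n m s0 b = true}

theorem lossV_ce (hψ : Good ψ) : UniformCEIn zeroJump (lossV ψ) := by
  let R : (ℕ × List Bool) × ℕ → ℕ → Bool := fun p b => lossR ψ p.1.1 (ψ p.1.2) p.2.unpair.1 p.2.unpair.2.unpair.1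
    p.2.unpair.2.unpair.2.unpair.1 p.2.unpair.2.unpair.2.unpair.2 b
  have hR : Primrec₂ R := by
    have hi : Primrec fun q : ((ℕ × List Bool) × ℕ) × ℕ => q.1.1.1 := Primrec.fst.comp (Primrec.fst.comp Primrec.fst)
    have hv : Primrec fun q : ((ℕ × List Bool) × ℕ) × ℕ => ψ q.1.1.2 := hψ.prim.comp (Primrec.snd.comp (Primrec.fst.comp Primrec.fst))
    have ha : Primrec fun q : ((ℕ × List Bool) × ℕ) × ℕ => q.1.2 := Primrec.snd.comp Primrec.fst
    have hb : Primrec fun q : ((ℕ × List Bool) × ℕ) × ℕ => q.2 := Primrec.snd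
    have hk : Primrec fun q : ((ℕ × List Bool) × ℕ) × ℕ => q.1.2.unpair.1 := Primrec.fst.comp (Primrec.unpair.comp ha)
    have ha2 : Primrec fun q : ((ℕ × List Bool) × ℕ) × ℕ => q.1.2.unpair.2 := Primrec.snd.comp (Primrec.unpair.comp ha)
    have hn : Primrec fun q : ((ℕ × List Bool) × ℕ) × ℕ => q.1.2.unpair.2.unpair.1 := Primrec.fst.comp (Primrec.unpair.comp ha2)
    have ha3 : Primrec fun q : ((ℕ × List Bool) × ℕ) × ℕ => q.1.2.unpair.2.unpair.2 := Primrec.snd.comp (Primrec.unpair.comp ha2)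
    have hm : Primrec fun q : ((ℕ × List Bool) × ℕ) × ℕ => q.1.2.unpair.2.unpair.2.unpair.1 := Primrec.fst.comp (Primrec.unpair.comp ha3)
    have hs : Primrec fun q : ((ℕ × List Bool) × ℕ) × ℕ => q.1.2.unpair.2.unpair.2.unpair.2 := Primrec.snd.comp (Primrec.unpair.comp ha3)
    have hz := Primrec.list_take.comp hn hv
    have hr := Primrec.list_take.comp hm hv
    have t1 := prim_test1 hψ.prim hi hb hz
    have t2 := prim_test2 hψ.prim hi hb hs hz hr
    have t3 : Primrec fun q : ((ℕ × List Bool) × ℕ) × ℕ => decide (q.1.2.unpair.2.unpair.2.unpair.1 < (ψ q.1.1.2).length) :=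
      Primrec.nat_lt.decide.comp hm (Primrec.list_length.comp hv)
    have t4 : Primrec fun q : ((ℕ × List Bool) × ℕ) × ℕ => decide (q.1.2.unpair.1 = 0) :=
      Primrec.eq.decide.comp hk (Primrec.const 0)
    exact Primrec.cond t4 t1 (Primrec.and.comp t3 t2)
  refine sigma2_uniformCE hR fun i σ => ?_
  constructor
  · rintro ⟨k, n, m, s0, h⟩
    refine ⟨Nat.pair k (Nat.pair n (Nat.pair m s0)), fun b => ?_⟩
    simpa [R] using h b
  · rintro ⟨a, h⟩
    exact ⟨_, _, _, _, h⟩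

theorem lossV_sub (hψ : Good ψ) (i : ℕ) : openOf (lossV ψ i) ⊆ LossSet ψ i := by
  rintro X ⟨σ, ⟨k, n, m, s0, h⟩, hX⟩
  have hσ := pre_eq_iff.2 hX
  by_cases hk : k = 0
  · left
    have hp : (ψ σ).take n <+: ψ (pre X σ.length) := by rw [hσ]; exact take_prefix_le _ _
    refine Set.mem_iUnion₂.2 ⟨(ψ σ).take n, ?_, mem_PP.2 ⟨σ.length, hp⟩⟩
    intro s hs
    have := h s
    rw [hk, lossR] at this
    simp only [decide_true, cond_true, test1, Bool.or_eq_true, decide_eq_true_eq, Bool.not_eq_true', ] at this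
    rcases this with h1 | h1
    · omega
    · exact h1
  · right
    have h' : ∀ b, m < (ψ σ).length ∧ test2 ψ i ((ψ σ).take n) ((ψ σ).take m) s0 b = true := by
      intro b
      have := h b
      simpa [lossR, hk] using this
    have hm := (h' 0).1
    set z := (ψ σ).take n
    set r := (ψ σ).take m with hr
    have h2 : ∀ b, (SS ψ i z).2.1 = z ∧ (aOpt ψ (2 ^ (i + 2)) s0 z).isSome ∧
        succL (SS ψ i z).1.length (SS ψ i z).2.2 b = none ∧ trig (SS ψ i z).1 b = none ∧ (b < s0 ∨ rr ψ i (SS ψ i z).1.length z b = r) := by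
      intro b
      simpa [test2] using (h' b).2
    have hact : Act ψ (2 ^ (i + 2)) z := by
      obtain ⟨a, ha⟩ := Option.isSome_iff_exists.1 (h2 0).2.1
      exact ⟨a, (aOpt_eq_some.1 ha).2⟩
    refine Set.mem_iUnion.2 ⟨(SS ψ i z).1.length, Set.mem_iUnion₂.2 ⟨z, ⟨⟨(h2 0).1, hact, fun t => (h2 t).2.2.1, fun t => (h2 t).2.2.2.1⟩, rfl⟩, ?_⟩⟩
    refine ⟨r, (ψ σ)[m], s0, fun s hs => ?_, mem_PP.2 ⟨σ.length, ?_⟩⟩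
    · rcases (h2 s).2.2.2.2 with h3 | h3
      · omega
      · exact h3
    · rw [hσ, hr, List.take_append_getElem]
      exact take_prefix_le _ _

theorem lossV_test (hψ : Good ψ) : MLTest zeroJump (lossV ψ) :=
  ⟨lossV_ce hψ, fun i => (stringMeasure_le _).trans_lt ((measure_mono (lossV_sub hψ i)).trans_lt (lam_LossSet hψ i))⟩


end PartB6

section PartB7
open Encodable MeasureTheory

variable {ψ : List Bool → List Bool}

/-! ### Restarts of a fixed requirement -/

/-- Nodes above `ρ0` where the requirement after `low` is restarted. -/
def EE (ψ : List Bool → List Bool) (i : ℕ) (low : List (Option (List Bool))) (ρ0 z : List Bool) : Prop :=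
  ρ0 <+: z ∧ (∀ y, ρ0 <+: y → y <+: z → low <+: (SS ψ i y).1) ∧ (SS ψ i z).2.1 = z ∧ (SS ψ i z).1 = low

/-- Behaviour of the construction between restarts. -/
def Stat (ψ : List Bool → List Bool) (i : ℕ) (low : List (Option (List Bool))) (ρ ζ y : List Bool) : Prop :=
  (SS ψ i y = (low, ρ, ζ) ∧ ∀ t, ρ.length ≤ t → t < y.length → succL low.length ζ t = none) ∨
  (low ++ [some ζ] <+: (SS ψ i y).1 ∧ (∀ t, ρ.length ≤ t → t < y.length → succL low.length ζ t = none) ∧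
    ∃ t, t < y.length ∧ ¬ rr ψ i low.length ρ t <+: y) ∨
  low ++ [none] <+: (SS ψ i y).1

theorem not_prefix_ext {r y y' : List Bool} (h : ¬ r <+: y) (hl : r.length ≤ y.length) (hy : y <+: y') : ¬ r <+: y' :=
  fun hr => h (List.prefix_of_prefix_length_le hr hy hl)

theorem stat_step {i : ℕ} {low : List (Option (List Bool))} {ρ ζ y : List Bool} {b : Bool} (hρ : ρ <+: y)
    (hst : Stat ψ i low ρ ζ y) (hl : low <+: (SS ψ i (y ++ [b])).1) :
    (Stat ψ i low ρ ζ (y ++ [b]) ∧ ¬ ((SS ψ i (y ++ [b])).2.1 = y ++ [b] ∧ (SS ψ i (y ++ [b])).1 = low)) ∨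
    ((SS ψ i (y ++ [b])).2.1 = y ++ [b] ∧ (SS ψ i (y ++ [b])).1 = low ∧ (succL low.length ζ y.length).isSome ∧
      (∀ t, ρ.length ≤ t → t < y.length → succL low.length ζ t = none) ∧
      ¬ rr ψ i low.length ρ y.length <+: y ++ [b]) := by
  have hρl := hρ.length_le
  have hext : ∀ o, low ++ [o] <+: (SS ψ i (y ++ [b])).1 →
      ¬ ((SS ψ i (y ++ [b])).2.1 = y ++ [b] ∧ (SS ψ i (y ++ [b])).1 = low) := by
    rintro o h ⟨-, h2⟩
    rw [h2] at h
    have := h.length_le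
    simp at this
  have hnone : (∀ t, ρ.length ≤ t → t < y.length → succL low.length ζ t = none) → succL low.length ζ y.length = none →
      ∀ t, ρ.length ≤ t → t < (y ++ [b]).length → succL low.length ζ t = none := by
    intro h1 h2 t ht ht'
    simp only [List.length_append, List.length_singleton] at ht'
    rcases Nat.lt_succ_iff_lt_or_eq.1 ht' with h | h
    · exact h1 t ht h
    · rw [h]; exact h2
  rcases hst with ⟨hS, hn⟩ | ⟨hS, hn, t, ht, hr⟩ | hS
  · rcases SS_cases (ψ := ψ) i y b with ⟨j, h1, h⟩ | ⟨ht, ⟨η, hη, ⟨hr, h⟩ | ⟨hr, h⟩⟩ | ⟨hs, ⟨hr, h⟩ | ⟨hr, h⟩⟩⟩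
    · rw [h] at hl
      have h2 := trig_lt h1
      have h3 := hl.length_le
      rw [hS] at h2 h3
      simp at h2 h3; omega
    · left
      have : low ++ [none] <+: (SS ψ i (y ++ [b])).1 := by rw [h, hS]
      exact ⟨Or.inr (Or.inr this), hext _ this⟩
    · right
      rw [hS] at hη hr h
      refine ⟨by rw [h], by rw [h], by rw [hη]; rfl, hn, hr⟩
    · left
      refine ⟨Or.inl ⟨h.trans hS, hnone hn ?_⟩, ?_⟩
      · rw [hS] at hs; exact hs
      · rintro ⟨h2, -⟩
        rw [h, hS] at h2
        simp only at h2
        rw [h2] at hρl; simp at hρl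
    · left
      have : low ++ [some ζ] <+: (SS ψ i (y ++ [b])).1 := by rw [h, hS]
      refine ⟨Or.inr (Or.inl ⟨this, hnone hn ?_, y.length, by simp, ?_⟩), hext _ this⟩
      · rw [hS] at hs; exact hs
      · rw [hS] at hr; exact hr
  · have hrl : (rr ψ i low.length ρ t).length ≤ y.length := by
      have := rr_len (ψ := ψ) (i := i) (e := low.length) (z := ρ) t
      omega
    have hr' := not_prefix_ext hr hrl (List.prefix_append y [b])
    have hkeep : low ++ [some ζ] <+: (SS ψ i (y ++ [b])).1 → succL low.length ζ y.length = none →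
        Stat ψ i low ρ ζ (y ++ [b]) ∧ ¬ ((SS ψ i (y ++ [b])).2.1 = y ++ [b] ∧ (SS ψ i (y ++ [b])).1 = low) := fun h1 h2 =>
      ⟨Or.inr (Or.inl ⟨h1, hnone hn h2, t, by simp; omega, hr'⟩), hext _ h1⟩
    have hlast := getElem?_last hS
    rcases SS_cases (ψ := ψ) i y b with ⟨j, h1, h⟩ | ⟨ht', ⟨η, hη, ⟨-, h⟩ | ⟨-, h⟩⟩ | ⟨hs, ⟨-, h⟩ | ⟨-, h⟩⟩⟩
    · have hj : low.length ≤ j := by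
        rw [h] at hl
        have := hl.length_le
        simp at this; omega
      obtain ⟨⟨ζ', h2, h3⟩, h4⟩ := trig_some h1
      rcases hj.eq_or_lt with he | hlt
      · right
        subst he
        rw [hlast] at h2
        simp only [Option.some.injEq] at h2
        subst h2
        refine ⟨by rw [h], ?_, h3, hn, fun hc => hr' ((rr_mono ht.le).trans hc)⟩
        rw [h]
        exact (List.prefix_iff_eq_take.1 ((List.prefix_append _ _).trans hS)).symm
      · left
        refine hkeep ?_ (h4 _ hlt _ hlast)
        rw [h]; exact prefix_take hS (by simp; omega)
    · left; refine hkeep ?_ (trig_none ht' hlast); rw [h]; exact hS.trans (List.prefix_append _ _)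
    · left; refine hkeep ?_ (trig_none ht' hlast); rw [h]; exact hS
    · left; refine hkeep ?_ (trig_none ht' hlast); rw [h]; exact hS
    · left; refine hkeep ?_ (trig_none ht' hlast); rw [h]; exact hS.trans (List.prefix_append _ _)
  · left
    have hlast := getElem?_last hS
    suffices this : low ++ [none] <+: (SS ψ i (y ++ [b])).1 from ⟨Or.inr (Or.inr this), hext _ this⟩
    rcases SS_cases (ψ := ψ) i y b with ⟨j, h1, h⟩ | ⟨ht', ⟨η, hη, ⟨-, h⟩ | ⟨-, h⟩⟩ | ⟨hs, ⟨-, h⟩ | ⟨-, h⟩⟩⟩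
    · have hj : low.length ≤ j := by
        rw [h] at hl
        have := hl.length_le
        simp at this; omega
      obtain ⟨⟨ζ', h2, h3⟩, h4⟩ := trig_some h1
      rcases hj.eq_or_lt with he | hlt
      · subst he
        rw [hlast] at h2
        simp at h2
      · rw [h]; exact prefix_take hS (by simp; omega)
    · rw [h]; exact hS.trans (List.prefix_append _ _)
    · rw [h]; exact hS
    · rw [h]; exact hS
    · rw [h]; exact hS.trans (List.prefix_append _ _)

/-- `t + 1` is the length of the restart following `ρ`. -/
def NextT (ψ : List Bool → List Bool) (i e : ℕ) (ρ : List Bool) (t : ℕ) : Prop :=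
  ρ.length ≤ t ∧ (succL e (SS ψ i ρ).2.2 t).isSome ∧ ∀ t', ρ.length ≤ t' → t' < t → succL e (SS ψ i ρ).2.2 t' = none

theorem NextT.unique {i e : ℕ} {ρ : List Bool} {t t' : ℕ} (h : NextT ψ i e ρ t) (h' : NextT ψ i e ρ t') : t = t' := by
  rcases lt_trichotomy t t' with hl | hl | hl
  · have h1 := h.2.1
    rw [h'.2.2 t h.1 hl] at h1; cases h1
  · exact hl
  · have h1 := h'.2.1
    rw [h.2.2 t' h'.1 hl] at h1; cases h1

theorem next_node {i : ℕ} {low : List (Option (List Bool))} {ρ0 ρ z : List Bool} (hρ : EE ψ i low ρ0 ρ) (hz : EE ψ i low ρ0 z)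
    (hpz : ρ <+: z) (hne : ρ ≠ z) (hcons : ∀ y, EE ψ i low ρ0 y → ρ <+: y → y <+: z → y = ρ ∨ y = z) :
    ∃ t, z.length = t + 1 ∧ NextT ψ i low.length ρ t ∧ ¬ rr ψ i low.length ρ t <+: z := by
  have key : ∀ y, ρ <+: y → y <+: z → Stat ψ i low ρ (SS ψ i ρ).2.2 y ∨
      (y = z ∧ ∃ t, z.length = t + 1 ∧ NextT ψ i low.length ρ t ∧ ¬ rr ψ i low.length ρ t <+: z) := by
    intro y hy
    refine ext_ind (P := fun y => y <+: z → Stat ψ i low ρ (SS ψ i ρ).2.2 y ∨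
      (y = z ∧ ∃ t, z.length = t + 1 ∧ NextT ψ i low.length ρ t ∧ ¬ rr ψ i low.length ρ t <+: z)) ?_ ?_ hy
    · intro _
      left; left
      refine ⟨Prod.ext hρ.2.2.2 (Prod.ext hρ.2.2.1 rfl), fun t h1 h2 => by omega⟩
    · intro y b hy ih hyb
      rcases ih ((List.prefix_append _ _).trans hyb) with hst | ⟨rfl, -⟩
      · have hlow := hz.2.1 (y ++ [b]) (hρ.1.trans (hy.trans (List.prefix_append _ _))) hyb
        rcases stat_step hy hst hlow with h | ⟨h1, h2, h3, h4, h5⟩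
        · exact Or.inl h.1
        · right
          have hE : EE ψ i low ρ0 (y ++ [b]) :=
            ⟨hρ.1.trans (hy.trans (List.prefix_append _ _)), fun y' ha hb => hz.2.1 y' ha (hb.trans hyb), h1, h2⟩
          rcases hcons _ hE (hy.trans (List.prefix_append _ _)) hyb with h | h
          · have := hy.length_le
            rw [← h] at this
            simp at this
          · subst h
            exact ⟨rfl, y.length, by simp, ⟨hy.length_le, h3, h4⟩, h5⟩
      · have := hyb.length_le
        simp at this
  obtain ⟨w, rfl⟩ := hpz
  induction w using List.reverseRecOn with
  | nil => simp at hne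
  | append_singleton w b _ =>
    rw [← List.append_assoc] at *
    have hy : ρ <+: ρ ++ w := List.prefix_append _ _
    rcases key (ρ ++ w) hy (List.prefix_append _ _) with hst | ⟨h, -⟩
    · rcases stat_step hy hst (hz.2.1 _ hz.1 (List.prefix_refl _)) with h | ⟨h1, h2, h3, h4, h5⟩
      · exact absurd ⟨hz.2.2.1, hz.2.2.2⟩ h.2
      · exact ⟨(ρ ++ w).length, by simp; omega, ⟨hy.length_le, h3, h4⟩, h5⟩
    · have := congrArg List.length h
      simp at this


end PartB7

section PartB8
open Encodable MeasureTheory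

variable {ψ : List Bool → List Bool}

/-! ### Oracles with infinitely many restarts -/

/-- Restart nodes of length at least `k` that are activated. -/
def BE (ψ : List Bool → List Bool) (i : ℕ) (low : List (Option (List Bool))) (ρ0 : List Bool) (k : ℕ) : Set (List Bool) :=
  {z | EE ψ i low ρ0 z ∧ k ≤ z.length ∧ Act ψ (2 ^ (i + 2)) z}

/-- Oracles passing through such a node. -/
def OE (ψ : List Bool → List Bool) (i : ℕ) (low : List (Option (List Bool))) (ρ0 : List Bool) (k : ℕ) : Set (ℕ → Bool) :=
  ⋃ z ∈ BE ψ i low ρ0 k, PP ψ z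

/-- Oracles with infinitely many restarts. -/
def NN (ψ : List Bool → List Bool) (i : ℕ) (low : List (Option (List Bool))) (ρ0 : List Bool) : Set (ℕ → Bool) :=
  ⋂ k, OE ψ i low ρ0 k

section
variable {i : ℕ} {low : List (Option (List Bool))} {ρ0 : List Bool}

theorem mem_OE {k : ℕ} {X : ℕ → Bool} : X ∈ OE ψ i low ρ0 k ↔ ∃ z, z ∈ BE ψ i low ρ0 k ∧ X ∈ PP ψ z := by
  simp [OE]

theorem meas_OE (hψ : Good ψ) (k : ℕ) : MeasurableSet (OE ψ i low ρ0 k) :=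
  MeasurableSet.biUnion (Set.to_countable _) fun β _ => (treeFam_PP hψ).meas β

theorem meas_NN (hψ : Good ψ) : MeasurableSet (NN ψ i low ρ0) := MeasurableSet.iInter fun k => meas_OE hψ k

theorem OE_anti : Antitone (OE ψ i low ρ0) := by
  intro k k' h X hX
  rw [mem_OE] at *
  obtain ⟨z, hz, h'⟩ := hX
  exact ⟨z, ⟨hz.1, h.trans hz.2.1, hz.2.2⟩, h'⟩

theorem NN_mem {X : ℕ → Bool} (h : X ∈ NN ψ i low ρ0) (k : ℕ) : ∃ z, EE ψ i low ρ0 z ∧ k ≤ z.length ∧ Act ψ (2 ^ (i + 2)) z ∧ X ∈ PP ψ z := by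
  obtain ⟨z, hz, h'⟩ := mem_OE.1 (Set.mem_iInter.1 h k)
  exact ⟨z, hz.1, hz.2.1, hz.2.2, h'⟩

theorem NN_sub_DD (hψ : Good ψ) (l : ℕ) : NN ψ i low ρ0 ⊆ DD ψ (2 ^ (i + 2)) l := by
  intro X hX
  obtain ⟨z, -, hl, ha, hz⟩ := NN_mem hX l
  refine Set.mem_biUnion (x := z.take l) ⟨by simp [hl], ha.prefix_le (take_prefix_le _ _)⟩ ?_
  exact (treeFam_PP hψ).anti _ _ (take_prefix_le _ _) hz

theorem PP_prefix_le (hψ : Good ψ) {X : ℕ → Bool} {β γ : List Bool} (h1 : X ∈ PP ψ β) (h2 : X ∈ PP ψ γ) (h : β.length ≤ γ.length) :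
    β <+: γ := by
  rcases PP_comparable hψ h1 h2 with hh | hh
  · exact hh
  · rw [hh.eq_of_length_le h]

/-- The next restart along `X`. -/
theorem next_along (hψ : Good ψ) {X : ℕ → Bool} (hX : X ∈ NN ψ i low ρ0) {ρ : List Bool} (hρ : EE ψ i low ρ0 ρ) (hXρ : X ∈ PP ψ ρ) :
    ∃ z t, EE ψ i low ρ0 z ∧ X ∈ PP ψ z ∧ z.length = t + 1 ∧ NextT ψ i low.length ρ t ∧ ¬ rr ψ i low.length ρ t <+: z := by
  classical
  have hex : ∃ n, ∃ z, EE ψ i low ρ0 z ∧ X ∈ PP ψ z ∧ ρ.length < z.length ∧ z.length = n := by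
    obtain ⟨z, h1, h2, -, h3⟩ := NN_mem hX (ρ.length + 1)
    exact ⟨_, z, h1, h3, h2, rfl⟩
  obtain ⟨z, h1, h2, h3, h4⟩ := Nat.find_spec hex
  have hpz : ρ <+: z := PP_prefix_le hψ hXρ h2 h3.le
  obtain ⟨t, a, b, c⟩ := next_node hρ h1 hpz (by rintro rfl; omega) (by
    intro y hy hρy hyz
    by_cases hl : y.length ≤ ρ.length
    · left; exact (hρy.eq_of_length_le hl).symm
    · right
      refine hyz.eq_of_length_le ?_
      rw [h4]
      exact Nat.find_min' hex ⟨y, hy, (treeFam_PP hψ).anti _ _ hyz h2, by omega, rfl⟩)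
  exact ⟨z, t, h1, h2, a, b, c⟩

theorem le_diff_of_disjoint {c : ℝ≥0∞} (hc : 1 ≤ c) {z : List Bool} {N : Set (ℕ → Bool)} (C : ℕ) (h : ∀ X ∈ PP ψ z, X ∉ N) :
    wt ψ C z ≤ c * lam (PP ψ z \ N) := by
  have : PP ψ z \ N = PP ψ z := sdiff_eq_left.2 (Set.disjoint_left.2 h)
  rw [this]
  calc wt ψ C z ≤ 1 * lam (PP ψ z) := by rw [one_mul]; exact wt_le _ _
    _ ≤ _ := by gcongr

theorem knode (hψ : Good ψ) {z : List Bool} (hz : EE ψ i low ρ0 z) (hact : Act ψ (2 ^ (i + 2)) z) :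
    wt ψ (2 ^ (i + 2)) z ≤ 2 ^ (low.length + i + 4) * lam (PP ψ z \ NN ψ i low ρ0) := by
  by_cases hemp : ∀ X ∈ PP ψ z, X ∉ NN ψ i low ρ0
  · exact le_diff_of_disjoint (one_le_pow₀ (by norm_num)) _ hemp
  · push Not at hemp
    obtain ⟨X, hX, hXN⟩ := hemp
    obtain ⟨a, ha⟩ := hact
    obtain ⟨z', t, -, -, -, ht, -⟩ := next_along hψ hXN hz hX
    have hdis : ∀ Y ∈ PP ψ (rr ψ i low.length z t), Y ∉ NN ψ i low ρ0 := by
      intro Y hY hYN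
      obtain ⟨z1, t1, -, h2, h3, h4, h5⟩ := next_along hψ hYN hz ((treeFam_PP hψ).anti _ _ (rr_ext t) hY)
      rw [h4.unique ht] at h3 h5
      refine h5 (PP_prefix_le hψ hY h2 ?_)
      have := rr_len (ψ := ψ) (i := i) (e := low.length) (z := z) t
      have := ht.1
      omega
    rcases le_or_gt a t with hat | hat
    · refine (rr_heavy (e := low.length) hψ ha hat).trans ?_
      gcongr
      intro Y hY
      have hY' := PS_sub_PP _ _ hY
      exact ⟨(treeFam_PP hψ).anti _ _ (rr_ext t) hY', hdis Y hY'⟩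
    · rw [rr_of_le ha hat.le] at hdis
      exact absurd hXN (hdis X hX)

theorem sumL (hψ : Good ψ) {N : Set (ℕ → Bool)} (hN : MeasurableSet N) {C l : ℕ} (hND : N ⊆ DD ψ C l) {c : ℝ≥0∞} (hc : 1 ≤ c)
    (τ : List Bool) (h : ∀ z, z.length = l → τ <+: z → Act ψ C z → wt ψ C z ≤ c * lam (PP ψ z \ N)) :
    mT ψ C l {y | τ <+: y} + lam (PP ψ τ \ DD ψ C l) ≤ c * lam (PP ψ τ \ N) := by
  classical
  let B : Set (List Bool) := {z | z.length = l ∧ τ <+: z ∧ Act ψ C z}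
  have h1 : mT ψ C l {y | τ <+: y} ≤ c * lam (⋃ z ∈ B, PP ψ z \ N) := by
    rw [measure_biUnion (Set.to_countable _)]
    · rw [tsum_subtype B (fun z => lam (PP ψ z \ N)), ← ENNReal.tsum_mul_left, mT_apply]
      refine ENNReal.tsum_le_tsum fun z => ?_
      by_cases hz : z ∈ B
      · rw [Set.indicator_of_mem (show z ∈ {y | τ <+: y} from hz.2.1), Set.indicator_of_mem hz, if_pos hz.1]
        exact h z hz.1 hz.2.1 hz.2.2
      · have : Set.indicator {y | τ <+: y} (fun y => if y.length = l then wt ψ C y else 0) z = 0 := by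
          rw [Set.indicator_apply_eq_zero]
          intro h1
          split_ifs with h2
          · have : ¬ Act ψ C z := fun h3 => hz ⟨h2, h1, h3⟩
            refine le_antisymm (iSup₂_le fun a ha => absurd ⟨a, ha⟩ this) bot_le
          · rfl
        rw [this]; exact bot_le
    · intro z hz z' hz' hne
      refine Disjoint.mono Set.sdiff_subset Set.sdiff_subset ?_
      apply (treeFam_PP hψ).disj
      · intro hp; exact hne (hp.eq_of_length (hz.1.trans hz'.1.symm))
      · intro hp; exact hne (hp.eq_of_length (hz'.1.trans hz.1.symm)).symm
    · intro z _; exact ((treeFam_PP hψ).meas z).diff hN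
  calc mT ψ C l {y | τ <+: y} + lam (PP ψ τ \ DD ψ C l)
      ≤ c * lam (⋃ z ∈ B, PP ψ z \ N) + c * lam (PP ψ τ \ DD ψ C l) := by
        refine add_le_add h1 ?_
        calc _ = 1 * lam (PP ψ τ \ DD ψ C l) := (one_mul _).symm
          _ ≤ _ := by gcongr
    _ = c * lam ((⋃ z ∈ B, PP ψ z \ N) ∪ PP ψ τ \ DD ψ C l) := by
        rw [← mul_add, measure_union]
        · refine Set.disjoint_left.2 fun X hX hX' => ?_
          simp only [Set.mem_iUnion] at hX
          obtain ⟨z, hz, hX, -⟩ := hX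
          exact hX'.2 (Set.mem_biUnion (x := z) ⟨hz.1, hz.2.2⟩ hX)
        · exact ((treeFam_PP hψ).meas τ).diff (meas_DD hψ C l)
    _ ≤ _ := by
        gcongr
        refine Set.union_subset ?_ (Set.sdiff_subset_sdiff_right hND)
        refine Set.iUnion₂_subset fun z hz => Set.sdiff_subset_sdiff_left ?_
        exact (treeFam_PP hψ).anti _ _ hz.2.1

theorem ynode (hψ : Good ψ) {ρ y : List Bool} (hρ : EE ψ i low ρ0 ρ) (hρy : ρ <+: y) (hact : Act ψ (2 ^ (i + 2)) y) :
    wt ψ (2 ^ (i + 2)) y ≤ 2 ^ (i + 2) * 2 ^ (low.length + i + 4) * lam (PP ψ y \ NN ψ i low ρ0) := by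
  classical
  have hK : (1 : ℝ≥0∞) ≤ 2 ^ (low.length + i + 4) := one_le_pow₀ (by norm_num)
  by_cases hemp : ∀ X ∈ PP ψ y, X ∉ NN ψ i low ρ0
  · refine le_diff_of_disjoint ?_ _ hemp
    exact one_le_mul_of_one_le_of_one_le (one_le_pow₀ (by norm_num)) hK
  · push Not at hemp
    obtain ⟨X, hX, hXN⟩ := hemp
    obtain ⟨a, ha⟩ := hact
    -- the longest restart below `y`
    obtain ⟨ρ', h1, h2, h3⟩ : ∃ ρ', EE ψ i low ρ0 ρ' ∧ ρ' <+: y ∧ ∀ z, EE ψ i low ρ0 z → z <+: y → z.length ≤ ρ'.length := by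
      let P : ℕ → Prop := fun n => EE ψ i low ρ0 (y.take n)
      have hP : P ρ.length := by
        show EE ψ i low ρ0 (y.take ρ.length)
        rw [← List.prefix_iff_eq_take.1 hρy]; exact hρ
      have hsp := Nat.findGreatest_spec hρy.length_le hP
      refine ⟨y.take (Nat.findGreatest P y.length), hsp, take_prefix_le _ _, ?_⟩
      intro z hz hzy
      rw [List.length_take, min_eq_left (Nat.findGreatest_le _)]
      refine Nat.le_findGreatest hzy.length_le ?_
      show EE ψ i low ρ0 (y.take z.length)
      rw [← List.prefix_iff_eq_take.1 hzy]; exact hz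
    have hnext : ∀ Y ∈ PP ψ y, Y ∈ NN ψ i low ρ0 → ∃ z t, EE ψ i low ρ0 z ∧ Y ∈ PP ψ z ∧ z.length = t + 1 ∧ NextT ψ i low.length ρ' t ∧ y.length < z.length := by
      intro Y hY hYN
      obtain ⟨z, t, e1, e2, e3, e4, -⟩ := next_along hψ hYN h1 ((treeFam_PP hψ).anti _ _ h2 hY)
      refine ⟨z, t, e1, e2, e3, e4, ?_⟩
      by_contra hc
      have := h3 z e1 (PP_prefix_le hψ e2 hY (by omega))
      have := e4.1
      omega
    obtain ⟨z0, t, -, -, e3, e4, e5⟩ := hnext X hX hXN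
    have hT := lemmaT hψ (C := 2 ^ (i + 2)) (l := t + 1) Nat.one_le_two_pow (t + 1 - y.length) y a (by omega) (by
      intro z b hz hyz hb
      obtain ⟨b', hb', hb''⟩ := hb.prefix_le hyz
      rw [ha.unique hb'']; exact hb')
    rw [wt_eq ha]
    refine hT.trans ?_
    rw [mul_assoc]
    push_cast
    gcongr
    refine sumL hψ (meas_NN hψ) (NN_sub_DD hψ _) hK y ?_
    intro z hz hyz hzact
    by_cases hemp : ∀ X ∈ PP ψ z, X ∉ NN ψ i low ρ0
    · exact le_diff_of_disjoint hK _ hemp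
    · push Not at hemp
      obtain ⟨Y, hY, hYN⟩ := hemp
      obtain ⟨z1, t1, g1, g2, g3, g4, -⟩ := hnext Y ((treeFam_PP hψ).anti _ _ hyz hY) hYN
      have hl : z1.length = z.length := by rw [hz, g3, g4.unique e4]
      have : z1 = z := (PP_prefix_le hψ g2 hY hl.le).eq_of_length hl
      subst this
      exact knode hψ g1 hzact

theorem local_bound (hψ : Good ψ) {ρ : List Bool} (hρ : EE ψ i low ρ0 ρ) :
    lam (PP ψ ρ) ≤ 2 ^ (i + 2) * (2 ^ (i + 2) * 2 ^ (low.length + i + 4)) * lam (PP ψ ρ \ NN ψ i low ρ0) := by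
  refine PP_le hψ ρ.length fun t0 ht0 => ?_
  refine (lemmaT hψ (C := 2 ^ (i + 2)) (l := t0 + 1) Nat.one_le_two_pow (t0 + 1 - ρ.length) ρ t0 (by omega) ?_).trans ?_
  · intro y a hy _ ha
    have := ha.1; omega
  · rw [mul_assoc]
    push_cast
    gcongr
    refine sumL hψ (meas_NN hψ) (NN_sub_DD hψ _) ?_ ρ fun z _ hz hact => ynode hψ hρ hz hact
    exact one_le_mul_of_one_le_of_one_le (one_le_pow₀ (by norm_num)) (one_le_pow₀ (by norm_num))

theorem lam_OE_le (hψ : Good ψ) (k : ℕ) :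
    lam (OE ψ i low ρ0 k) ≤ 2 ^ (i + 2) * (2 ^ (i + 2) * 2 ^ (low.length + i + 4)) * lam (OE ψ i low ρ0 k \ NN ψ i low ρ0) := by
  have := group2 (treeFam_PP hψ) ((treeFam_PP hψ).inter (meas_NN (i := i) (low := low) (ρ0 := ρ0) hψ).compl) lam
    (((2 : ℝ≥0∞) ^ (i + 2) * (2 ^ (i + 2) * 2 ^ (low.length + i + 4))) • lam) (BE ψ i low ρ0 k) (by
      intro β hβ
      rw [Measure.smul_apply, smul_eq_mul, ← Set.sdiff_eq]
      exact local_bound hψ hβ.1.1)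
  rw [Measure.smul_apply, smul_eq_mul] at this
  refine this.trans ?_
  gcongr
  rw [Set.sdiff_eq, OE, Set.iUnion₂_inter]

theorem lam_NN (hψ : Good ψ) : Filter.Tendsto (fun k => lam (OE ψ i low ρ0 k)) Filter.atTop (nhds 0) := by
  have h1 : Filter.Tendsto (fun k => lam (OE ψ i low ρ0 k)) Filter.atTop (nhds (lam (NN ψ i low ρ0))) :=
    tendsto_measure_iInter_atTop (fun k => (meas_OE hψ k).nullMeasurableSet) OE_anti ⟨0, measure_ne_top _ _⟩
  have h2 : Filter.Tendsto (fun k => lam (OE ψ i low ρ0 k \ NN ψ i low ρ0)) Filter.atTop (nhds 0) := by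
    have := tendsto_measure_iInter_atTop (μ := lam) (s := fun k => OE ψ i low ρ0 k \ NN ψ i low ρ0)
      (fun k => ((meas_OE hψ k).diff (meas_NN hψ)).nullMeasurableSet) (fun k k' h => Set.sdiff_subset_sdiff_left (OE_anti h)) ⟨0, measure_ne_top _ _⟩
    have he : ⋂ k, OE ψ i low ρ0 k \ NN ψ i low ρ0 = ∅ := by
      refine Set.eq_empty_iff_forall_notMem.2 fun X hX => ?_
      rw [Set.mem_iInter] at hX
      exact (hX 0).2 (Set.mem_iInter.2 fun k => (hX k).1)
    rwa [he, measure_empty] at this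
  have h3 : Filter.Tendsto (fun k => (2 : ℝ≥0∞) ^ (i + 2) * (2 ^ (i + 2) * 2 ^ (low.length + i + 4)) * lam (OE ψ i low ρ0 k \ NN ψ i low ρ0)) Filter.atTop (nhds 0) := by
    have := ENNReal.Tendsto.const_mul (a := (2 : ℝ≥0∞) ^ (i + 2) * (2 ^ (i + 2) * 2 ^ (low.length + i + 4))) h2
      (Or.inr (ENNReal.mul_ne_top (by simp) (ENNReal.mul_ne_top (by simp) (by simp))))
    rwa [mul_zero] at this
  exact tendsto_of_tendsto_of_tendsto_of_le_of_le tendsto_const_nhds h3 (fun k => bot_le) (fun k => lam_OE_le hψ k)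

end

end PartB8

section PartB9
open Encodable MeasureTheory

variable {ψ : List Bool → List Bool}

/-! ### The restart test -/

/-- Boolean version of `EE`. -/
def eeB (ψ : List Bool → List Bool) (i : ℕ) (low : List (Option (List Bool))) (ρ0 z : List Bool) : Bool :=
  (pfx ρ0 z && allp z (fun y => !pfx ρ0 y || decide ((SS ψ i y).1.take low.length = low))) &&
    (decide ((SS ψ i z).2.1 = z) && decide ((SS ψ i z).1 = low))

theorem eeB_iff {i : ℕ} {low : List (Option (List Bool))} {ρ0 z : List Bool} : eeB ψ i low ρ0 z = true ↔ EE ψ i low ρ0 z := by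
  simp only [eeB, Bool.and_eq_true, pfx_iff, allp_iff, Bool.or_eq_true, decide_eq_true_eq, EE, Bool.not_eq_true']
  have h1 : ∀ y, (SS ψ i y).1.take low.length = low ↔ low <+: (SS ψ i y).1 := fun y => by
    rw [List.prefix_iff_eq_take, eq_comm]
  have h2 : ∀ y, pfx ρ0 y = false ↔ ¬ ρ0 <+: y := fun y => by
    rw [← pfx_iff]; simp
  simp only [h1, h2]
  constructor
  · rintro ⟨⟨a, b⟩, c, d⟩
    exact ⟨a, fun y hy hyz => (b y hyz).resolve_left (not_not.2 hy), c, d⟩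
  · rintro ⟨a, b, c, d⟩
    refine ⟨⟨a, fun y hyz => ?_⟩, c, d⟩
    by_cases hy : ρ0 <+: y
    · exact Or.inr (b y hy hyz)
    · exact Or.inl hy

theorem prim_eeB (hψ : Primrec ψ) (i : ℕ) (low : List (Option (List Bool))) (ρ0 : List Bool) : Primrec (eeB ψ i low ρ0) := by
  have hS : Primrec fun y : List Bool => SS ψ i y := (prim_SS hψ).comp (Primrec.const i) Primrec.id
  have hS1 : Primrec fun y : List Bool => (SS ψ i y).1 := Primrec.fst.comp hS
  have hS2 : Primrec fun y : List Bool => (SS ψ i y).2.1 := Primrec.fst.comp (Primrec.snd.comp hS)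
  have hp : Primrec fun y : List Bool => pfx ρ0 y := prim_pfx (Primrec.const ρ0) Primrec.id
  have h1 : Primrec fun y : List Bool => (SS ψ i y).1.take low.length := Primrec.list_take.comp (Primrec.const _) hS1
  have h2 : Primrec fun y : List Bool => decide ((SS ψ i y).1.take low.length = low) := Primrec.eq.decide.comp h1 (Primrec.const low)
  have h3 : Primrec fun y : List Bool => !pfx ρ0 y || decide ((SS ψ i y).1.take low.length = low) :=
    Primrec.or.comp (Primrec.not.comp hp) h2
  have h4 : Primrec fun z : List Bool => allp z (fun y => !pfx ρ0 y || decide ((SS ψ i y).1.take low.length = low)) :=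
    prim_allp (f := fun z : List Bool => z) (q := fun _ y => !pfx ρ0 y || decide ((SS ψ i y).1.take low.length = low)) Primrec.id
      (h3.comp Primrec.snd)
  have h5 : Primrec fun z : List Bool => decide ((SS ψ i z).2.1 = z) := Primrec.eq.decide.comp hS2 Primrec.id
  have h6 : Primrec fun z : List Bool => decide ((SS ψ i z).1 = low) := Primrec.eq.decide.comp hS1 (Primrec.const low)
  exact Primrec.and.comp (Primrec.and.comp hp h4) (Primrec.and.comp h5 h6)

/-- Decidable approximation to `OE`. -/
def oB (ψ : List Bool → List Bool) (i : ℕ) (low : List (Option (List Bool))) (ρ0 : List Bool) (k : ℕ) (x : List Bool) : Bool :=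
  !allp (ψ x) fun z => !(eeB ψ i low ρ0 z && (decide (k ≤ z.length) && (aOpt ψ (2 ^ (i + 2)) x.length z).isSome))

section
variable {i : ℕ} {low : List (Option (List Bool))} {ρ0 : List Bool}

theorem oB_iff {k : ℕ} {x : List Bool} : oB ψ i low ρ0 k x = true ↔
    ∃ z, z <+: ψ x ∧ EE ψ i low ρ0 z ∧ k ≤ z.length ∧ (aOpt ψ (2 ^ (i + 2)) x.length z).isSome := by
  rw [oB, Bool.not_eq_true', ← Bool.not_eq_true, allp_iff]
  simp [eeB_iff, Option.isSome_iff_ne_none]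

theorem prim_oB (hψ : Primrec ψ) (i : ℕ) (low : List (Option (List Bool))) (ρ0 : List Bool) : Primrec₂ (oB ψ i low ρ0) := by
  have hz : Primrec fun q : (ℕ × List Bool) × List Bool => q.2 := Primrec.snd
  have hx : Primrec fun q : (ℕ × List Bool) × List Bool => q.1.2 := Primrec.snd.comp Primrec.fst
  have hk : Primrec fun q : (ℕ × List Bool) × List Bool => q.1.1 := Primrec.fst.comp Primrec.fst
  have h1 : Primrec fun q : (ℕ × List Bool) × List Bool => eeB ψ i low ρ0 q.2 := (prim_eeB hψ i low ρ0).comp hz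
  have h2 : Primrec fun q : (ℕ × List Bool) × List Bool => decide (q.1.1 ≤ q.2.length) :=
    Primrec.nat_le.decide.comp hk (Primrec.list_length.comp hz)
  have h3 : Primrec fun q : (ℕ × List Bool) × List Bool => (((2 ^ (i + 2), q.1.2.length), q.2) : (ℕ × ℕ) × List Bool) :=
    Primrec.pair (Primrec.pair (Primrec.const _) (Primrec.list_length.comp hx)) hz
  have h4 : Primrec fun q : (ℕ × List Bool) × List Bool => aOpt ψ (2 ^ (i + 2)) q.1.2.length q.2 := (prim_aOpt hψ).comp h3
  have h5 : Primrec fun q : (ℕ × List Bool) × List Bool => (aOpt ψ (2 ^ (i + 2)) q.1.2.length q.2).isSome := Primrec.option_isSome.comp h4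
  have h6 : Primrec fun q : (ℕ × List Bool) × List Bool =>
      !(eeB ψ i low ρ0 q.2 && (decide (q.1.1 ≤ q.2.length) && (aOpt ψ (2 ^ (i + 2)) q.1.2.length q.2).isSome)) :=
    Primrec.not.comp (Primrec.and.comp h1 (Primrec.and.comp h2 h5))
  have h7 : Primrec fun p : ℕ × List Bool => ψ p.2 := hψ.comp Primrec.snd
  exact Primrec.not.comp (prim_allp h7 h6)

theorem oB_mono (hψ : Good ψ) {k : ℕ} {x x' : List Bool} (h : x <+: x') (hx : oB ψ i low ρ0 k x = true) : oB ψ i low ρ0 k x' = true := by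
  rw [oB_iff] at *
  obtain ⟨z, h1, h2, h3, h4⟩ := hx
  exact ⟨z, h1.trans (hψ.mono _ _ h), h2, h3, aOpt_isSome_mono h.length_le h4⟩

theorem OE_eq (hψ : Good ψ) (k : ℕ) : OE ψ i low ρ0 k = ⋃ n, {X | oB ψ i low ρ0 k (pre X n) = true} := by
  ext X
  rw [mem_OE, Set.mem_iUnion]
  simp only [Set.mem_ofPred_eq, oB_iff, pre_length]
  constructor
  · rintro ⟨z, ⟨h1, h2, a, ha⟩, h3⟩
    obtain ⟨s, hs⟩ := mem_PP.1 h3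
    refine ⟨max s a, z, hs.trans (hψ.mono _ _ (pre_prefix_le X (le_max_left s a))), h1, h2, ?_⟩
    rw [aOpt_eq_some.2 ⟨le_max_right s a, ha⟩]; rfl
  · rintro ⟨n, z, h1, h2, h3, h4⟩
    obtain ⟨a, ha⟩ := Option.isSome_iff_exists.1 h4
    exact ⟨z, ⟨h2, h3, a, (aOpt_eq_some.1 ha).2⟩, mem_PP.2 ⟨n, h1⟩⟩

theorem count_iff (p : List Bool → Bool) (n j : ℕ) :
    (strs n).countP p * 2 ^ (j + 1) ≤ 2 ^ n ↔ lam {X | p (pre X n) = true} ≤ (2⁻¹ : ℝ≥0∞) ^ (j + 1) := by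
  rw [lam_pre]
  have hp : ∀ n : ℕ, (2 : ℝ≥0∞) ^ n ≠ 0 := fun n => by simp
  have ht : ∀ n : ℕ, (2 : ℝ≥0∞) ^ n ≠ ⊤ := fun n => by simp
  have hi : ∀ n : ℕ, (2⁻¹ : ℝ≥0∞) ^ n * 2 ^ n = 1 := fun n => by
    rw [← mul_pow, ENNReal.inv_mul_cancel (by simp) (by simp), one_pow]
  rw [← ENNReal.mul_le_mul_iff_left (hp n) (ht n), ← ENNReal.mul_le_mul_iff_left (hp (j + 1)) (ht (j + 1))]
  have e1 : ((strs n).countP p : ℝ≥0∞) * (2⁻¹) ^ n * 2 ^ n * 2 ^ (j + 1) = (strs n).countP p * 2 ^ (j + 1) := by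
    rw [mul_assoc ((strs n).countP p : ℝ≥0∞), hi, mul_one]
  have e2 : (2⁻¹ : ℝ≥0∞) ^ (j + 1) * 2 ^ n * 2 ^ (j + 1) = 2 ^ n := by
    calc (2⁻¹ : ℝ≥0∞) ^ (j + 1) * 2 ^ n * 2 ^ (j + 1) = (2⁻¹ : ℝ≥0∞) ^ (j + 1) * 2 ^ (j + 1) * 2 ^ n := by ring
      _ = _ := by rw [hi, one_mul]
  rw [e1, e2]
  exact_mod_cast Iff.rfl

/-- The restart test. -/
def resV (ψ : List Bool → List Bool) (i : ℕ) (low : List (Option (List Bool))) (ρ0 : List Bool) (j : ℕ) : Set (List Bool) :=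
  {x | ∃ k, ∀ n, ((strs n).countP (oB ψ i low ρ0 k) * 2 ^ (j + 1) ≤ 2 ^ n) ∧ oB ψ i low ρ0 k x = true}

theorem resV_ce (hψ : Good ψ) : UniformCEIn zeroJump (resV ψ i low ρ0) := by
  let R : (ℕ × List Bool) × ℕ → ℕ → Bool := fun p n =>
    decide ((strs n).countP (oB ψ i low ρ0 p.2) * 2 ^ (p.1.1 + 1) ≤ 2 ^ n) && oB ψ i low ρ0 p.2 p.1.2
  have hR : Primrec₂ R := by
    have hn : Primrec fun q : ((ℕ × List Bool) × ℕ) × ℕ => q.2 := Primrec.snd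
    have hk : Primrec fun q : ((ℕ × List Bool) × ℕ) × ℕ => q.1.2 := Primrec.snd.comp Primrec.fst
    have hj : Primrec fun q : ((ℕ × List Bool) × ℕ) × ℕ => q.1.1.1 := Primrec.fst.comp (Primrec.fst.comp Primrec.fst)
    have hx : Primrec fun q : ((ℕ × List Bool) × ℕ) × ℕ => q.1.1.2 := Primrec.snd.comp (Primrec.fst.comp Primrec.fst)
    have hs : Primrec fun q : ((ℕ × List Bool) × ℕ) × ℕ => strs q.2 := prim_strs.comp hn
    have ho : Primrec₂ fun (q : ((ℕ × List Bool) × ℕ) × ℕ) (x : List Bool) => oB ψ i low ρ0 q.1.2 x :=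
      (prim_oB hψ.prim i low ρ0).comp (hk.comp Primrec.fst) Primrec.snd
    have hc : Primrec fun q : ((ℕ × List Bool) × ℕ) × ℕ => (strs q.2).countP (oB ψ i low ρ0 q.1.2) := prim_countP hs ho
    have hp1 : Primrec fun q : ((ℕ × List Bool) × ℕ) × ℕ => 2 ^ (q.1.1.1 + 1) := prim_pow.comp (Primrec.const 2) (Primrec.succ.comp hj)
    have hp2 : Primrec fun q : ((ℕ × List Bool) × ℕ) × ℕ => 2 ^ q.2 := prim_pow.comp (Primrec.const 2) hn
    have hm : Primrec fun q : ((ℕ × List Bool) × ℕ) × ℕ => (strs q.2).countP (oB ψ i low ρ0 q.1.2) * 2 ^ (q.1.1.1 + 1) := Primrec.nat_mul.comp hc hp1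
    have hd : Primrec fun q : ((ℕ × List Bool) × ℕ) × ℕ => decide ((strs q.2).countP (oB ψ i low ρ0 q.1.2) * 2 ^ (q.1.1.1 + 1) ≤ 2 ^ q.2) :=
      Primrec.nat_le.decide.comp hm hp2
    have he : Primrec fun q : ((ℕ × List Bool) × ℕ) × ℕ => oB ψ i low ρ0 q.1.2 q.1.1.2 := (prim_oB hψ.prim i low ρ0).comp hk hx
    exact Primrec.and.comp hd he
  refine sigma2_uniformCE hR fun j σ => ?_
  simp only [resV, Set.mem_ofPred_eq, R, Bool.and_eq_true, decide_eq_true_eq]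

theorem OE_small (hψ : Good ψ) {k j : ℕ} : (∀ n, (strs n).countP (oB ψ i low ρ0 k) * 2 ^ (j + 1) ≤ 2 ^ n) ↔
    lam (OE ψ i low ρ0 k) ≤ (2⁻¹ : ℝ≥0∞) ^ (j + 1) := by
  simp only [count_iff]
  have hm : Monotone fun n => {X | oB ψ i low ρ0 k (pre X n) = true} := fun n n' h X hX => oB_mono hψ (pre_prefix_le X h) hX
  rw [OE_eq hψ, hm.measure_iUnion, iSup_le_iff]

theorem resV_meas (hψ : Good ψ) (j : ℕ) : stringMeasure (resV ψ i low ρ0 j) < (2 : ℝ≥0∞)⁻¹ ^ j := by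
  classical
  refine (stringMeasure_le _).trans_lt ?_
  have hlt : (2⁻¹ : ℝ≥0∞) ^ (j + 1) < 2⁻¹ ^ j := by
    rw [pow_succ, ← div_eq_mul_inv]
    exact ENNReal.half_lt_self (by simp) (by simp)
  refine lt_of_le_of_lt ?_ hlt
  by_cases hex : ∃ k, ∀ n, (strs n).countP (oB ψ i low ρ0 k) * 2 ^ (j + 1) ≤ 2 ^ n
  · refine le_trans (measure_mono ?_) ((OE_small hψ).1 (Nat.find_spec hex))
    rintro X ⟨σ, ⟨k, hk⟩, hσ⟩
    refine OE_anti (Nat.find_min' hex fun n => (hk n).1) ?_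
    rw [OE_eq hψ]
    refine Set.mem_iUnion.2 ⟨σ.length, ?_⟩
    show oB ψ i low ρ0 k (pre X σ.length) = true
    rw [pre_eq_iff.2 hσ]; exact (hk 0).2
  · have : openOf (resV ψ i low ρ0 j) = ∅ := by
      refine Set.eq_empty_iff_forall_notMem.2 ?_
      rintro X ⟨σ, ⟨k, hk⟩, -⟩
      exact hex ⟨k, fun n => (hk n).1⟩
    rw [this, measure_empty]; exact bot_le

theorem notMem_NN (hψ : Good ψ) {A : ℕ → Bool} (hA : TwoRandom A) : A ∉ NN ψ i low ρ0 := by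
  intro hAN
  obtain ⟨j, hj⟩ := hA (resV ψ i low ρ0) ⟨resV_ce hψ, resV_meas hψ⟩
  apply hj
  have hpos : (0 : ℝ≥0∞) < (2⁻¹ : ℝ≥0∞) ^ (j + 1) := by
    apply ENNReal.pow_pos; simp
  obtain ⟨k, hk⟩ := ((lam_NN (i := i) (low := low) (ρ0 := ρ0) hψ).eventually_lt_const hpos).exists
  have hA' := Set.mem_iInter.1 hAN k
  rw [OE_eq hψ] at hA'
  obtain ⟨n, hn⟩ := Set.mem_iUnion.1 hA'
  refine ⟨pre A n, ⟨k, fun m => ⟨(OE_small hψ).2 hk.le m, hn⟩⟩, pre_eq_iff.1 (by rw [pre_length])⟩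

end

end PartB9

section PartB10
open Encodable MeasureTheory

variable {ψ : List Bool → List Bool}

/-! ### The verification -/

section
variable {i : ℕ} {A M : ℕ → Bool}

theorem mem_PP_pre (hψ : Good ψ) (h1 : ∀ k, ψ (pre A k) = pre M (ψ (pre A k)).length) (h2 : ∀ n, ∃ k, n ≤ (ψ (pre A k)).length)
    (n : ℕ) : A ∈ PP ψ (pre M n) := by
  obtain ⟨k, hk⟩ := h2 n
  refine mem_PP.2 ⟨k, ?_⟩
  rw [h1]; exact pre_prefix_le M hk

theorem take_pre {n m : ℕ} (h : n ≤ m) : (pre M m).take n = pre M n := by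
  have := List.prefix_iff_eq_take.1 (pre_prefix_le M h)
  rw [pre_length] at this; exact this.symm

theorem act_pre (h1 : ∀ k, ψ (pre A k) = pre M (ψ (pre A k)).length) (h2 : ∀ n, ∃ k, n ≤ (ψ (pre A k)).length)
    (hi : A ∉ openOf (lossV ψ i)) (n : ℕ) : Act ψ (2 ^ (i + 2)) (pre M n) := by
  rw [act_iff]
  intro hn
  obtain ⟨k, hk⟩ := h2 n
  refine hi ⟨pre A k, ⟨0, n, 0, 0, fun b => ?_⟩, pre_eq_iff.1 (by rw [pre_length])⟩
  rw [h1 k, lossR, take_pre hk]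
  simp only [decide_true, cond_true, test1, Bool.or_eq_true, decide_eq_true_eq, Bool.not_eq_true']
  by_cases hb : b < (pre M n).length
  · exact Or.inl hb
  · exact Or.inr (hn b (by omega))

theorem no_stuck (h1 : ∀ k, ψ (pre A k) = pre M (ψ (pre A k)).length) (h2 : ∀ n, ∃ k, n ≤ (ψ (pre A k)).length)
    (hi : A ∉ openOf (lossV ψ i)) {n m s0 : ℕ} (hf : (SS ψ i (pre M n)).2.1 = pre M n)
    (hs : ∀ t, succL (SS ψ i (pre M n)).1.length (SS ψ i (pre M n)).2.2 t = none)
    (ht : ∀ t, trig (SS ψ i (pre M n)).1 t = none)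
    (hr : ∀ s, s0 ≤ s → rr ψ i (SS ψ i (pre M n)).1.length (pre M n) s = pre M m) : False := by
  obtain ⟨a, ha⟩ := act_pre h1 h2 hi n
  obtain ⟨k, hk⟩ := h2 (max n (m + 1))
  refine hi ⟨pre A k, ⟨1, n, m, max s0 a, fun b => ?_⟩, pre_eq_iff.1 (by rw [pre_length])⟩
  rw [lossR, h1 k, take_pre (by omega), take_pre (by omega)]
  have hao : aOpt ψ (2 ^ (i + 2)) (max s0 a) (pre M n) = some a := aOpt_eq_some.2 ⟨le_max_right _ _, ha⟩
  have hb : b < max s0 a ∨ rr ψ i (SS ψ i (pre M n)).1.length (pre M n) b = pre M m := by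
    rcases lt_or_ge b (max s0 a) with h | h
    · exact Or.inl h
    · exact Or.inr (hr b (by omega))
  have hm : m < (ψ (pre A k)).length := by omega
  simp only [one_ne_zero, decide_false, cond_false, pre_length, hm, decide_true, Bool.true_and]
  simp only [test2, hf, hao, hs b, ht b, Option.isSome_some, Option.isNone_none, decide_true, Bool.true_and, Bool.or_eq_true, decide_eq_true_eq]
  simpa using hb

theorem bounded_stable {i e : ℕ} {z : List Bool} {n : ℕ} (h : ∀ s, (rr ψ i e z s).length ≤ n) :
    ∃ s0, ∀ s, s0 ≤ s → rr ψ i e z s = rr ψ i e z s0 := by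
  classical
  have hex : ∃ m s, n - (rr ψ i e z s).length = m := ⟨_, 0, rfl⟩
  obtain ⟨s0, hs0⟩ := Nat.find_spec hex
  refine ⟨s0, fun s hs => ((rr_mono hs).eq_of_length_le ?_).symm⟩
  have h3 := Nat.find_min' hex ⟨s, rfl⟩
  have := h s
  have := h s0
  omega

theorem claim_step (hψ : Good ψ) (h1 : ∀ k, ψ (pre A k) = pre M (ψ (pre A k)).length) (h2 : ∀ n, ∃ k, n ≤ (ψ (pre A k)).length)
    (hi : A ∉ openOf (lossV ψ i)) (hA : TwoRandom A) (hM : ¬ ComputableSeq M) {low : List (Option (List Bool))} {n0 : ℕ}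
    (hlow : ∀ n, n0 ≤ n → low <+: (SS ψ i (pre M n)).1) :
    ∃ o n1, ∀ n, n1 ≤ n → low ++ [o] <+: (SS ψ i (pre M n)).1 := by
  by_cases hinf : ∀ N, ∃ n, N ≤ n ∧ (SS ψ i (pre M n)).1 = low ∧ (SS ψ i (pre M n)).2.1 = pre M n
  · exfalso
    refine notMem_NN (i := i) (low := low) (ρ0 := pre M n0) hψ hA (Set.mem_iInter.2 fun k => mem_OE.2 ?_)
    obtain ⟨n, hn, e1, e2⟩ := hinf (max k n0)
    refine ⟨pre M n, ⟨⟨pre_prefix_le M (by omega), ?_, e2, e1⟩, by simp; omega, act_pre h1 h2 hi n⟩, mem_PP_pre hψ h1 h2 n⟩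
    intro y hy hyn
    rw [prefix_pre hyn]
    refine hlow _ ?_
    simpa using hy.length_le
  push Not at hinf
  obtain ⟨N0, hN0⟩ := hinf
  obtain ⟨N, hN, hnf⟩ : ∃ N, n0 ≤ N ∧ ∀ n, N ≤ n → (SS ψ i (pre M n)).1 = low → (SS ψ i (pre M n)).2.1 ≠ pre M n :=
    ⟨max n0 N0, le_max_left _ _, fun n hn => hN0 n (by omega)⟩
  by_cases hlen : ∃ n, N ≤ n ∧ low.length < (SS ψ i (pre M n)).1.length
  · obtain ⟨n, hn, hl⟩ := hlen
    refine ⟨(SS ψ i (pre M n)).1[low.length], n, fun m hm => ?_⟩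
    generalize ho : (SS ψ i (pre M n)).1[low.length] = o
    induction hm with
    | refl =>
      have this := List.prefix_iff_eq_take.1 (hlow n (by omega))
      have e : low ++ [o] = (SS ψ i (pre M n)).1.take (low.length + 1) := by
        rw [← List.take_append_getElem hl, ho]
        exact congrArg (· ++ [o]) this
      rw [e]
      exact take_prefix_le _ _
    | step hm ih =>
      rename_i m
      have hle : n ≤ m := hm
      have hl' := hlow (m + 1) (by omega)
      have hnf' := hnf (m + 1) (by omega)
      show low ++ [o] <+: (SS ψ i (pre M (m + 1))).1
      rw [pre_succ] at hl' hnf' ⊢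
      rcases SS_cases (ψ := ψ) i (pre M m) (M m) with ⟨j, g1, h⟩ | ⟨ht', ⟨η, hη, ⟨-, h⟩ | ⟨-, h⟩⟩ | ⟨hs, ⟨-, h⟩ | ⟨-, h⟩⟩⟩
      · rw [h] at hl' hnf' ⊢
        simp only at hl' hnf' ⊢
        have hj : low.length ≤ j := by
          have := hl'.length_le
          simp at this; omega
        rcases hj.eq_or_lt with he | hlt
        · exfalso
          subst he
          exact hnf' (List.prefix_iff_eq_take.1 ((List.prefix_append _ _).trans ih)).symm rfl
        · exact prefix_take ih (by simp; omega)
      · rw [h]; exact ih.trans (List.prefix_append _ _)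
      · rw [h]; exact ih
      · rw [h]; exact ih
      · rw [h]; exact ih.trans (List.prefix_append _ _)
  · exfalso
    push Not at hlen
    have heq : ∀ n, N ≤ n → (SS ψ i (pre M n)).1 = low := fun n hn =>
      ((hlow n (by omega)).eq_of_length_le (hlen n hn)).symm
    have hstep : ∀ n, N ≤ n → SS ψ i (pre M (n + 1)) = SS ψ i (pre M n) ∧ trig low n = none ∧
        succL low.length (SS ψ i (pre M n)).2.2 n = none ∧ rr ψ i low.length (SS ψ i (pre M n)).2.1 n <+: pre M (n + 1) := by
      intro n hn
      have e0 := heq n hn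
      have e1 := heq (n + 1) (by omega)
      have e2 := hnf (n + 1) (by omega) e1
      rw [pre_succ] at e1 e2 ⊢
      rcases SS_cases (ψ := ψ) i (pre M n) (M n) with ⟨j, g1, h⟩ | ⟨ht', ⟨η, hη, ⟨-, h⟩ | ⟨-, h⟩⟩ | ⟨hs, ⟨hr, h⟩ | ⟨-, h⟩⟩⟩
      · rw [h] at e2; exact absurd rfl e2
      · rw [h] at e2; exact absurd rfl e2
      · rw [h] at e2; exact absurd rfl e2
      · rw [e0, pre_length] at ht' hs hr
        exact ⟨h, ht', hs, hr⟩
      · rw [h] at e2; exact absurd rfl e2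
    have hconst : ∀ n, N ≤ n → SS ψ i (pre M n) = SS ψ i (pre M N) := by
      intro n hn
      induction hn with
      | refl => rfl
      | step hm ih => exact (hstep _ hm).1.trans ih
    obtain ⟨hz1, hz2⟩ := SS_node (ψ := ψ) i (pre M N)
    have hz3 := prefix_pre hz1
    set l := (SS ψ i (pre M N)).2.1.length with hl
    rw [hz3] at hz2
    have hlowz : (SS ψ i (pre M l)).1 = low := by rw [hz2]; exact heq N le_rfl
    have htrig : ∀ t, trig low t = none := by
      intro t
      cases hj : trig low t with
      | none => rfl
      | some j =>
        obtain ⟨⟨ζ, g1, g2⟩, -⟩ := trig_some hj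
        have g3 := succL_mono (le_max_left t N) g2
        rw [trig_none (hstep (max t N) (le_max_right _ _)).2.1 g1] at g3
        cases g3
    have hsucc : ∀ t, succL low.length (SS ψ i (pre M N)).2.2 t = none := by
      intro t
      cases hj : succL low.length (SS ψ i (pre M N)).2.2 t with
      | none => rfl
      | some η =>
        have g2 : (succL low.length (SS ψ i (pre M N)).2.2 t).isSome := by rw [hj]; rfl
        have g3 := succL_mono (le_max_left t N) g2
        have g4 := (hstep (max t N) (le_max_right _ _)).2.2.1
        rw [hconst _ (le_max_right _ _)] at g4
        rw [g4] at g3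
        cases g3
    have hrr : ∀ t, rr ψ i low.length (pre M l) t <+: pre M (max t N + 1) := by
      intro t
      have g4 := (hstep (max t N) (le_max_right _ _)).2.2.2
      rw [hconst _ (le_max_right _ _), hz3] at g4
      exact (rr_mono (le_max_left t N)).trans g4
    by_cases hbd : ∃ n, ∀ s, (rr ψ i low.length (pre M l) s).length ≤ n
    · obtain ⟨n, hn⟩ := hbd
      obtain ⟨s0, hs0⟩ := bounded_stable hn
      refine no_stuck h1 h2 hi (n := l) (m := (rr ψ i low.length (pre M l) s0).length) (s0 := s0) ?_ ?_ ?_ ?_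
      · rw [hz2]; exact hz3
      · intro t; rw [hlowz, hz2]; exact hsucc t
      · intro t; rw [hlowz]; exact htrig t
      · intro s hs
        rw [hlowz, hs0 s hs]
        exact prefix_pre (hrr s0)
    · push Not at hbd
      apply hM
      have hp : Primrec₂ fun (k n : ℕ) => (rr ψ i low.length (pre M l) k)[n]? := by
        have hk : Primrec fun q : ℕ × ℕ => q.1 := Primrec.fst
        have hr : Primrec fun q : ℕ × ℕ => rr ψ i low.length (pre M l) q.1 :=
          prim_rr' hψ.prim (Primrec.const i) (Primrec.const _) hk (Primrec.const _)
        exact Primrec.list_getElem?.comp hr Primrec.snd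
      refine computableSeq_of_search hp ?_ ?_
      · intro n
        obtain ⟨k, hk⟩ := hbd n
        refine ⟨k, ?_⟩
        rw [List.getElem?_eq_getElem hk]; rfl
      · intro n k b hb
        have g := getElem?_of_prefix_le (hrr k) hb
        have hlt : n < max k N + 1 := by
          by_contra hc
          rw [List.getElem?_eq_none (by simp; omega)] at g
          cases g
        rw [pre_getElem?, if_pos hlt] at g
        exact (Option.some.inj g).symm

theorem claim (hψ : Good ψ) (h1 : ∀ k, ψ (pre A k) = pre M (ψ (pre A k)).length) (h2 : ∀ n, ∃ k, n ≤ (ψ (pre A k)).length)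
    (hi : A ∉ openOf (lossV ψ i)) (hA : TwoRandom A) (hM : ¬ ComputableSeq M) (e : ℕ) :
    ∃ low : List (Option (List Bool)), low.length = e ∧ ∃ n0, ∀ n, n0 ≤ n → low <+: (SS ψ i (pre M n)).1 := by
  induction e with
  | zero => exact ⟨[], rfl, 0, fun n _ => nil_prefix_le⟩
  | succ e ih =>
    obtain ⟨low, hl, n0, h⟩ := ih
    obtain ⟨o, n1, h'⟩ := claim_step hψ h1 h2 hi hA hM h
    exact ⟨low ++ [o], by simp [hl], n1, h'⟩

theorem decide_req (hcl : ∀ e, ∃ low : List (Option (List Bool)), low.length = e ∧ ∃ n0, ∀ n, n0 ≤ n → low <+: (SS ψ i (pre M n)).1)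
    (e : ℕ) : ∃ n η, η <+: (SS ψ i (pre M n)).2.2 ∧ (Wset e η ∨ ∀ η', η <+: η' → ¬ Wset e η') := by
  obtain ⟨low, hl, n0, hlow⟩ := hcl (e + 1)
  have hinv := (SS_lowInv (ψ := ψ) i (pre M n0)).sub (hlow n0 le_rfl)
  have hle : e < low.length := by omega
  have hoe : low[e]? = some low[e] := List.getElem?_eq_getElem hle
  cases ho : low[e] with
  | none =>
    rw [ho] at hoe
    obtain ⟨η, g1, g2⟩ := hinv.2 e hoe
    exact ⟨n0, η, g1, Or.inl g2⟩
  | some ζ =>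
    rw [ho] at hoe
    refine ⟨n0, ζ, hinv.1 e ζ hoe, Or.inr fun η hη hW => ?_⟩
    obtain ⟨t, ht⟩ := succL_complete hη hW
    have ht' := succL_mono (le_max_left t n0) ht
    set n := max t n0 with hn
    have hn0 : n0 ≤ n := le_max_right _ _
    have hoe' := getElem?_of_prefix_le (hlow n hn0) hoe
    have hnext := hlow (n + 1) (by omega)
    rw [pre_succ] at hnext
    rcases SS_cases (ψ := ψ) i (pre M n) (M n) with ⟨j, g1, h⟩ | ⟨hnt, -⟩
    · rw [h] at hnext
      rw [pre_length] at g1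
      have hj : j ≤ e := by
        by_contra hc
        rw [(trig_some g1).2 e (by omega) ζ hoe'] at ht'
        cases ht'
      have := hnext.length_le
      simp at this; omega
    · rw [pre_length] at hnt
      rw [trig_none hnt hoe'] at ht'
      cases ht'

theorem final_generic (hψ : Good ψ) (hcl : ∀ e, ∃ low : List (Option (List Bool)), low.length = e ∧ ∃ n0, ∀ n, n0 ≤ n → low <+: (SS ψ i (pre M n)).1) :
    ∃ Z, Generic1 Z ∧ TRed Z M := by
  have hreq : ∀ c : Nat.Partrec.Code, ∃ n η, η <+: (SS ψ i (pre M n)).2.2 ∧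
      ((c.eval (encode η)).Dom ∨ ∀ η', η <+: η' → ¬ (c.eval (encode η')).Dom) := by
    intro c
    have := decide_req hcl (encode c)
    simpa only [Wset, Denumerable.ofNat_encode] using this
  have hunb : ∀ k, ∃ n, k ≤ (SS ψ i (pre M n)).2.2.length := by
    intro k
    have hR : Primrec₂ fun (σ : List Bool) (_ : ℕ) => decide (k ≤ σ.length) :=
      Primrec.nat_le.decide.comp (Primrec.const k) (Primrec.list_length.comp Primrec.fst)
    obtain ⟨c, hc⟩ := exists_code_re hR
    obtain ⟨n, η, g1, g2 | g2⟩ := hreq c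
    · rw [hc] at g2
      obtain ⟨-, g3⟩ := g2
      exact ⟨n, (of_decide_eq_true g3).trans g1.length_le⟩
    · exfalso
      apply g2 (η ++ List.replicate k false) (List.prefix_append _ _)
      rw [hc]
      exact ⟨0, by simp⟩
  choose f hf using fun k => hunb (k + 1)
  let Z : ℕ → Bool := fun n => ((SS ψ i (pre M (f n))).2.2)[n]?.getD false
  have hZ : ∀ m n b, ((SS ψ i (pre M m)).2.2)[n]? = some b → b = Z n := by
    intro m n b hb
    have e1 := getElem?_of_prefix_le (SS_out_mono (ψ := ψ) i (pre_prefix_le M (le_max_left m (f n)))) hb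
    have hlt : n < (SS ψ i (pre M (f n))).2.2.length := hf n
    have e2 := getElem?_of_prefix_le (SS_out_mono (ψ := ψ) i (pre_prefix_le M (le_max_right m (f n)))) (List.getElem?_eq_getElem hlt)
    rw [e1] at e2
    show b = ((SS ψ i (pre M (f n))).2.2)[n]?.getD false
    rw [List.getElem?_eq_getElem hlt, Option.getD_some]
    exact Option.some.inj e2
  have hpre : ∀ m, (SS ψ i (pre M m)).2.2 = pre Z (SS ψ i (pre M m)).2.2.length := by
    intro m
    refine List.ext_getElem? fun n => ?_
    rw [pre_getElem?]
    split_ifs with hn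
    · rw [List.getElem?_eq_getElem hn, hZ m n _ (List.getElem?_eq_getElem hn)]
    · exact List.getElem?_eq_none (by omega)
  refine ⟨Z, ?_, ?_⟩
  · intro c
    obtain ⟨n, η, g1, g2⟩ := hreq c
    rw [hpre] at g1
    have := prefix_pre g1
    refine ⟨η.length, ?_⟩
    rw [← this]; exact g2
  · have hp : Primrec₂ fun (x : List Bool) (n : ℕ) => ((SS ψ i x).2.2)[n]? := by
      have hS : Primrec fun q : List Bool × ℕ => SS ψ i q.1 := prim_SS' hψ.prim (Primrec.const i) Primrec.fst
      have hS2 : Primrec fun q : List Bool × ℕ => (SS ψ i q.1).2.2 := Primrec.snd.comp (Primrec.snd.comp hS)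
      exact Primrec.list_getElem?.comp hS2 Primrec.snd
    refine tred_of_search hp ?_ ?_
    · intro n
      refine ⟨f n, ?_⟩
      have hlt : n < (SS ψ i (pre M (f n))).2.2.length := hf n
      rw [List.getElem?_eq_getElem hlt]; rfl
    · intro n k b hb
      exact hZ k n b hb

end

theorem final_main (A M : ℕ → Bool) (hA : TwoRandom A) (hMA : TRed M A) : ¬ MinimalDeg M := by
  intro hmin
  obtain ⟨ψ, p1, p2, p3, h1, h2⟩ := exists_psi hMA
  have hψ : Good ψ := ⟨p1, p2, p3⟩
  obtain ⟨i, hi⟩ := hA _ (lossV_test hψ)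
  obtain ⟨Z, hZ, hZM⟩ := final_generic (i := i) (M := M) hψ (claim hψ h1 h2 hi hA hmin.1)
  exact not_minimal_of_generic hZ hZM hmin


end PartB10

/-- if a Turing degree is 2-random then it has no minimal
predecessors. -/
theorem twoRandom_no_minimal_predecessors (A M : ℕ → Bool)
    (hA : TwoRandom A) (hMA : TRed M A) : ¬ MinimalDeg M := by
  exact final_main A M hA hMA

end TypicalDegree
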